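/- Let λ be a nonzero real number and let u : ℝ³ → ℝ³ be a smooth vector field satisfying curl u = λ·u at every point of ℝ³. Then for every ε′ > 0, every natural number m, and every R > 0, there exists J₀ such that for every odd integer J ≥ J₀ there is a smooth vector field U : ℝ³ → ℝ³ which is 2π-periodic in each coordinate (U(x + 2πk) = U(x) for all k ∈ ℤ³, so U defines a Beltrami field on the flat torus 𝕋³), satisfies curl U = J·U at every point of ℝ³, and approximates u after rescaling: ‖D^j( x ↦ U((λ/J)·x) − u(x) )‖ ≤ ε′ for all x with ‖x‖ ≤ R and all 0 ≤ j ≤ m, where D^j denotes the j-th iterated (Fréchet) derivative. -/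

import Mathlib

noncomputable section

/-- Euclidean 3-space. -/
abbrev E3 := EuclideanSpace ℝ (Fin 3)

/-- Build a point of Euclidean 3-space from a plain function. -/
def toE3 (v : Fin 3 → ℝ) : E3 := (WithLp.equiv 2 (Fin 3 → ℝ)).symm v

/-- Partial derivative in the `i`-th coordinate direction. -/
def pd3 (i : Fin 3) (f : E3 → ℝ) (x : E3) : ℝ :=
  fderiv ℝ f x (EuclideanSpace.single i 1)

/-- Curl of a vector field on `E3`. -/
def curl3 (u : E3 → E3) (x : E3) : E3 :=
  toE3 ![pd3 1 (fun y => u y 2) x - pd3 2 (fun y => u y 1) x,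
         pd3 2 (fun y => u y 0) x - pd3 0 (fun y => u y 2) x,
         pd3 0 (fun y => u y 1) x - pd3 1 (fun y => u y 0) x]

section

open scoped Quaternion

/-- The Gaussian integers of norm `n`. -/
def gaussSphere (n : ℤ) : Set GaussianInt := {z | z.norm = n}

lemma GaussianInt.norm_eq_sq (z : GaussianInt) : z.norm = z.re ^ 2 + z.im ^ 2 := by
  simp [Zsqrtd.norm_def]; ring

lemma finite_gaussianInt_norm_le (n : ℤ) : {z : GaussianInt | z.norm ≤ n}.Finite := by
  have h : Set.Finite ((fun p : ℤ × ℤ => (⟨p.1, p.2⟩ : GaussianInt)) ''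
      (Set.Icc (-n) n ×ˢ Set.Icc (-n) n)) :=
    ((Set.finite_Icc _ _).prod (Set.finite_Icc _ _)).image _
  refine h.subset fun z hz => ⟨(z.re, z.im), ?_, rfl⟩
  simp only [Set.mem_ofPred_eq, GaussianInt.norm_eq_sq] at hz
  simp only [Set.mem_prod, Set.mem_Icc]
  refine ⟨⟨?_, ?_⟩, ?_, ?_⟩ <;> nlinarith [sq_nonneg z.re, sq_nonneg z.im,
    sq_nonneg (z.re - 1), sq_nonneg (z.im - 1), sq_nonneg (z.re + 1), sq_nonneg (z.im + 1)]

lemma finite_gaussSphere (n : ℤ) : (gaussSphere n).Finite :=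
  (finite_gaussianInt_norm_le n).subset fun _ hz => le_of_eq hz

lemma GaussianInt.dvd_of_dvd_norm_of_prime {w z : GaussianInt} (hw : Prime w)
    (h : w ∣ (z.norm : GaussianInt)) : w ∣ z ∨ star w ∣ z := by
  rw [Zsqrtd.norm_eq_mul_conj] at h
  rcases hw.dvd_or_dvd h with h | h
  · exact .inl h
  · right
    obtain ⟨c, hc⟩ := h
    refine ⟨star c, ?_⟩
    rw [← star_star z, hc, star_mul']

lemma ncard_gaussSphere_prime_pow_mul_le {p : ℕ} (hp : p.Prime) (a m : ℕ) (hm : ¬ p ∣ m) :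
    (gaussSphere ((p ^ a * m : ℕ) : ℤ)).ncard ≤ (a + 1) * (gaussSphere (m : ℤ)).ncard := by
  have hp0 : (p : ℤ) ≠ 0 := by exact_mod_cast hp.ne_zero
  have := Fact.mk hp
  suffices h : ∃ w : ℕ → GaussianInt, ∀ z : GaussianInt, z.norm = ((p ^ a * m : ℕ) : ℤ) →
      ∃ i ≤ a, ∃ z' : GaussianInt, z'.norm = m ∧ z = w i * z' by
    obtain ⟨w, hw⟩ := h
    calc (gaussSphere ((p ^ a * m : ℕ) : ℤ)).ncard
        ≤ (⋃ i ∈ Finset.range (a + 1), (fun z => w i * z) '' gaussSphere (m : ℤ)).ncard := by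
          refine Set.ncard_le_ncard ?_ ?_
          · intro z hz
            obtain ⟨i, hi, z', hz', rfl⟩ := hw z hz
            simp only [Set.mem_iUnion]
            exact ⟨i, Finset.mem_range.2 (by omega), z', hz', rfl⟩
          · exact Set.Finite.biUnion (Finset.finite_toSet _)
              fun i _ => (finite_gaussSphere _).image _
      _ ≤ ∑ i ∈ Finset.range (a + 1), ((fun z => w i * z) '' gaussSphere (m : ℤ)).ncard :=
          Finset.set_ncard_biUnion_le _ _
      _ ≤ ∑ i ∈ Finset.range (a + 1), (gaussSphere (m : ℤ)).ncard :=
          Finset.sum_le_sum fun i _ => Set.ncard_image_le (finite_gaussSphere _)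
      _ = _ := by simp
  by_cases hirr : Irreducible (p : GaussianInt)
  · refine ⟨fun i => (p : GaussianInt) ^ i, ?_⟩
    have hprime : Prime (p : GaussianInt) := hirr.prime
    induction a using Nat.strong_induction_on with
    | _ a ih =>
      intro z hz
      rcases Nat.eq_zero_or_pos a with rfl | ha
      · exact ⟨0, le_rfl, z, by simpa using hz, by simp⟩
      have hd : (p : GaussianInt) ∣ z := by
        have : (p : GaussianInt) ∣ (z.norm : GaussianInt) := by
          rw [hz]
          push_cast
          exact Dvd.dvd.mul_right (dvd_pow_self _ (by omega)) _
        rcases GaussianInt.dvd_of_dvd_norm_of_prime hprime this with h | h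
        · exact h
        · simpa using h
      obtain ⟨z', rfl⟩ := hd
      rw [Zsqrtd.norm_mul, Zsqrtd.norm_natCast] at hz
      obtain ⟨b, rfl⟩ : ∃ b, a = b + 1 := ⟨a - 1, by omega⟩
      have h1 : (p : ℤ) * z'.norm = ((p ^ b * m : ℕ) : ℤ) := by
        apply mul_left_cancel₀ hp0
        rw [← mul_assoc, hz]
        push_cast
        ring
      rcases Nat.eq_zero_or_pos b with rfl | hb
      · exfalso
        apply hm
        have : (p : ℤ) ∣ (m : ℤ) := ⟨_, by simpa using h1.symm⟩
        exact_mod_cast this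
      obtain ⟨c, rfl⟩ : ∃ c, b = c + 1 := ⟨b - 1, by omega⟩
      have h2 : z'.norm = ((p ^ c * m : ℕ) : ℤ) := by
        apply mul_left_cancel₀ hp0
        rw [h1]
        push_cast
        ring
      obtain ⟨i, hi, y, hy, rfl⟩ := ih c (by omega) z' h2
      exact ⟨i + 1, by omega, y, hy, by ring⟩
  · obtain ⟨x, y, hxy⟩ := GaussianInt.sq_add_sq_of_nat_prime_of_not_irreducible p hirr
    set w : GaussianInt := ⟨x, y⟩ with hw
    have hwn : w.norm = p := by
      rw [GaussianInt.norm_eq_sq]; simp [hw]; exact_mod_cast hxy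
    have hws : w * star w = p := by
      rw [← Zsqrtd.norm_eq_mul_conj, hwn]; simp
    have hwp : Prime w := by
      refine Irreducible.prime ⟨?_, ?_⟩
      · rw [← Zsqrtd.norm_eq_one_iff, hwn]
        simpa using hp.one_lt.ne'
      · intro s t hst
        have := congrArg (fun z => (Zsqrtd.norm z).natAbs) hst
        simp only [hwn, Zsqrtd.norm_mul, Int.natAbs_mul, Int.natAbs_natCast] at this
        rw [← Zsqrtd.norm_eq_one_iff, ← Zsqrtd.norm_eq_one_iff]
        have h3 := hp.isUnit_or_isUnit this
        simpa using h3
    have key : ∀ (a : ℕ) (z : GaussianInt), z.norm = ((p ^ a * m : ℕ) : ℤ) →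
        ∃ i ≤ a, ∃ z' : GaussianInt, z'.norm = m ∧ z = w ^ i * star w ^ (a - i) * z' := by
      intro a
      induction a with
      | zero => exact fun z hz => ⟨0, le_rfl, z, by simpa using hz, by simp⟩
      | succ a ih =>
        intro z hz
        have : w ∣ (z.norm : GaussianInt) := by
          rw [hz]
          push_cast
          refine Dvd.dvd.mul_right (dvd_trans ⟨star w, hws.symm⟩ (dvd_pow_self _ (by omega))) _
        have hcancel : ∀ z' : GaussianInt, (p : ℤ) * z'.norm = ((p ^ (a + 1) * m : ℕ) : ℤ) →
            z'.norm = ((p ^ a * m : ℕ) : ℤ) := by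
          intro z' h
          apply mul_left_cancel₀ hp0
          rw [h]
          push_cast
          ring
        rcases GaussianInt.dvd_of_dvd_norm_of_prime hwp this with ⟨z', rfl⟩ | ⟨z', rfl⟩
        · rw [Zsqrtd.norm_mul, hwn] at hz
          obtain ⟨i, hi, y, hy, rfl⟩ := ih z' (hcancel z' hz)
          refine ⟨i + 1, by omega, y, hy, ?_⟩
          rw [show a + 1 - (i + 1) = a - i by omega]
          ring
        · rw [Zsqrtd.norm_mul, Zsqrtd.norm_conj, hwn] at hz
          obtain ⟨i, hi, y, hy, rfl⟩ := ih z' (hcancel z' hz)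
          refine ⟨i, by omega, y, hy, ?_⟩
          rw [show a + 1 - i = a - i + 1 by omega]
          ring
    exact ⟨fun i => w ^ i * star w ^ (a - i), key a⟩

/-- The number of representations of `n` as a sum of two squares is `O(n ^ ε)`. -/
lemma exists_ncard_gaussSphere_le {ε : ℝ} (hε : 0 < ε) :
    ∃ C : ℝ, 1 ≤ C ∧ ∀ n : ℕ, 0 < n → ((gaussSphere (n : ℤ)).ncard : ℝ) ≤ C * (n : ℝ) ^ ε := by
  obtain ⟨K, hK1, hK⟩ : ∃ K : ℝ, 1 ≤ K ∧ ∀ a : ℕ, (a + 1 : ℝ) ≤ K * (2 : ℝ) ^ (a * ε) := by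
    have hlog : 0 < Real.log 2 * ε := by have := Real.log_pos one_lt_two; positivity
    refine ⟨1 + 1 / (Real.log 2 * ε), by simp; positivity, fun a => ?_⟩
    have h2 : (2 : ℝ) ^ (a * ε) = Real.exp (a * (Real.log 2 * ε)) := by
      rw [Real.rpow_def_of_pos two_pos]; ring_nf
    have h1 : 1 + a * (Real.log 2 * ε) ≤ (2 : ℝ) ^ (a * ε) := by
      rw [h2, add_comm]; exact Real.add_one_le_exp _
    have h3 : (0 : ℝ) ≤ a * (Real.log 2 * ε) := by positivity
    calc (a + 1 : ℝ) ≤ (1 + 1 / (Real.log 2 * ε)) * (1 + a * (Real.log 2 * ε)) := by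
          have : 1 / (Real.log 2 * ε) * (a * (Real.log 2 * ε)) = a := by field_simp
          have h5 : 0 < 1 / (Real.log 2 * ε) := by positivity
          nlinarith
      _ ≤ _ := by gcongr
  obtain ⟨P, hP⟩ := exists_nat_ge ((2 : ℝ) ^ (1 / ε))
  set k : ℕ → ℝ := fun p => if p < P then K else 1 with hk
  have hk1 : ∀ p, 1 ≤ k p := fun p => by simp only [hk]; split_ifs <;> simp [hK1]
  have hloc : ∀ p : ℕ, p.Prime → ∀ a : ℕ, (a + 1 : ℝ) ≤ k p * ((p : ℝ) ^ a) ^ ε := by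
    intro p hp a
    have hp2 : (2 : ℝ) ≤ p := by exact_mod_cast hp.two_le
    have hpa : ((p : ℝ) ^ a) ^ ε = (p : ℝ) ^ (a * ε) := by
      rw [Real.rpow_mul (by positivity), Real.rpow_natCast]
    rw [hpa]
    by_cases hpP : p < P
    · simp only [hk, hpP, if_true]
      refine (hK a).trans ?_
      gcongr
    · simp only [hk, hpP, if_false, one_mul]
      have : (2 : ℝ) ≤ (p : ℝ) ^ ε := by
        have h1 : (2 : ℝ) ^ (1 / ε) ≤ p := hP.trans (by exact_mod_cast not_lt.1 hpP)
        calc (2 : ℝ) = ((2 : ℝ) ^ (1 / ε)) ^ ε := by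
              rw [← Real.rpow_mul (by norm_num), one_div_mul_cancel hε.ne', Real.rpow_one]
          _ ≤ _ := by gcongr
      calc (a + 1 : ℝ) ≤ 2 ^ a := by exact_mod_cast Nat.lt_two_pow_self
        _ ≤ ((p : ℝ) ^ ε) ^ a := by gcongr
        _ = _ := by rw [← Real.rpow_natCast, ← Real.rpow_mul (by positivity), mul_comm]
  have hone : ((gaussSphere 1).ncard : ℝ) ≤ 9 := by
    have : (gaussSphere 1).ncard ≤ 9 := by
      calc (gaussSphere 1).ncard ≤ (((Finset.Icc (-1 : ℤ) 1 ×ˢ Finset.Icc (-1 : ℤ) 1).image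
            (fun p : ℤ × ℤ => (⟨p.1, p.2⟩ : GaussianInt)) : Finset GaussianInt) :
              Set GaussianInt).ncard := by
            refine Set.ncard_le_ncard ?_ (Finset.finite_toSet _)
            intro z hz
            simp only [gaussSphere, Set.mem_ofPred_eq, GaussianInt.norm_eq_sq] at hz
            simp only [Finset.coe_image, Set.mem_image, Finset.mem_coe, Finset.mem_product,
              Finset.mem_Icc]
            refine ⟨(z.re, z.im), ⟨⟨?_, ?_⟩, ?_, ?_⟩, rfl⟩ <;> simp only <;>
              nlinarith [sq_nonneg z.re, sq_nonneg z.im]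
        _ ≤ _ := by
            rw [Set.ncard_coe_finset]
            exact Finset.card_image_le
    exact_mod_cast this
  have main : ∀ n : ℕ, 0 < n → ((gaussSphere (n : ℤ)).ncard : ℝ) ≤
      9 * (∏ p ∈ n.primeFactors, k p) * (n : ℝ) ^ ε := by
    intro n
    induction n using Nat.recOnPrimePow with
    | zero => intro h; omega
    | one => intro _; simpa using hone
    | prime_pow_mul m p a hp hpm ha ihm =>
      intro _
      have hm0 : 0 < m := Nat.pos_of_ne_zero fun h => hpm (h ▸ dvd_zero p)
      have hpf : (p ^ a * m).primeFactors = insert p m.primeFactors := by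
        rw [Nat.primeFactors_mul (pow_ne_zero _ hp.ne_zero) hm0.ne',
          Nat.primeFactors_prime_pow ha.ne' hp]
        rfl
      rw [hpf, Finset.prod_insert fun h => hpm (Nat.dvd_of_mem_primeFactors h)]
      have h1 := ncard_gaussSphere_prime_pow_mul_le hp a m hpm
      have h0 : 0 ≤ k p := zero_le_one.trans (hk1 p)
      calc ((gaussSphere ((p ^ a * m : ℕ) : ℤ)).ncard : ℝ)
          ≤ (a + 1) * (gaussSphere (m : ℤ)).ncard := by exact_mod_cast h1
        _ ≤ (k p * ((p : ℝ) ^ a) ^ ε) * (9 * (∏ p ∈ m.primeFactors, k p) * (m : ℝ) ^ ε) := by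
          gcongr
          · exact hloc p hp a
          · exact ihm hm0
        _ = _ := by
          push_cast
          rw [Real.mul_rpow (by positivity) (by positivity)]
          ring
  refine ⟨9 * K ^ P, by nlinarith [one_le_pow₀ hK1 (n := P)], fun n hn => (main n hn).trans ?_⟩
  gcongr
  calc ∏ p ∈ n.primeFactors, k p ≤ ∏ p ∈ n.primeFactors ∪ Finset.range P, k p :=
        Finset.prod_le_prod_of_subset_of_one_le Finset.subset_union_left
          (fun p _ => zero_le_one.trans (hk1 p)) fun p _ _ => hk1 p
    _ = ∏ p ∈ Finset.range P, k p := by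
        refine (Finset.prod_subset Finset.subset_union_right ?_).symm
        intro p _ hp
        simp only [hk]
        rw [if_neg (by simpa using hp)]
    _ ≤ ∏ p ∈ Finset.range P, K := by
        refine Finset.prod_le_prod (fun p _ => zero_le_one.trans (hk1 p)) fun p _ => ?_
        simp only [hk]; split_ifs <;> simp [hK1]
    _ = K ^ P := by simp

lemma Circle.denseRange_pow_of_rat {c : Circle} {r : ℚ} (hr : 4 * (c : ℂ).re ^ 2 = r)
    (hint : ∀ n : ℤ, (r : ℝ) ≠ n) : DenseRange (fun n : ℕ => c ^ n) := by
  rw [← denseRange_zpow_iff_pow]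
  obtain ⟨x, rfl⟩ : ∃ x, Circle.exp x = c := ⟨Complex.arg c, Circle.exp_arg c⟩
  have hre : ((Circle.exp x : Circle) : ℂ).re = Real.cos x := by
    rw [Circle.coe_exp, Complex.exp_ofReal_mul_I_re]
  rw [hre] at hr
  have hirr : Irrational (x / (2 * Real.pi)) := by
    rintro ⟨s, hs⟩
    have hx : 2 * x = ((4 * s : ℚ) : ℝ) * Real.pi := by
      push_cast
      rw [hs]
      field_simp
      ring
    have h1 := Real.isIntegral_two_mul_cos_rat_mul_pi (4 * s)
    rw [← hx, Real.cos_two_mul] at h1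
    obtain ⟨k, hk⟩ := (IsIntegral.exists_int_iff_exists_rat h1).1 ⟨r - 2, by
      push_cast; rw [← hr]; ring⟩
    exact hint (k + 2) (by push_cast; rw [← hk, ← hr]; ring)
  have hd := AddCircle.denseRange_zsmul_coe_iff.2 hirr
  have h2 := (AddCircle.homeomorphCircle'.surjective.denseRange).comp hd
    AddCircle.homeomorphCircle'.continuous
  convert! h2 using 1
  funext n
  simp only [Function.comp]
  rw [← AddCircle.coe_zsmul, AddCircle.homeomorphCircle'_apply_mk, Circle.exp_zsmul]

lemma mul_self_of_re_eq_zero_of_normSq {v : ℍ} (h : v.re = 0) (h1 : Quaternion.normSq v = 1) :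
    v * v = -1 := by
  have h2 := (Quaternion.sq_eq_neg_normSq (a := v)).2 h
  rw [h1] at h2
  rw [← sq, h2]; simp

/-- A closed set of unit imaginary quaternions mapped into itself by one rotation of infinite order
is mapped into itself by all rotations with the same axis. -/
lemma mem_of_conj_mem_of_rat {C : Set ℍ} (hC : IsClosed C) {q : ℍ}
    (hq : ∀ x ∈ C, (Quaternion.normSq q)⁻¹ • (q * x * star q) ∈ C) {r : ℚ}
    (him : q.im ≠ 0) (hr : 4 * q.re ^ 2 / Quaternion.normSq q = r) (hint : ∀ n : ℤ, (r : ℝ) ≠ n)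
    (t : ℝ) {x : ℍ} (hx : x ∈ C) :
    (1 + t ^ 2 * Quaternion.normSq q.im)⁻¹ • ((1 + t • q.im) * x * star (1 + t • q.im)) ∈ C := by
  have him0 : 0 < Quaternion.normSq q.im :=
    lt_of_le_of_ne Quaternion.normSq_nonneg (Quaternion.normSq_ne_zero.2 him).symm
  have hnq : Quaternion.normSq q = q.re ^ 2 + Quaternion.normSq q.im := by
    simp [Quaternion.normSq_def']; ring
  have hnq0 : 0 < Quaternion.normSq q := by rw [hnq]; positivity
  set s := √(Quaternion.normSq q.im) with hs
  have hs2 : s ^ 2 = Quaternion.normSq q.im := Real.sq_sqrt him0.le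
  have hs0 : 0 < s := Real.sqrt_pos.2 him0
  set v : ℍ := s⁻¹ • q.im with hv
  have hv2 : v * v = -1 := by
    apply mul_self_of_re_eq_zero_of_normSq
    · simp [hv]
    · rw [hv, Quaternion.normSq_smul, ← hs2]; field_simp
  set φ : ℂ → ℍ := fun c => c.re • (1 : ℍ) + c.im • v with hφ
  have hφmul : ∀ c d, φ (c * d) = φ c * φ d := by
    intro c d
    simp only [hφ, Complex.mul_re, Complex.mul_im, add_mul, mul_add, smul_mul_smul_comm, hv2,
      one_mul, mul_one]
    module
  have hφone : φ 1 = 1 := by simp [hφ]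
  have hφcont : Continuous φ := by
    simp only [hφ]
    fun_prop
  have hclosed : IsClosed {c : Circle | ∀ x ∈ C, φ c * x * star (φ c) ∈ C} := by
    simp only [Set.ofPred_forall]
    refine isClosed_iInter fun x => isClosed_iInter fun _ => ?_
    refine hC.preimage ?_
    have : Continuous fun c : Circle => φ c := hφcont.comp continuous_subtype_val
    fun_prop
  have hstep : ∀ c : ℂ, ∀ l : ℝ, 0 < l → ∀ x, 
      φ (l⁻¹ • c) * x * star (φ (l⁻¹ • c)) = (l ^ 2)⁻¹ • (φ c * x * star (φ c)) := by
    intro c l hl x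
    have : φ (l⁻¹ • c) = l⁻¹ • φ c := by
      simp only [hφ, Complex.smul_re, Complex.smul_im, smul_eq_mul, smul_add, smul_smul]
    rw [this, Quaternion.star_smul, smul_mul_assoc, smul_mul_smul_comm]
    congr 1
    field_simp
  set n := √(Quaternion.normSq q) with hn
  have hn2 : n ^ 2 = Quaternion.normSq q := Real.sq_sqrt hnq0.le
  have hn0 : 0 < n := Real.sqrt_pos.2 hnq0
  have hunit : ‖(n⁻¹ • (⟨q.re, s⟩ : ℂ))‖ = 1 := by
    rw [norm_smul, Complex.norm_eq_sqrt_sq_add_sq]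
    simp only [hs2]
    rw [← hnq, ← hn, norm_inv, Real.norm_of_nonneg hn0.le, inv_mul_cancel₀ hn0.ne']
  set c0 : Circle := ⟨n⁻¹ • (⟨q.re, s⟩ : ℂ), mem_sphere_zero_iff_norm.2 hunit⟩ with hc0
  have hφq : φ (⟨q.re, s⟩ : ℂ) = q := by
    simp only [hφ, hv, smul_smul]
    rw [mul_inv_cancel₀ hs0.ne', one_smul]
    conv_rhs => rw [← Quaternion.re_add_im q]
    rw [← Quaternion.coe_one, Quaternion.smul_coe, mul_one]
  have hmem : ∀ k : ℕ, c0 ^ k ∈ {c : Circle | ∀ x ∈ C, φ c * x * star (φ c) ∈ C} := by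
    intro k
    induction k with
    | zero => intro x hx; simpa [hφone] using hx
    | succ k ih =>
      intro x hx
      have h1 := ih x hx
      rw [pow_succ', Circle.coe_mul, hφmul, star_mul]
      have h2 := hq _ h1
      rw [← hn2] at h2
      have h3 := hstep (⟨q.re, s⟩ : ℂ) n hn0 (φ ↑(c0 ^ k) * x * star (φ ↑(c0 ^ k)))
      rw [hφq] at h3
      rw [← h3] at h2
      convert h2 using 1
      simp only [hc0, mul_assoc]
  have hdense : DenseRange (fun k : ℕ => c0 ^ k) := by
    refine Circle.denseRange_pow_of_rat (r := r) ?_ hint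
    rw [← hr, hc0, ← hn2]
    simp only [Complex.smul_re, smul_eq_mul]
    field_simp
  have hall : ∀ c : Circle, ∀ x ∈ C, φ c * x * star (φ c) ∈ C := fun c =>
    hdense.induction_on (p := fun c : Circle => ∀ x ∈ C, φ c * x * star (φ c) ∈ C) c hclosed hmem
  set l := √(1 + t ^ 2 * Quaternion.normSq q.im) with hl
  have hlpos : 0 < 1 + t ^ 2 * Quaternion.normSq q.im := by positivity
  have hl2 : l ^ 2 = 1 + t ^ 2 * Quaternion.normSq q.im := Real.sq_sqrt hlpos.le
  have hl0 : 0 < l := Real.sqrt_pos.2 hlpos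
  have hunit2 : ‖(l⁻¹ • (⟨1, t * s⟩ : ℂ))‖ = 1 := by
    rw [norm_smul, Complex.norm_eq_sqrt_sq_add_sq]
    simp only [one_pow, mul_pow, hs2]
    rw [← hl, norm_inv, Real.norm_of_nonneg hl0.le, inv_mul_cancel₀ hl0.ne']
  have h4 := hall ⟨l⁻¹ • (⟨1, t * s⟩ : ℂ), mem_sphere_zero_iff_norm.2 hunit2⟩ x hx
  simp only at h4
  rw [hstep _ l hl0, hl2] at h4
  have : φ (⟨1, t * s⟩ : ℂ) = 1 + t • q.im := by
    simp only [hφ, hv, smul_smul, mul_assoc]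
    rw [mul_inv_cancel₀ hs0.ne']; simp
  rwa [this] at h4

/-- A nonempty closed set of unit imaginary quaternions invariant under enough rotations of infinite
order is the whole sphere. -/
lemma sphere_subset_of_conj_mem {C : Set ℍ} (hC : IsClosed C) (hne : C.Nonempty)
    (hsub : ∀ x ∈ C, x.re = 0 ∧ Quaternion.normSq x = 1) {Q : Set ℍ}
    (hQ : ∀ q ∈ Q, ∀ x ∈ C, (Quaternion.normSq q)⁻¹ • (q * x * star q) ∈ C)
    (hQ' : ∀ q ∈ Q, q.im ≠ 0 ∧ ∃ r : ℚ, 4 * q.re ^ 2 / Quaternion.normSq q = r ∧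
      ∀ n : ℤ, (r : ℝ) ≠ n)
    (hspan : ∀ w : ℍ, w.re = 0 →
      (∀ q ∈ Q, q.imI * w.imI + q.imJ * w.imJ + q.imK * w.imK = 0) → w = 0)
    {b : ℍ} (hb : b.re = 0) (hb1 : Quaternion.normSq b = 1) : b ∈ C := by
  have hbdd : Bornology.IsBounded C := by
    refine (Metric.isBounded_closedBall (x := (0 : ℍ)) (r := 1)).subset fun x hx => ?_
    have := (hsub x hx).2
    rw [Quaternion.normSq_eq_norm_mul_self] at this
    rw [mem_closedBall_zero_iff]
    nlinarith [norm_nonneg x]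
  have hcomp : IsCompact C := Metric.isCompact_of_isClosed_isBounded hC hbdd
  obtain ⟨z, hzC, hz⟩ := hcomp.exists_isMaxOn hne
    (f := fun x : ℍ => x.imI * b.imI + x.imJ * b.imJ + x.imK * b.imK) (by
      have h1 := Quaternion.continuous_imI
      have h2 := Quaternion.continuous_imJ
      have h3 := Quaternion.continuous_imK
      fun_prop)
  rw [isMaxOn_iff] at hz
  obtain ⟨hzre, hz1⟩ := hsub z hzC
  rw [Quaternion.normSq_def', hzre] at hz1
  rw [Quaternion.normSq_def', hb] at hb1
  have hcross : (⟨0, z.imJ * b.imK - z.imK * b.imJ, z.imK * b.imI - z.imI * b.imK,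
      z.imI * b.imJ - z.imJ * b.imI⟩ : ℍ) = 0 := by
    refine hspan _ rfl fun q hq => ?_
    obtain ⟨him, r, hr, hint⟩ := hQ' q hq
    have key := fun t => hz _ (mem_of_conj_mem_of_rat hC (hQ q hq) him hr hint t hzC)
    simp only at key ⊢
    set L := q.imI * (z.imJ * b.imK - z.imK * b.imJ) + q.imJ * (z.imK * b.imI - z.imI * b.imK) +
      q.imK * (z.imI * b.imJ - z.imJ * b.imI) with hL
    obtain ⟨M, hM⟩ : ∃ M : ℝ, ∀ t : ℝ, 2 * t * L + t ^ 2 * M ≤ 0 := by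
      refine ⟨2 * (q.imI * z.imI + q.imJ * z.imJ + q.imK * z.imK) *
        (q.imI * b.imI + q.imJ * b.imJ + q.imK * b.imK) - 2 * (q.imI ^ 2 + q.imJ ^ 2 + q.imK ^ 2) *
        (z.imI * b.imI + z.imJ * b.imJ + z.imK * b.imK), fun t => ?_⟩
      have h := key t
      have hpos : 0 < 1 + t ^ 2 * Quaternion.normSq q.im := by
        have := Quaternion.normSq_nonneg (a := q.im); positivity
      simp only [Quaternion.imI_smul, Quaternion.imJ_smul, Quaternion.imK_smul, smul_eq_mul] at h
      have h : (1 + t ^ 2 * Quaternion.normSq q.im)⁻¹ *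
          (((1 + t • q.im) * z * star (1 + t • q.im)).imI * b.imI +
          ((1 + t • q.im) * z * star (1 + t • q.im)).imJ * b.imJ +
          ((1 + t • q.im) * z * star (1 + t • q.im)).imK * b.imK) ≤
          z.imI * b.imI + z.imJ * b.imJ + z.imK * b.imK := by
        refine le_trans (le_of_eq ?_) h
        ring
      rw [inv_mul_le_iff₀ hpos] at h
      rw [Quaternion.normSq_def'] at h
      simp [hzre] at h
      rw [hL]
      linear_combination h
    by_contra hne
    have h1 : 0 < L ^ 2 := by positivity
    have h2 := hM (L / (|M| + 1))
    have h3 : 0 < |M| + 1 := by positivity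
    have h4 : 2 * (L / (|M| + 1)) * L + (L / (|M| + 1)) ^ 2 * M =
        (L ^ 2 * (2 * (|M| + 1) + M)) / (|M| + 1) ^ 2 := by field_simp
    rw [h4] at h2
    have h5 : 0 < 2 * (|M| + 1) + M := by
      have := neg_abs_le M; have := abs_nonneg M; linarith
    have : 0 < (L ^ 2 * (2 * (|M| + 1) + M)) / (|M| + 1) ^ 2 := by positivity
    linarith
  have c1 : z.imJ * b.imK - z.imK * b.imJ = 0 := congrArg (fun w : ℍ => w.imI) hcross
  have c2 : z.imK * b.imI - z.imI * b.imK = 0 := congrArg (fun w : ℍ => w.imJ) hcross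
  have c3 : z.imI * b.imJ - z.imJ * b.imI = 0 := congrArg (fun w : ℍ => w.imK) hcross
  set d := z.imI * b.imI + z.imJ * b.imJ + z.imK * b.imK with hd
  have hzd : z.imI = d * b.imI ∧ z.imJ = d * b.imJ ∧ z.imK = d * b.imK := by
    refine ⟨?_, ?_, ?_⟩ <;> rw [hd]
    · linear_combination (-z.imI) * hb1 + b.imJ * c3 - b.imK * c2
    · linear_combination (-z.imJ) * hb1 - b.imI * c3 + b.imK * c1
    · linear_combination (-z.imK) * hb1 + b.imI * c2 - b.imJ * c1
  have hd2 : d ^ 2 = 1 := by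
    obtain ⟨e1, e2, e3⟩ := hzd
    rw [e1, e2, e3] at hz1
    linear_combination hz1 - d ^ 2 * hb1
  rcases sq_eq_one_iff.1 hd2 with h | h
  · convert hzC
    rw [h] at hzd
    ext <;> simp [hb, hzre, hzd]
  · exfalso
    have hall : ∀ x ∈ C, x = -b := by
      intro x hx
      have h1 := hz x hx
      rw [h] at h1
      obtain ⟨hx0, hx1⟩ := hsub x hx
      rw [Quaternion.normSq_def', hx0] at hx1
      have hsum : (x.imI + b.imI) ^ 2 + (x.imJ + b.imJ) ^ 2 + (x.imK + b.imK) ^ 2 ≤ 0 := by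
        linarith
      have hs1 : x.imI + b.imI = 0 := pow_eq_zero_iff two_ne_zero |>.1 (by
        linarith [sq_nonneg (x.imI + b.imI), sq_nonneg (x.imJ + b.imJ), sq_nonneg (x.imK + b.imK)])
      have hs2 : x.imJ + b.imJ = 0 := pow_eq_zero_iff two_ne_zero |>.1 (by
        linarith [sq_nonneg (x.imI + b.imI), sq_nonneg (x.imJ + b.imJ), sq_nonneg (x.imK + b.imK)])
      have hs3 : x.imK + b.imK = 0 := pow_eq_zero_iff two_ne_zero |>.1 (by
        linarith [sq_nonneg (x.imI + b.imI), sq_nonneg (x.imJ + b.imJ), sq_nonneg (x.imK + b.imK)])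
      ext <;> simp [hb, hx0] <;> linarith
    have hv : ∀ q ∈ Q, q.imJ * b.imK - q.imK * b.imJ = 0 ∧ q.imK * b.imI - q.imI * b.imK = 0 ∧
        q.imI * b.imJ - q.imJ * b.imI = 0 := by
      intro q hq
      obtain ⟨him, r, hr, hint⟩ := hQ' q hq
      have key : ∀ t : ℝ, (1 + t • q.im) * b * star (1 + t • q.im) =
          (1 + t ^ 2 * Quaternion.normSq q.im) • b := by
        intro t
        have hpos : 0 < 1 + t ^ 2 * Quaternion.normSq q.im := by
          have := Quaternion.normSq_nonneg (a := q.im); positivity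
        have h1 := hall _ (mem_of_conj_mem_of_rat hC (hQ q hq) him hr hint t hzC)
        rw [hall z hzC, inv_smul_eq_iff₀ hpos.ne', smul_neg, mul_neg, neg_mul, neg_inj] at h1
        exact h1
      have k1 := Quaternion.ext_iff.1 (key 1)
      have k2 := Quaternion.ext_iff.1 (key (-1))
      simp [hb] at k1 k2
      obtain ⟨-, k11, k12, k13⟩ := k1
      obtain ⟨-, k21, k22, k23⟩ := k2
      refine ⟨?_, ?_, ?_⟩
      · linear_combination (k11 - k21) / 4
      · linear_combination (k12 - k22) / 4
      · linear_combination (k13 - k23) / 4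
    have b1 := hspan ⟨0, 0, b.imK, -b.imJ⟩ rfl fun q hq => by
      obtain ⟨h1, h2, h3⟩ := hv q hq
      simp only
      linear_combination h1
    have b2 := hspan ⟨0, -b.imK, 0, b.imI⟩ rfl fun q hq => by
      obtain ⟨h1, h2, h3⟩ := hv q hq
      simp only
      linear_combination h2
    have b3 : b.imK = 0 := congrArg (fun w : ℍ => w.imJ) b1
    have b4 : -b.imJ = 0 := congrArg (fun w : ℍ => w.imK) b1
    have b5 : b.imI = 0 := congrArg (fun w : ℍ => w.imK) b2
    rw [b3, neg_eq_zero.1 b4, b5] at hb1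
    norm_num at hb1

/-- The quaternion with the given coordinates. -/
def quat {R : Type*} [CommRing R] (a b c d : R) : ℍ[R] := ⟨a, b, c, d⟩

section quat
variable {R : Type*} [CommRing R] (a b c d : R)
@[simp] lemma quat_re : (quat a b c d).re = a := rfl
@[simp] lemma quat_imI : (quat a b c d).imI = b := rfl
@[simp] lemma quat_imJ : (quat a b c d).imJ = c := rfl
@[simp] lemma quat_imK : (quat a b c d).imK = d := rfl
end quat

/-- The inclusion of the Lipschitz quaternions in the real quaternions. -/
def lipCast : ℍ[ℤ] →+* ℍ where
  toFun q := quat (q.re : ℝ) q.imI q.imJ q.imK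
  map_one' := by ext <;> simp
  map_mul' a b := by ext <;> simp
  map_zero' := by ext <;> simp
  map_add' a b := by ext <;> simp

@[simp] lemma lipCast_re (q : ℍ[ℤ]) : (lipCast q).re = q.re := rfl
@[simp] lemma lipCast_imI (q : ℍ[ℤ]) : (lipCast q).imI = q.imI := rfl
@[simp] lemma lipCast_imJ (q : ℍ[ℤ]) : (lipCast q).imJ = q.imJ := rfl
@[simp] lemma lipCast_imK (q : ℍ[ℤ]) : (lipCast q).imK = q.imK := rfl

lemma lipCast_star (q : ℍ[ℤ]) : lipCast (star q) = star (lipCast q) := by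
  ext <;> simp

lemma normSq_lipCast (q : ℍ[ℤ]) :
    Quaternion.normSq (lipCast q) = ((Quaternion.normSq q : ℤ) : ℝ) := by
  simp [Quaternion.normSq_def']

lemma lipCast_natCast (n : ℕ) : lipCast (n : ℍ[ℤ]) = ((n : ℝ) : ℍ) := by
  rw [map_natCast, Quaternion.coe_natCast]

/-- The unit imaginary quaternions with coordinates in `(1 / n) ℤ`. -/
def ratSphere (n : ℕ) : Set ℍ :=
  {x | x.re = 0 ∧ Quaternion.normSq x = 1 ∧ ∃ ξ : ℍ[ℤ], (n : ℝ) • x = lipCast ξ}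

lemma ratSphere_mono {d n : ℕ} (h : d ∣ n) : ratSphere d ⊆ ratSphere n := by
  rintro x ⟨h0, h1, ξ, hξ⟩
  obtain ⟨e, rfl⟩ := h
  refine ⟨h0, h1, (e : ℍ[ℤ]) * ξ, ?_⟩
  rw [map_mul, ← hξ, lipCast_natCast, Quaternion.coe_mul_eq_smul, smul_smul]
  push_cast
  rw [mul_comm]

lemma conj_re (q x : ℍ) (h : x.re = 0) : (q * x * star q).re = 0 := by
  simp [h]; ring

lemma normSq_inv_smul_conj {q x : ℍ} (hq : q ≠ 0) (hx : Quaternion.normSq x = 1) :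
    Quaternion.normSq ((Quaternion.normSq q)⁻¹ • (q * x * star q)) = 1 := by
  have := Quaternion.normSq_ne_zero.2 hq
  rw [Quaternion.normSq_smul, map_mul, map_mul, hx, Quaternion.normSq_star]
  field_simp

lemma conj_mem_ratSphere {q : ℍ[ℤ]} {p n : ℕ} (hp : p ≠ 0) (hq : Quaternion.normSq q = p) {x : ℍ}
    (hx : x ∈ ratSphere n) :
    (Quaternion.normSq (lipCast q))⁻¹ • (lipCast q * x * star (lipCast q)) ∈ ratSphere (n * p) := by
  obtain ⟨h0, h1, ξ, hξ⟩ := hx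
  have hp' : (p : ℝ) ≠ 0 := by exact_mod_cast hp
  have hN : Quaternion.normSq (lipCast q) = (p : ℝ) := by rw [normSq_lipCast, hq]; simp
  refine ⟨?_, ?_, q * ξ * star q, ?_⟩
  · rw [Quaternion.re_smul, conj_re _ _ h0, smul_zero]
  · refine normSq_inv_smul_conj (fun h => hp' ?_) h1
    rw [← hN, h, map_zero]
  · rw [map_mul, map_mul, ← hξ, lipCast_star, hN, smul_smul, mul_smul_comm, smul_mul_assoc]
    congr 1
    push_cast
    field_simp

lemma exists_four_squares_ne_zero {p : ℕ} (hp : p.Prime) :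
    ∃ a b c d : ℤ, a ^ 2 + b ^ 2 + c ^ 2 + d ^ 2 = p ∧ a ≠ 0 ∧ b ≠ 0 := by
  obtain ⟨a, b, c, d, h⟩ := Nat.sum_four_squares p
  have h' : (a : ℤ) ^ 2 + b ^ 2 + c ^ 2 + d ^ 2 = p := by exact_mod_cast h
  have hsq : ∀ e : ℕ, e ^ 2 ≠ p := fun e he => by
    rw [← he] at hp
    exact Nat.Prime.not_prime_pow le_rfl hp
  by_cases ha : a = 0 <;> by_cases hb : b = 0 <;> by_cases hc : c = 0 <;> by_cases hd : d = 0
  all_goals first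
    | exact ⟨a, b, c, d, by linarith, by exact_mod_cast ha, by exact_mod_cast hb⟩
    | exact ⟨a, c, b, d, by linarith, by exact_mod_cast ha, by exact_mod_cast hc⟩
    | exact ⟨a, d, b, c, by linarith, by exact_mod_cast ha, by exact_mod_cast hd⟩
    | exact ⟨b, c, a, d, by linarith, by exact_mod_cast hb, by exact_mod_cast hc⟩
    | exact ⟨b, d, a, c, by linarith, by exact_mod_cast hb, by exact_mod_cast hd⟩
    | exact ⟨c, d, a, b, by linarith, by exact_mod_cast hc, by exact_mod_cast hd⟩
    | (refine absurd (?_ : (a + b + c + d) ^ 2 = p) (hsq _)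
       rw [← h]
       simp only [ha, hb, hc, hd]
       ring)

lemma four_mul_sq_div_not_int {p : ℕ} (hp : p.Prime) (hp2 : p ≠ 2) {a : ℤ} (ha : a ≠ 0)
    (hap : a ^ 2 ≤ p) (n : ℤ) : (((4 * a ^ 2 / p : ℚ)) : ℝ) ≠ n := by
  intro h
  have hp0 : (p : ℝ) ≠ 0 := by exact_mod_cast hp.ne_zero
  push_cast at h
  rw [div_eq_iff hp0] at h
  have h1 : 4 * a ^ 2 = n * p := Int.cast_injective (α := ℝ) (by push_cast; exact h)
  have hpp : Prime (p : ℤ) := Nat.prime_iff_prime_int.1 hp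
  have h2 : (p : ℤ) ∣ a := by
    have h3 : (p : ℤ) ∣ 2 ^ 2 * a ^ 2 := ⟨n, by rw [mul_comm (p : ℤ), ← h1]; norm_num⟩
    rcases hpp.dvd_or_dvd h3 with h4 | h4
    · exfalso
      have h5 := Int.le_of_dvd (by norm_num) (hpp.dvd_of_dvd_pow h4)
      have h6 := hp.two_le
      omega
    · exact hpp.dvd_of_dvd_pow h4
  obtain ⟨e, rfl⟩ := h2
  have he : 0 < e ^ 2 := by
    have : e ≠ 0 := by rintro rfl; simp at ha
    positivity
  have : (2 : ℤ) ≤ p := by exact_mod_cast hp.two_le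
  have h3 : (p : ℤ) * p ≤ p := by
    calc (p : ℤ) * p ≤ (p * p) * e ^ 2 := le_mul_of_one_le_right (by positivity) he
      _ = (p * e) ^ 2 := by ring
      _ ≤ p := hap
  nlinarith

lemma mem_closure_ratSphere_prime_pow {p : ℕ} (hp : p.Prime) (hp2 : p ≠ 2) {b : ℍ}
    (hb : b.re = 0) (hb1 : Quaternion.normSq b = 1) : b ∈ closure (⋃ k : ℕ, ratSphere (p ^ k)) := by
  have hp0 : (p : ℝ) ≠ 0 := by exact_mod_cast hp.ne_zero
  refine sphere_subset_of_conj_mem (Q := {q | ∃ r : ℍ[ℤ], q = lipCast r ∧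
    Quaternion.normSq r = p ∧ r.re ≠ 0 ∧ r.im ≠ 0}) isClosed_closure ?_ ?_ ?_ ?_ ?_ hb hb1
  · refine ⟨quat 0 1 0 0, subset_closure (Set.mem_iUnion.2 ⟨0, rfl, ?_, quat 0 1 0 0, ?_⟩)⟩
    · simp [Quaternion.normSq_def']
    · ext <;> simp
  · have hcl : IsClosed {x : ℍ | x.re = 0 ∧ Quaternion.normSq x = 1} :=
      (isClosed_eq Quaternion.continuous_re continuous_const).inter
        (isClosed_eq Quaternion.continuous_normSq continuous_const)
    have hsub : (⋃ k : ℕ, ratSphere (p ^ k)) ⊆ {x : ℍ | x.re = 0 ∧ Quaternion.normSq x = 1} :=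
      Set.iUnion_subset fun k y hy => ⟨hy.1, hy.2.1⟩
    exact fun x hx => closure_minimal hsub hcl hx
  · rintro _ ⟨q, rfl, hq, -, -⟩ x hx
    refine map_mem_closure (f := fun x => (Quaternion.normSq (lipCast q))⁻¹ •
      (lipCast q * x * star (lipCast q))) (by fun_prop) hx ?_
    intro y hy
    obtain ⟨k, hk⟩ := Set.mem_iUnion.1 hy
    exact Set.mem_iUnion.2 ⟨k + 1, conj_mem_ratSphere hp.ne_zero hq hk⟩
  · rintro _ ⟨q, rfl, hq, hre, him⟩
    refine ⟨fun h => him ?_, (4 * q.re ^ 2 / p : ℚ), ?_, ?_⟩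
    · have h1 := congrArg (fun w : ℍ => w.imI) h
      have h2 := congrArg (fun w : ℍ => w.imJ) h
      have h3 := congrArg (fun w : ℍ => w.imK) h
      simp at h1 h2 h3
      ext <;> simp [h1, h2, h3]
    · rw [normSq_lipCast, hq]; simp
    · refine four_mul_sq_div_not_int hp hp2 hre ?_
      rw [← hq, Quaternion.normSq_def']
      nlinarith [sq_nonneg q.imI, sq_nonneg q.imJ, sq_nonneg q.imK]
  · intro w hw h
    obtain ⟨a, b, c, d, habcd, ha, hb⟩ := exists_four_squares_ne_zero hp
    have hb' : (b : ℝ) ≠ 0 := by exact_mod_cast hb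
    have key : ∀ x y z : ℤ, a ^ 2 + x ^ 2 + y ^ 2 + z ^ 2 = p → (x ≠ 0 ∨ y ≠ 0 ∨ z ≠ 0) →
        (x : ℝ) * w.imI + y * w.imJ + z * w.imK = 0 := by
      intro x y z hs hne
      refine h (lipCast (quat a x y z)) ⟨_, rfl, ?_, ha, fun him => ?_⟩
      · rw [Quaternion.normSq_def']; exact hs
      · have h1 : x = 0 := congrArg (fun w : ℍ[ℤ] => w.imI) him
        have h2 : y = 0 := congrArg (fun w : ℍ[ℤ] => w.imJ) him
        have h3 : z = 0 := congrArg (fun w : ℍ[ℤ] => w.imK) him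
        simp_all
    have k1 := key b c d habcd (.inl hb)
    have k2 := key b (-c) (-d) (by linarith) (.inl hb)
    have k3 := key c b d (by linarith) (.inr (.inl hb))
    have k4 := key (-c) b (-d) (by linarith) (.inr (.inl hb))
    have k5 := key c d b (by linarith) (.inr (.inr hb))
    have k6 := key (-c) (-d) b (by linarith) (.inr (.inr hb))
    push_cast at k2 k4 k6
    have e1 : (b : ℝ) * w.imI = 0 := by linarith
    have e2 : (b : ℝ) * w.imJ = 0 := by linarith
    have e3 : (b : ℝ) * w.imK = 0 := by linarith
    simp only [mul_eq_zero, hb', false_or] at e1 e2 e3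
    ext <;> simp [hw, e1, e2, e3]

/-- The Lipschitz quaternions of norm `n`. -/
def lipSphere (n : ℕ) : Set ℍ[ℤ] := {q | Quaternion.normSq q = n}

lemma finite_lipSphere (n : ℕ) : (lipSphere n).Finite := by
  have h : Set.Finite ((fun p : ℤ × ℤ × ℤ × ℤ => quat p.1 p.2.1 p.2.2.1 p.2.2.2) ''
      (Set.Icc (-n : ℤ) n ×ˢ Set.Icc (-n : ℤ) n ×ˢ Set.Icc (-n : ℤ) n ×ˢ Set.Icc (-n : ℤ) n)) :=
    ((Set.finite_Icc _ _).prod ((Set.finite_Icc _ _).prod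
      ((Set.finite_Icc _ _).prod (Set.finite_Icc _ _)))).image _
  have key : ∀ x : ℤ, x ^ 2 ≤ n → x ∈ Set.Icc (-n : ℤ) n := fun x hx => by
    constructor <;> nlinarith [sq_nonneg (x - 1), sq_nonneg (x + 1)]
  refine h.subset fun q hq => ⟨(q.re, q.imI, q.imJ, q.imK), ?_, rfl⟩
  have h2 : q.re ^ 2 + q.imI ^ 2 + q.imJ ^ 2 + q.imK ^ 2 = n := by
    rw [← Quaternion.normSq_def']; exact hq
  simp only [Set.mem_prod]
  refine ⟨key _ ?_, key _ ?_, key _ ?_, key _ ?_⟩ <;>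
    linarith [sq_nonneg q.re, sq_nonneg q.imI, sq_nonneg q.imJ, sq_nonneg q.imK]

lemma exists_eq_natCast_mul {m : ℕ} {q : ℍ[ℤ]} (h0 : (m : ℤ) ∣ q.re) (h1 : (m : ℤ) ∣ q.imI)
    (h2 : (m : ℤ) ∣ q.imJ) (h3 : (m : ℤ) ∣ q.imK) : ∃ w : ℍ[ℤ], q = (m : ℍ[ℤ]) * w := by
  obtain ⟨a, ha⟩ := h0
  obtain ⟨b, hb⟩ := h1
  obtain ⟨c, hc⟩ := h2
  obtain ⟨d, hd⟩ := h3
  exact ⟨quat a b c d, by ext <;> simp [ha, hb, hc, hd]⟩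

lemma natCast_mul_left_cancel {m : ℕ} (hm : m ≠ 0) {v w : ℍ[ℤ]}
    (h : (m : ℍ[ℤ]) * v = (m : ℍ[ℤ]) * w) : v = w := by
  have hm' : (m : ℍ[ℤ]) ≠ 0 := fun h0 => hm (by simpa using congrArg (·.re) h0)
  exact mul_left_cancel₀ hm' h

lemma star_mul_self_of_mem {n : ℕ} {q : ℍ[ℤ]} (h : q ∈ lipSphere n) : star q * q = (n : ℍ[ℤ]) := by
  rw [Quaternion.star_mul_self, show Quaternion.normSq q = n from h]; norm_cast

lemma self_mul_star_of_mem {n : ℕ} {q : ℍ[ℤ]} (h : q ∈ lipSphere n) : q * star q = (n : ℍ[ℤ]) := by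
  rw [Quaternion.self_mul_star, show Quaternion.normSq q = n from h]; norm_cast

lemma mul_mem_lipSphere {m n : ℕ} {q r : ℍ[ℤ]} (hq : q ∈ lipSphere m) (hr : r ∈ lipSphere n) :
    q * r ∈ lipSphere (m * n) := by
  simp only [lipSphere, Set.mem_ofPred_eq, map_mul] at *
  rw [hq, hr]; push_cast; rfl

lemma mem_lipSphere_of_mul {m n : ℕ} (hm : m ≠ 0) {q r : ℍ[ℤ]} (hq : q ∈ lipSphere m)
    (hqr : q * r ∈ lipSphere (m * n)) : r ∈ lipSphere n := by
  simp only [lipSphere, Set.mem_ofPred_eq, map_mul] at *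
  rw [hq] at hqr
  push_cast at hqr
  exact mul_left_cancel₀ (by exact_mod_cast hm) hqr

/-- Left division by one of the elements `t i` of norm `m`, when these exhaust the right ideals
of norm `m` modulo `m`. -/
lemma exists_eq_mul_of_mem_lipSphere {ι : Type*} {m : ℕ} (hm : m ≠ 0) (t : ι → ℍ[ℤ])
    (ht : ∀ i, t i ∈ lipSphere m)
    (hdec : ∀ a b c d : ZMod m, a ^ 2 + b ^ 2 + c ^ 2 + d ^ 2 = 0 → ∃ i,
      (t i).re * a + (t i).imI * b + (t i).imJ * c + (t i).imK * d = 0 ∧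
      (t i).re * b - (t i).imI * a - (t i).imJ * d + (t i).imK * c = 0 ∧
      (t i).re * c + (t i).imI * d - (t i).imJ * a - (t i).imK * b = 0 ∧
      (t i).re * d - (t i).imI * c + (t i).imJ * b - (t i).imK * a = 0)
    {n : ℕ} {v : ℍ[ℤ]} (hv : v ∈ lipSphere (m * n)) :
    ∃ i, ∃ w ∈ lipSphere n, v = t i * w := by
  have hv' : v.re ^ 2 + v.imI ^ 2 + v.imJ ^ 2 + v.imK ^ 2 = ((m * n : ℕ) : ℤ) := by
    rw [← Quaternion.normSq_def']; exact hv
  obtain ⟨i, h0, h1, h2, h3⟩ := hdec v.re v.imI v.imJ v.imK (by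
    have := congrArg (Int.cast (R := ZMod m)) hv'
    push_cast at this
    rw [this]; simp)
  obtain ⟨w, hw⟩ : ∃ w : ℍ[ℤ], star (t i) * v = (m : ℍ[ℤ]) * w := by
    refine exists_eq_natCast_mul ?_ ?_ ?_ ?_ <;> rw [← ZMod.intCast_zmod_eq_zero_iff_dvd]
    · rw [← h0]; simp
    · rw [← h1]; simp; ring
    · rw [← h2]; simp; ring
    · rw [← h3]; simp; ring
  have hvw : v = t i * w := by
    apply natCast_mul_left_cancel hm
    rw [← self_mul_star_of_mem (ht i), mul_assoc, hw, ← mul_assoc, ← mul_assoc,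
      self_mul_star_of_mem (ht i), (Nat.cast_commute m (t i)).eq]
  exact ⟨i, w, mem_lipSphere_of_mul hm (ht i) (hvw ▸ hv), hvw⟩

lemma ncard_lipSphere_mul_le {ι : Type*} [Fintype ι] {m n : ℕ} (t : ι → ℍ[ℤ])
    (h : ∀ v ∈ lipSphere (m * n), ∃ i, ∃ w ∈ lipSphere n, v = t i * w) :
    (lipSphere (m * n)).ncard ≤ Fintype.card ι * (lipSphere n).ncard := by
  calc (lipSphere (m * n)).ncard
      ≤ (⋃ i ∈ (Finset.univ : Finset ι), (fun w => t i * w) '' lipSphere n).ncard := by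
        refine Set.ncard_le_ncard ?_ ?_
        · intro v hv
          obtain ⟨i, w, hw, rfl⟩ := h v hv
          simp only [Set.mem_iUnion]
          exact ⟨i, Finset.mem_univ _, w, hw, rfl⟩
        · exact Set.Finite.biUnion (Finset.finite_toSet _) fun i _ => (finite_lipSphere _).image _
    _ ≤ ∑ i : ι, ((fun w => t i * w) '' lipSphere n).ncard := Finset.set_ncard_biUnion_le _ _
    _ ≤ ∑ i : ι, (lipSphere n).ncard :=
        Finset.sum_le_sum fun i _ => Set.ncard_image_le (finite_lipSphere _)
    _ = _ := by simp

lemma ncard_lipSphere_two_mul_le (n : ℕ) :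
    (lipSphere (2 * n)).ncard ≤ 3 * (lipSphere n).ncard := by
  have := ncard_lipSphere_mul_le (n := n) ![quat 1 1 0 0, quat 1 0 1 0, quat 1 0 0 1] fun v hv =>
    exists_eq_mul_of_mem_lipSphere two_ne_zero _
      (by intro i; fin_cases i <;> simp [lipSphere, Quaternion.normSq_def'])
      (by decide +kernel) hv
  simpa using this

lemma ncard_lipSphere_three_mul_le (n : ℕ) :
    (lipSphere (3 * n)).ncard ≤ 4 * (lipSphere n).ncard := by
  have := ncard_lipSphere_mul_le (n := n)
    ![quat 1 1 (-1) 0, quat 1 1 0 (-1), quat 1 1 0 1, quat 1 1 1 0] fun v hv =>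
    exists_eq_mul_of_mem_lipSphere three_ne_zero _
      (by intro i; fin_cases i <;> simp [lipSphere, Quaternion.normSq_def'])
      (by decide +kernel) hv
  simpa using this

lemma card_sub_two_le_card_sq_add_sq_eq_neg_one (p : ℕ) [Fact p.Prime] (hp2 : p ≠ 2) :
    p ≤ (Finset.univ.filter fun x : ZMod p × ZMod p => x.1 ^ 2 + x.2 ^ 2 = -1).card + 2 := by
  obtain ⟨a, b, hab⟩ := ZMod.sq_add_sq p (-1)
  have h2 : (2 : ZMod p) ≠ 0 := by
    intro h
    have := (ZMod.natCast_eq_zero_iff 2 p).1 (by exact_mod_cast h)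
    exact hp2 ((Nat.prime_dvd_prime_iff_eq (Fact.out : p.Prime) Nat.prime_two).1 this)
  have hbad : (Finset.univ.filter fun t : ZMod p => 1 + t ^ 2 = 0).card ≤ 2 := by
    by_cases h : ∃ t : ZMod p, 1 + t ^ 2 = 0
    · obtain ⟨t, ht⟩ := h
      refine (Finset.card_le_card (t := {t, -t}) fun s hs => ?_).trans Finset.card_le_two
      simp only [Finset.mem_filter, Finset.mem_univ, true_and] at hs
      simp only [Finset.mem_insert, Finset.mem_singleton]
      exact sq_eq_sq_iff_eq_or_eq_neg.1 (by linear_combination hs - ht)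
    · push Not at h
      rw [Finset.filter_false_of_mem fun t _ => h t]; simp
  have hgood : (Finset.univ.filter fun t : ZMod p => 1 + t ^ 2 ≠ 0).card ≤
      (Finset.univ.filter fun x : ZMod p × ZMod p => x.1 ^ 2 + x.2 ^ 2 = -1).card := by
    refine Finset.card_le_card_of_injOn (fun t => ((a * (1 - t ^ 2) - b * (2 * t)) / (1 + t ^ 2),
      (a * (2 * t) + b * (1 - t ^ 2)) / (1 + t ^ 2))) ?_ ?_
    · intro t ht
      simp only [Finset.coe_filter, Finset.mem_univ, true_and, Set.mem_ofPred_eq] at ht ⊢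
      field_simp
      linear_combination (1 + t ^ 2) ^ 2 * hab
    · intro t ht s hs hts
      simp only [Finset.coe_filter, Finset.mem_univ, true_and, Set.mem_ofPred_eq] at ht hs
      simp only [Prod.mk.injEq] at hts
      obtain ⟨e1, e2⟩ := hts
      rw [div_eq_div_iff ht hs] at e1 e2
      have c1 : (1 - t ^ 2) * (1 + s ^ 2) = (1 - s ^ 2) * (1 + t ^ 2) := by
        linear_combination (-a) * e1 - b * e2 + ((1 - t ^ 2) * (1 + s ^ 2) -
          (1 - s ^ 2) * (1 + t ^ 2)) * hab
      have c2 : (2 * t) * (1 + s ^ 2) = (2 * s) * (1 + t ^ 2) := by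
        linear_combination b * e1 - a * e2 + ((2 * t) * (1 + s ^ 2) -
          (2 * s) * (1 + t ^ 2)) * hab
      have c3 : t ^ 2 = s ^ 2 := by
        have : 2 * (t ^ 2 - s ^ 2) = 0 := by linear_combination -c1
        rcases mul_eq_zero.1 this with h | h
        · exact absurd h h2
        · linear_combination h
      have c4 : 2 * (1 + t ^ 2) * (t - s) = 0 := by linear_combination c2 + 2 * t * c3
      rcases mul_eq_zero.1 c4 with h | h
      · rcases mul_eq_zero.1 h with h | h
        · exact absurd h h2
        · exact absurd h ht
      · linear_combination h
  have hsum := Finset.card_filter_add_card_filter_not (s := (Finset.univ : Finset (ZMod p)))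
    (fun t => 1 + t ^ 2 = 0)
  simp only [Finset.card_univ, ZMod.card] at hsum
  have : p = (Finset.univ.filter fun t : ZMod p => 1 + t ^ 2 = 0).card +
    (Finset.univ.filter fun t : ZMod p => 1 + t ^ 2 ≠ 0).card := hsum.symm
  omega

lemma exists_small_quaternion (p : ℕ) [Fact p.Prime] (a b : ZMod p) :
    ∃ v : ℍ[ℤ], v ≠ 0 ∧ v.re ^ 2 < p ∧ v.imI ^ 2 < p ∧ v.imJ ^ 2 < p ∧ v.imK ^ 2 < p ∧
      (v.imJ : ZMod p) = a * v.re + b * v.imI ∧ (v.imK : ZMod p) = b * v.re - a * v.imI := by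
  set s := Nat.sqrt p with hs
  have hp : p.Prime := Fact.out
  have hsp : s ^ 2 < p := lt_of_le_of_ne (Nat.sqrt_le' p) fun h =>
    hp.prime.not_isSquare ⟨s, by rw [← h, sq]⟩
  have hps : p < (s + 1) ^ 2 := Nat.lt_succ_sqrt' p
  let D : Finset ((ℕ × ℕ) × ℕ × ℕ) := (Finset.range (s + 1) ×ˢ Finset.range (s + 1)) ×ˢ
    (Finset.range (s + 1) ×ˢ Finset.range (s + 1))
  let f : (ℕ × ℕ) × ℕ × ℕ → ZMod p × ZMod p := fun u =>
    (u.2.1 - a * u.1.1 - b * u.1.2, u.2.2 - b * u.1.1 + a * u.1.2)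
  have hcard : (Finset.univ : Finset (ZMod p × ZMod p)).card < D.card := by
    simp only [D, Finset.card_univ, Fintype.card_prod, ZMod.card, Finset.card_product,
      Finset.card_range]
    nlinarith
  obtain ⟨u, hu, u', hu', hne, he⟩ := Finset.exists_ne_map_eq_of_card_lt_of_maps_to hcard
    (f := f) (fun _ _ => Finset.mem_univ _)
  obtain ⟨⟨z, w⟩, x, y⟩ := u
  obtain ⟨⟨z', w'⟩, x', y'⟩ := u'
  simp only [D, Finset.mem_product, Finset.mem_range, Nat.lt_succ_iff] at hu hu'
  simp only [f, Prod.mk.injEq] at he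
  have key : ∀ i j : ℕ, i ≤ s → j ≤ s → ((i : ℤ) - j) ^ 2 < p := fun i j hi hj => by
    have h1 : ((s : ℤ)) ^ 2 < p := by exact_mod_cast hsp
    have h2 : |(i : ℤ) - j| ≤ |(s : ℤ)| := by
      rw [abs_of_nonneg (Int.natCast_nonneg s), abs_le]; constructor <;> omega
    exact (sq_le_sq.2 h2).trans_lt h1
  refine ⟨quat ((z : ℤ) - z') (w - w') (x - x') (y - y'), ?_, ?_, ?_, ?_, ?_, ?_, ?_⟩
  · intro h0
    apply hne
    have e0 := congrArg (·.re) h0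
    have e1 := congrArg (·.imI) h0
    have e2 := congrArg (·.imJ) h0
    have e3 := congrArg (·.imK) h0
    simp at e0 e1 e2 e3
    simp only [Prod.mk.injEq]
    omega
  · simpa using key z z' hu.1.1 hu'.1.1
  · simpa using key w w' hu.1.2 hu'.1.2
  · simpa using key x x' hu.2.1 hu'.2.1
  · simpa using key y y' hu.2.2 hu'.2.2
  · simp only [quat_re, quat_imI, quat_imJ]; push_cast; linear_combination he.1
  · simp only [quat_re, quat_imI, quat_imK]; push_cast; linear_combination he.2

lemma le_ncard_lipSphere (p : ℕ) [Fact p.Prime] (hp2 : p ≠ 2) :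
    p ≤ 8 * (lipSphere p).ncard + 2 := by
  have hp : p.Prime := Fact.out
  have h2 : (2 : ZMod p) ≠ 0 := by
    intro h
    have := (ZMod.natCast_eq_zero_iff 2 p).1 (by exact_mod_cast h)
    exact hp2 ((Nat.prime_dvd_prime_iff_eq hp Nat.prime_two).1 this)
  choose v hv0 hv1 hv2 hv3 hv4 hvJ hvK using exists_small_quaternion p
  set S := Finset.univ.filter fun x : ZMod p × ZMod p => x.1 ^ 2 + x.2 ^ 2 = -1 with hS
  set T : Set ℍ[ℤ] := lipSphere p ∪ lipSphere (2 * p) ∪ lipSphere (3 * p) with hT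
  have hTfin : T.Finite := ((finite_lipSphere _).union (finite_lipSphere _)).union
    (finite_lipSphere _)
  have hmem : ∀ x ∈ S, v x.1 x.2 ∈ T := by
    rintro ⟨a, b⟩ hab
    simp only [hS, Finset.mem_filter, Finset.mem_univ, true_and] at hab
    have hN := Quaternion.normSq_def' (a := v a b)
    have hpos : 0 < Quaternion.normSq (v a b) :=
      lt_of_le_of_ne Quaternion.normSq_nonneg fun h => hv0 a b (Quaternion.normSq_eq_zero.1 h.symm)
    have hlt : Quaternion.normSq (v a b) < 4 * p := by
      rw [hN]; linarith [hv1 a b, hv2 a b, hv3 a b, hv4 a b]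
    obtain ⟨c, hc⟩ : (p : ℤ) ∣ Quaternion.normSq (v a b) := by
      rw [← ZMod.intCast_zmod_eq_zero_iff_dvd, hN]
      push_cast
      rw [hvJ, hvK]
      linear_combination (((v a b).re : ZMod p) ^ 2 + ((v a b).imI : ZMod p) ^ 2) * hab
    have hp0 : (0 : ℤ) < p := by exact_mod_cast hp.pos
    have hc0 : 0 < c := by
      rw [hc] at hpos; exact (mul_pos_iff_of_pos_left hp0).1 hpos
    have hc4 : c < 4 := by
      rw [hc] at hlt; nlinarith
    simp only [hT, lipSphere, Set.mem_union, Set.mem_ofPred_eq, hc]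
    push_cast
    interval_cases c
    · left; left; ring
    · left; right; ring
    · right; ring
  have hinj : Set.InjOn (fun x : ZMod p × ZMod p => v x.1 x.2) S := by
    rintro ⟨a, b⟩ hab ⟨c, d⟩ hcd h
    simp only [hS, Finset.coe_filter, Finset.mem_univ, true_and, Set.mem_ofPred_eq] at hab hcd h
    have e1 := hvJ a b
    have e2 := hvK a b
    have e1' := hvJ c d
    have e2' := hvK c d
    rw [← h] at e1' e2'
    have small : ∀ z : ℤ, z ^ 2 < p → (z : ZMod p) = 0 → z = 0 := fun z hz h0 => by
      rw [ZMod.intCast_zmod_eq_zero_iff_dvd] at h0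
      by_contra hne
      have h3 := Int.le_of_dvd (abs_pos.2 hne) ((dvd_abs _ _).2 h0)
      have h4 : 1 ≤ |z| := Int.one_le_abs hne
      nlinarith [sq_abs z]
    have hiso : (a - c) ^ 2 + (b - d) ^ 2 = 0 := by
      by_contra hne
      have hz : ((v a b).re : ZMod p) = 0 := by
        refine (mul_eq_zero.1 ?_).resolve_left hne
        linear_combination (a - c) * (e1' - e1) + (b - d) * (e2' - e2)
      have hw : ((v a b).imI : ZMod p) = 0 := by
        refine (mul_eq_zero.1 ?_).resolve_left hne
        linear_combination (b - d) * (e1' - e1) - (a - c) * (e2' - e2)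
      rw [hz, hw] at e1 e2
      simp only [mul_zero, add_zero, sub_zero] at e1 e2
      refine hv0 a b ?_
      ext
      exacts [small _ (hv1 a b) hz, small _ (hv2 a b) hw, small _ (hv3 a b) e1,
        small _ (hv4 a b) e2]
    have horth : a * (a - c) + b * (b - d) = 0 := by
      refine (mul_eq_zero.1 ?_).resolve_left h2
      linear_combination hab - hcd + hiso
    have hd1 : (a - c) ^ 2 = 0 := by
      linear_combination (a - c) ^ 2 * hab -
        (a * (a - c) - b * (b - d)) * horth - b ^ 2 * hiso
    have hd2 : (b - d) ^ 2 = 0 := by linear_combination hiso - hd1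
    rw [sq_eq_zero_iff, sub_eq_zero] at hd1 hd2
    rw [hd1, hd2]
  have h1 : S.card ≤ T.ncard := by
    rw [← Set.ncard_coe_finset]
    exact Set.ncard_le_ncard_of_injOn _ hmem hinj hTfin
  have h3 : T.ncard ≤ (lipSphere p).ncard + (lipSphere (2 * p)).ncard +
      (lipSphere (3 * p)).ncard :=
    (Set.ncard_union_le _ _).trans (Nat.add_le_add_right (Set.ncard_union_le _ _) _)
  have h4 := ncard_lipSphere_two_mul_le p
  have h5 := ncard_lipSphere_three_mul_le p
  have h6 := card_sub_two_le_card_sq_add_sq_eq_neg_one p hp2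
  rw [← hS] at h6
  omega

/-- The six quaternions `2 ± i`, `2 ± j`, `2 ± k` of norm `5`. -/
def letter (s : Fin 3 × Bool) : ℍ[ℤ] :=
  quat 2 (if s.1 = 0 then cond s.2 1 (-1) else 0) (if s.1 = 1 then cond s.2 1 (-1) else 0)
    (if s.1 = 2 then cond s.2 1 (-1) else 0)

/-- The letter of the conjugate quaternion. -/
def invLetter (s : Fin 3 × Bool) : Fin 3 × Bool := (s.1, !s.2)

lemma star_letter (s : Fin 3 × Bool) : star (letter s) = letter (invLetter s) := by
  obtain ⟨i, b⟩ := s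
  fin_cases i <;> cases b <;> ext <;> simp [letter, invLetter]

lemma letter_mem (s : Fin 3 × Bool) : letter s ∈ lipSphere 5 := by
  obtain ⟨i, b⟩ := s
  fin_cases i <;> cases b <;> simp [letter, lipSphere, Quaternion.normSq_def']

lemma exists_step (q : ℍ[ℤ]) : ∃ s w, Quaternion.normSq w = Quaternion.normSq q ∧
    q * letter (0, true) = letter s * w := by
  obtain ⟨n, hn⟩ := Int.eq_ofNat_of_zero_le (Quaternion.normSq_nonneg (a := q))
  have hq : q ∈ lipSphere n := hn
  have hq' : q * letter (0, true) ∈ lipSphere (5 * n) := by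
    rw [mul_comm]; exact mul_mem_lipSphere hq (letter_mem _)
  obtain ⟨s, w, hw, h⟩ := exists_eq_mul_of_mem_lipSphere (by norm_num) letter letter_mem
    (by decide +kernel) hq'
  exact ⟨s, w, (show Quaternion.normSq w = n from hw).trans hn.symm, h⟩

/-- The first letter in the factorization of `q * (2 + i)`. -/
noncomputable def stepLetter (q : ℍ[ℤ]) : Fin 3 × Bool := (exists_step q).choose

/-- The cofactor in the factorization of `q * (2 + i)`. -/
noncomputable def step (q : ℍ[ℤ]) : ℍ[ℤ] := (exists_step q).choose_spec.choose

lemma step_mem {n : ℕ} {q : ℍ[ℤ]} (hq : q ∈ lipSphere n) : step q ∈ lipSphere n :=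
  (exists_step q).choose_spec.choose_spec.1.trans hq

lemma mul_letter_eq (q : ℍ[ℤ]) : q * letter (0, true) = letter (stepLetter q) * step q :=
  (exists_step q).choose_spec.choose_spec.2

/-- The word of length `n` recording the factorizations of `q * (2 + i) ^ n`. -/
noncomputable def word : ℕ → ℍ[ℤ] → List (Fin 3 × Bool)
  | 0, _ => []
  | n + 1, q => stepLetter q :: word n (step q)

lemma mul_letter_pow_eq (n : ℕ) (q : ℍ[ℤ]) :
    q * letter (0, true) ^ n = ((word n q).map letter).prod * step^[n] q := by
  induction n generalizing q with
  | zero => simp [word]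
  | succ n ih => rw [pow_succ', ← mul_assoc, mul_letter_eq, mul_assoc, ih, word, List.map_cons,
      List.prod_cons, mul_assoc, Function.iterate_succ_apply]

lemma prod_letter_mem (l : List (Fin 3 × Bool)) :
    (l.map letter).prod ∈ lipSphere (5 ^ l.length) := by
  induction l with
  | nil => simp [lipSphere]
  | cons s l ih =>
    rw [List.map_cons, List.prod_cons, List.length_cons, pow_succ']
    exact mul_mem_lipSphere (letter_mem s) ih

lemma length_word (n : ℕ) (q : ℍ[ℤ]) : (word n q).length = n := by
  induction n generalizing q with
  | zero => rfl
  | succ n ih => simp [word, ih]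

lemma stepLetter_step_ne {p : ℕ} (hp : ¬ 5 ∣ p) {q : ℍ[ℤ]} (hq : q ∈ lipSphere p) :
    stepLetter (step q) ≠ invLetter (stepLetter q) := by
  intro h
  have h1 : q * letter (0, true) ^ 2 = ((5 : ℕ) : ℍ[ℤ]) * step (step q) := by
    rw [sq, ← mul_assoc, mul_letter_eq q, mul_assoc, mul_letter_eq (step q), h, ← star_letter, ← mul_assoc,
      self_mul_star_of_mem (letter_mem _)]
  have h2 : q.re ^ 2 + q.imI ^ 2 + q.imJ ^ 2 + q.imK ^ 2 = (p : ℤ) := by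
    rw [← Quaternion.normSq_def']; exact hq
  rw [sq, ← mul_assoc] at h1
  have e0 := congrArg (·.re) h1
  have e1 := congrArg (·.imI) h1
  have e2 := congrArg (·.imJ) h1
  have e3 := congrArg (·.imK) h1
  simp [letter, -Nat.cast_ofNat] at e0 e1 e2 e3
  apply hp
  zify
  have hp' := h2.symm
  generalize (step (step q)).re = x at *
  generalize (step (step q)).imJ = y at *
  generalize q.re = a at *
  generalize q.imI = b at *
  generalize q.imJ = c at *
  generalize q.imK = d at *
  obtain ⟨u, hu⟩ : ∃ u, u = 2 * x - a + b := ⟨_, rfl⟩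
  obtain ⟨v, hv⟩ : ∃ v, v = 2 * y - c - 2 * d := ⟨_, rfl⟩
  have ha : a = 3 * b + 5 * u := by linarith
  have hc : c = 2 * d + 5 * v := by linarith
  refine ⟨2 * b ^ 2 + 6 * b * u + 5 * u ^ 2 + d ^ 2 + 4 * d * v + 5 * v ^ 2, ?_⟩
  rw [hp', ha, hc]
  ring

/-- The first complex coordinate of a quaternion. -/
def gaussFst (r : ℍ[ℤ]) : GaussianInt := ⟨r.re, r.imI⟩

/-- The second complex coordinate of a quaternion. -/
def gaussSnd (r : ℍ[ℤ]) : GaussianInt := ⟨r.imJ, r.imK⟩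

/-- Gaussian integers as quaternions. -/
def gaussCast (z : GaussianInt) : ℍ[ℤ] := quat z.re z.im 0 0

lemma gaussCast_pow (z : GaussianInt) (n : ℕ) : gaussCast (z ^ n) = gaussCast z ^ n := by
  induction n with
  | zero => ext <;> rfl
  | succ n ih => rw [pow_succ, pow_succ, ← ih]; ext <;> simp [gaussCast]; ring

lemma star_gaussCast (z : GaussianInt) : star (gaussCast z) = gaussCast (star z) := by
  ext <;> simp [gaussCast]

lemma gaussSnd_mul_mul (z w : GaussianInt) (r : ℍ[ℤ]) :
    gaussSnd (gaussCast z * r * gaussCast w) = z * gaussSnd r * star w := by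
  ext <;> simp [gaussCast, gaussSnd, -mul_eq_mul_right_iff] <;> ring

lemma gaussSnd_natCast_mul (n : ℕ) (r : ℍ[ℤ]) :
    gaussSnd ((n : ℍ[ℤ]) * r) = n * gaussSnd r := by
  ext <;> simp [gaussSnd]

lemma norm_gaussFst_add_norm_gaussSnd (r : ℍ[ℤ]) :
    (gaussFst r).norm + (gaussSnd r).norm = Quaternion.normSq r := by
  rw [Quaternion.normSq_def', GaussianInt.norm_eq_sq, GaussianInt.norm_eq_sq]
  simp only [gaussFst, gaussSnd]; ring

lemma dvd_gaussSnd_of_word_eq {n : ℕ} {q q' : ℍ[ℤ]} (h : word n q = word n q') :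
    (⟨2, 1⟩ : GaussianInt) ^ n ∣ gaussSnd (star q * q') := by
  set π : GaussianInt := ⟨2, 1⟩ with hπ
  have hl : letter (0, true) = gaussCast π := by ext <;> simp [letter, gaussCast, hπ]
  have h1 : gaussCast (star π ^ n) * (star q * q') * gaussCast (π ^ n) =
      ((5 ^ n : ℕ) : ℍ[ℤ]) * (star (step^[n] q) * step^[n] q') := by
    have e1 := mul_letter_pow_eq n q
    have e2 := mul_letter_pow_eq n q'
    rw [hl, ← gaussCast_pow] at e1 e2
    rw [← h] at e2
    have e3 := star_mul_self_of_mem (prod_letter_mem (word n q))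
    rw [length_word] at e3
    set T := ((word n q).map letter).prod
    calc _ = star (q * gaussCast (π ^ n)) * (q' * gaussCast (π ^ n)) := by
          rw [star_mul, star_gaussCast, star_pow]; simp only [mul_assoc]
      _ = star (step^[n] q) * (star T * T) * step^[n] q' := by
          rw [e1, e2, star_mul]; simp only [mul_assoc]
      _ = _ := by
          rw [e3, ← (Nat.cast_commute _ _).eq, mul_assoc]
  have h2 := congrArg gaussSnd h1
  rw [gaussSnd_mul_mul, gaussSnd_natCast_mul, star_pow] at h2
  have h5 : ((5 ^ n : ℕ) : GaussianInt) = π ^ n * star π ^ n := by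
    rw [← mul_pow]; push_cast; congr 1
  rw [h5] at h2
  have hcop : IsCoprime (π ^ n) (star π ^ n) := by
    apply IsCoprime.pow
    refine ⟨⟨1, -1⟩, -1, ?_⟩
    decide
  have h3 : star π ^ n * gaussSnd (star q * q') =
      π ^ n * gaussSnd (star (step^[n] q) * step^[n] q') := by
    have h0 : star π ^ n ≠ 0 := pow_ne_zero _ (by decide)
    apply mul_left_cancel₀ h0
    linear_combination h2
  exact hcop.dvd_of_dvd_mul_left ⟨_, h3⟩

lemma ncard_gaussianInt_norm_le {n : ℕ} (hn : 0 < n) :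
    {z : GaussianInt | z.norm ≤ n}.ncard ≤ 9 * n := by
  set s : ℕ := Nat.sqrt n with hs
  have h1 : {z : GaussianInt | z.norm ≤ n} ⊆
      (((Finset.Icc (-s : ℤ) s ×ˢ Finset.Icc (-s : ℤ) s).image
        fun x => (⟨x.1, x.2⟩ : GaussianInt) : Finset GaussianInt) : Set GaussianInt) := by
    intro z hz
    simp only [Set.mem_ofPred_eq, GaussianInt.norm_eq_sq] at hz
    have key : ∀ x : ℤ, x ^ 2 ≤ n → x ∈ Finset.Icc (-s : ℤ) s := fun x hx => by
      have : x.natAbs ≤ s := by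
        rw [hs, Nat.le_sqrt']; zify; simpa using hx
      rw [Finset.mem_Icc]; omega
    simp only [Finset.coe_image, Set.mem_image, Finset.mem_coe, Finset.mem_product]
    exact ⟨(z.re, z.im), ⟨key _ (by linarith [sq_nonneg z.im]),
      key _ (by linarith [sq_nonneg z.re])⟩, rfl⟩
  calc _ ≤ _ := Set.ncard_le_ncard h1 (Finset.finite_toSet _)
    _ ≤ (Finset.Icc (-s : ℤ) s ×ˢ Finset.Icc (-s : ℤ) s).card := by
        rw [Set.ncard_coe_finset]; exact Finset.card_image_le
    _ = (2 * s + 1) ^ 2 := by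
        rw [Finset.card_product, Int.card_Icc, sq]
        congr 1 <;> omega
    _ ≤ 9 * n := by
        have h2 : s ^ 2 ≤ n := Nat.sqrt_le' n
        have h3 : 1 ≤ s := by rw [hs, Nat.le_sqrt']; omega
        nlinarith

lemma exists_ncard_gaussSphere_le' {ε : ℝ} (hε : 0 < ε) :
    ∃ C : ℝ, 1 ≤ C ∧ ∀ n : ℕ, 0 < n → ∀ k : ℤ, k ≤ n →
      ((gaussSphere k).ncard : ℝ) ≤ C * (n : ℝ) ^ ε := by
  obtain ⟨C, hC, h⟩ := exists_ncard_gaussSphere_le hε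
  refine ⟨C, hC, fun n hn k hk => ?_⟩
  have hn1 : (1 : ℝ) ≤ n := by exact_mod_cast hn
  have hC1 : 1 ≤ C * (n : ℝ) ^ ε := one_le_mul_of_one_le_of_one_le hC
    (Real.one_le_rpow hn1 hε.le)
  rcases lt_trichotomy k 0 with hk0 | rfl | hk0
  · have : gaussSphere k = ∅ := by
      ext z
      simp only [gaussSphere, Set.mem_ofPred_eq, Set.mem_empty_iff_false, iff_false]
      have := GaussianInt.norm_nonneg z
      omega
    rw [this]; simp; linarith
  · have : gaussSphere 0 = {0} := by
      ext z; simp [gaussSphere]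
    rw [this]; simpa using hC1
  · lift k to ℕ using hk0.le
    refine (h k (by exact_mod_cast hk0)).trans ?_
    gcongr
    exact_mod_cast hk

lemma exists_ncard_dvd_gaussSnd_le {ε : ℝ} (hε : 0 < ε) :
    ∃ C : ℝ, 1 ≤ C ∧ ∀ p n : ℕ, 0 < p → p ≤ 5 ^ n →
      ((lipSphere (p ^ 2) ∩ {r | (⟨2, 1⟩ : GaussianInt) ^ n ∣ gaussSnd r}).ncard : ℝ) ≤
        C * (p : ℝ) ^ (1 + ε) := by
  obtain ⟨C, hC, h⟩ := exists_ncard_gaussSphere_le' (half_pos hε)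
  refine ⟨9 * C, by linarith, fun p n hp hpn => ?_⟩
  set π : GaussianInt := ⟨2, 1⟩ with hπ
  have hπn : (π ^ n).norm = 5 ^ n := map_pow Zsqrtd.normMonoidHom π n
  have hfin : {z : GaussianInt | z.norm ≤ p}.Finite := finite_gaussianInt_norm_le _
  set G := hfin.toFinset with hG
  let S : GaussianInt → Set ℍ[ℤ] := fun γ =>
    (fun α : GaussianInt => quat α.re α.im (π ^ n * γ).re (π ^ n * γ).im) ''
      gaussSphere ((p ^ 2 : ℕ) - (π ^ n * γ).norm)
  have hsub : lipSphere (p ^ 2) ∩ {r | π ^ n ∣ gaussSnd r} ⊆ ⋃ γ ∈ G, S γ := by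
    rintro r ⟨hr, γ, hγ⟩
    have hsum := norm_gaussFst_add_norm_gaussSnd r
    rw [show Quaternion.normSq r = (p ^ 2 : ℕ) from hr] at hsum
    simp only [Set.mem_iUnion]
    refine ⟨γ, ?_, gaussFst r, ?_, ?_⟩
    · rw [hG, Set.Finite.mem_toFinset, Set.mem_ofPred_eq]
      have h1 := GaussianInt.norm_nonneg (gaussFst r)
      rw [hγ, Zsqrtd.norm_mul, hπn] at hsum
      have h2 := GaussianInt.norm_nonneg γ
      have h3 : (p : ℤ) ≤ 5 ^ n := by exact_mod_cast hpn
      have h4 : (0 : ℤ) < p := by exact_mod_cast hp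
      push_cast at hsum
      nlinarith
    · rw [gaussSphere, Set.mem_ofPred_eq, ← hγ]; linarith
    · simp only
      rw [← hγ]; rfl
  have hb : ∀ γ, ((S γ).ncard : ℝ) ≤ C * (p : ℝ) ^ ε := fun γ => by
    have h1 : (S γ).ncard ≤ _ := Set.ncard_image_le (finite_gaussSphere _)
    have h2 := h (p ^ 2) (by positivity) ((p ^ 2 : ℕ) - (π ^ n * γ).norm)
      (by have := GaussianInt.norm_nonneg (π ^ n * γ); omega)
    calc ((S γ).ncard : ℝ) ≤ _ := by exact_mod_cast h1
      _ ≤ _ := h2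
      _ = _ := by
        push_cast
        rw [← Real.rpow_natCast, ← Real.rpow_mul (by positivity)]
        congr 2; push_cast; ring
  have hGc : (G.card : ℝ) ≤ 9 * p := by
    have := ncard_gaussianInt_norm_le hp
    rw [Set.ncard_eq_toFinset_card _ hfin] at this
    exact_mod_cast this
  calc _ ≤ (((⋃ γ ∈ G, S γ).ncard : ℕ) : ℝ) := by
        refine Nat.cast_le.2 (Set.ncard_le_ncard hsub ?_)
        exact Set.Finite.biUnion (Finset.finite_toSet _) fun γ _ => (finite_gaussSphere _).image _
    _ ≤ ∑ γ ∈ G, ((S γ).ncard : ℝ) := by exact_mod_cast Finset.set_ncard_biUnion_le _ _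
    _ ≤ ∑ γ ∈ G, C * (p : ℝ) ^ ε := Finset.sum_le_sum fun γ _ => hb γ
    _ = G.card * (C * (p : ℝ) ^ ε) := by simp
    _ ≤ (9 * p) * (C * (p : ℝ) ^ ε) := by gcongr
    _ = _ := by
      rw [Real.rpow_add (by exact_mod_cast hp), Real.rpow_one]; ring

lemma exists_eq_mul_of_mul_eq_natCast_mul {p : ℕ} (hp : p.Prime) (hp2 : p ≠ 2) {q q₁ r w w₁ : ℍ[ℤ]}
    (hq : q ∈ lipSphere p) (hq₁ : q₁ ∈ lipSphere p) (h : q * r = (p : ℍ[ℤ]) * w)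
    (h₁ : q₁ * r = (p : ℍ[ℤ]) * w₁) (hr : ∀ u, r ≠ (p : ℍ[ℤ]) * u) :
    ∃ u ∈ lipSphere 1, q = u * q₁ := by
  have hp0 := hp.ne_zero
  have hN : ∀ s w' : ℍ[ℤ], s * r = (p : ℍ[ℤ]) * w' → (p : ℤ) ∣ Quaternion.normSq s := by
    intro s w' hs
    by_contra hnd
    have hs' : ((Quaternion.normSq s : ℤ) : ℍ[ℤ]) * r = (p : ℍ[ℤ]) * (star s * w') := by
      have h1 : ((Quaternion.normSq s : ℤ) : ℍ[ℤ]) = star s * s := by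
        rw [Quaternion.star_mul_self]; norm_cast
      rw [h1, mul_assoc, hs, ← mul_assoc, ← mul_assoc, (Nat.cast_commute p (star s)).eq]
    have hpp : Prime (p : ℤ) := Nat.prime_iff_prime_int.1 hp
    have e0 := congrArg (·.re) hs'
    have e1 := congrArg (·.imI) hs'
    have e2 := congrArg (·.imJ) hs'
    have e3 := congrArg (·.imK) hs'
    simp only [Quaternion.re_mul, Quaternion.imI_mul, Quaternion.imJ_mul, Quaternion.imK_mul,
      Quaternion.re_natCast, Quaternion.imI_natCast, Quaternion.imJ_natCast,
      Quaternion.imK_natCast, Quaternion.re_intCast, Quaternion.imI_intCast,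
      Quaternion.imJ_intCast, Quaternion.imK_intCast, zero_mul, sub_zero, add_zero] at e0 e1 e2 e3
    obtain ⟨u, hu⟩ := exists_eq_natCast_mul
      ((hpp.dvd_or_dvd ⟨_, e0⟩).resolve_left hnd) ((hpp.dvd_or_dvd ⟨_, e1⟩).resolve_left hnd)
      ((hpp.dvd_or_dvd ⟨_, e2⟩).resolve_left hnd) ((hpp.dvd_or_dvd ⟨_, e3⟩).resolve_left hnd)
    exact hr u hu
  have key : ∀ h : ℍ[ℤ], (p : ℤ) ∣ 2 * (q * star (h * q₁)).re := by
    intro h'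
    have h2 := hN (q + h' * q₁) (w + h' * w₁) (by
      rw [add_mul, mul_add, h, mul_assoc, h₁, ← mul_assoc, ← mul_assoc,
        (Nat.cast_commute p h').eq])
    rw [Quaternion.normSq_add, map_mul, show Quaternion.normSq q = p from hq,
      show Quaternion.normSq q₁ = p from hq₁] at h2
    rw [show (2 * (q * star (h' * q₁)).re) = ((p : ℤ) + Quaternion.normSq h' * p +
      2 * (q * star (h' * q₁)).re) - p * (1 + Quaternion.normSq h') by ring]
    exact dvd_sub h2 (dvd_mul_right _ _)
  have key2 : ∀ h : ℍ[ℤ], (p : ℤ) ∣ (q * star (h * q₁)).re := fun h' => by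
    refine (IsCoprime.dvd_of_dvd_mul_left ?_ (key h'))
    exact_mod_cast Nat.isCoprime_iff_coprime.2 ((Nat.coprime_primes hp Nat.prime_two).2 hp2)
  have k0 := key2 1
  have k1 := key2 (quat 0 1 0 0)
  have k2 := key2 (quat 0 0 1 0)
  have k3 := key2 (quat 0 0 0 1)
  obtain ⟨u, hu⟩ : ∃ u, q * star q₁ = (p : ℍ[ℤ]) * u := by
    apply exists_eq_natCast_mul
    · simpa using k0
    · convert k1 using 1; simp; ring
    · convert k2 using 1; simp; ring
    · convert k3 using 1; simp; ring
  have hqu : q = u * q₁ := by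
    apply natCast_mul_left_cancel hp0
    rw [← mul_assoc, ← hu, mul_assoc, star_mul_self_of_mem hq₁, (Nat.cast_commute p q).eq]
  refine ⟨u, ?_, hqu⟩
  have h3 : Quaternion.normSq q = Quaternion.normSq u * Quaternion.normSq q₁ := by
    rw [← map_mul, ← hqu]
  rw [show Quaternion.normSq q = p from hq, show Quaternion.normSq q₁ = p from hq₁] at h3
  have hp0' : (p : ℤ) ≠ 0 := by exact_mod_cast hp0
  show Quaternion.normSq u = ((1 : ℕ) : ℤ)
  apply mul_right_cancel₀ hp0'
  rw [← h3]; simp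

lemma star_mem_lipSphere {n : ℕ} {q : ℍ[ℤ]} (hq : q ∈ lipSphere n) : star q ∈ lipSphere n := by
  show Quaternion.normSq (star q) = n
  rw [Quaternion.normSq_star]; exact hq

/-- The number of pairs in `lipSphere p` whose quotients lie in a given set. -/
lemma ncard_pairs_le {p : ℕ} (hp : p.Prime) (hp2 : p ≠ 2) (S : Set ℍ[ℤ]) :
    ((lipSphere p ×ˢ lipSphere p) ∩ {x | star x.1 * x.2 ∈ S}).ncard ≤
      (lipSphere 1).ncard * ((lipSphere (p ^ 2) ∩ S).ncard + (lipSphere p).ncard) := by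
  have hp0 := hp.ne_zero
  have hprod : ∀ x ∈ lipSphere p ×ˢ lipSphere p, star x.1 * x.2 ∈ lipSphere (p ^ 2) := by
    rintro x ⟨hx, hx'⟩
    rw [sq]; exact mul_mem_lipSphere (star_mem_lipSphere hx) hx'
  have hback : ∀ x ∈ lipSphere p ×ˢ lipSphere p, x.1 * (star x.1 * x.2) = (p : ℍ[ℤ]) * x.2 := by
    rintro x ⟨hx, -⟩
    rw [← mul_assoc, self_mul_star_of_mem hx]
  have hfin : (lipSphere (p ^ 2) ∩ S).Finite := (finite_lipSphere _).inter_of_left _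
  let F : ℍ[ℤ] → Set (ℍ[ℤ] × ℍ[ℤ]) := fun r =>
    {x | x ∈ lipSphere p ×ˢ lipSphere p ∧ star x.1 * x.2 = r ∧ ∀ u, r ≠ (p : ℍ[ℤ]) * u}
  have hXX : (lipSphere p ×ˢ lipSphere p).Finite := (finite_lipSphere p).prod (finite_lipSphere p)
  have hF : ∀ r, (F r).ncard ≤ (lipSphere 1).ncard := by
    intro r
    rcases (F r).eq_empty_or_nonempty with h0 | ⟨x₁, hx₁, hr₁, hnd⟩
    · rw [h0]; simp
    · refine (Set.ncard_le_ncard_of_injOn Prod.fst (t := (· * x₁.1) '' lipSphere 1) ?_ ?_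
        ((finite_lipSphere 1).image _)).trans (Set.ncard_image_le (finite_lipSphere 1))
      · rintro x ⟨hx, hr, -⟩
        obtain ⟨u, hu, h⟩ := exists_eq_mul_of_mul_eq_natCast_mul hp hp2 hx.1 hx₁.1
          (hr ▸ hback x hx) (hr₁ ▸ hback x₁ hx₁) hnd
        exact ⟨u, hu, h.symm⟩
      · rintro x ⟨hx, hr, -⟩ y ⟨hy, hr', -⟩ hxy
        refine Prod.ext hxy (natCast_mul_left_cancel hp0 ?_)
        rw [← hback x hx, ← hback y hy, hr, hr', hxy]
  have hsub : (lipSphere p ×ˢ lipSphere p) ∩ {x | star x.1 * x.2 ∈ S} ⊆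
      (⋃ r ∈ hfin.toFinset, F r) ∪
        (fun y : ℍ[ℤ] × ℍ[ℤ] => (y.1, y.1 * y.2)) '' (lipSphere p ×ˢ lipSphere 1) := by
    rintro x ⟨hx, hxS⟩
    by_cases h : ∃ u, star x.1 * x.2 = (p : ℍ[ℤ]) * u
    · right
      obtain ⟨u, hu⟩ := h
      have h2 : x.2 = x.1 * u := by
        apply natCast_mul_left_cancel hp0
        rw [← hback x hx, hu, ← mul_assoc, ← mul_assoc, (Nat.cast_commute p x.1).eq]
      refine ⟨(x.1, u), ⟨hx.1, mem_lipSphere_of_mul hp0 hx.1 ?_⟩, ?_⟩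
      · rw [← h2, mul_one]; exact hx.2
      · simp only [← h2]
    · left
      push Not at h
      simp only [Set.mem_iUnion, Set.Finite.mem_toFinset]
      exact ⟨_, ⟨hprod x hx, hxS⟩, hx, rfl, h⟩
  have hf1 : (⋃ r ∈ hfin.toFinset, F r).Finite :=
    Set.Finite.biUnion (Finset.finite_toSet _) fun r _ => hXX.subset fun x hx => hx.1
  have hf2 := (finite_lipSphere p).prod (finite_lipSphere 1)
  calc _ ≤ _ := Set.ncard_le_ncard hsub (hf1.union (hf2.image _))
    _ ≤ (⋃ r ∈ hfin.toFinset, F r).ncard + _ := Set.ncard_union_le _ _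
    _ ≤ (∑ r ∈ hfin.toFinset, (lipSphere 1).ncard) +
        (lipSphere p ×ˢ lipSphere 1).ncard :=
      add_le_add ((Finset.set_ncard_biUnion_le _ _).trans (Finset.sum_le_sum fun r _ => hF r))
        (Set.ncard_image_le hf2)
    _ = _ := by
      rw [Set.ncard_prod, Set.ncard_eq_toFinset_card _ hfin, Finset.sum_const, smul_eq_mul]
      ring

lemma sq_ncard_le {α β : Type*} {X : Set α} (hX : X.Finite) (f : α → β) :
    X.ncard ^ 2 ≤ (f '' X).ncard * ((X ×ˢ X) ∩ {x | f x.1 = f x.2}).ncard := by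
  classical
  lift X to Finset α using hX
  have h1 : ((X : Set α) ×ˢ (X : Set α)) ∩ {x | f x.1 = f x.2} =
      ((X ×ˢ X).filter fun x => f x.1 = f x.2 : Finset (α × α)) := by
    ext x; simp
  rw [h1, ← Finset.coe_image, Set.ncard_coe_finset, Set.ncard_coe_finset, Set.ncard_coe_finset]
  have h2 : X.card = ∑ b ∈ X.image f, (X.filter fun a => f a = b).card :=
    Finset.card_eq_sum_card_image f X
  have h3 : ((X ×ˢ X).filter fun x => f x.1 = f x.2).card =
      ∑ b ∈ X.image f, (X.filter fun a => f a = b).card ^ 2 := by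
    rw [Finset.card_eq_sum_card_fiberwise (f := fun x => f x.1) (t := X.image f)]
    · refine Finset.sum_congr rfl fun b _ => ?_
      rw [sq, ← Finset.card_product]
      congr 1
      ext x
      simp only [Finset.mem_filter, Finset.mem_product]
      constructor
      · rintro ⟨⟨⟨h1, h2⟩, h3⟩, h4⟩; exact ⟨⟨h1, h4⟩, h2, h3 ▸ h4⟩
      · rintro ⟨⟨h1, h2⟩, h3, h4⟩; exact ⟨⟨⟨h1, h3⟩, h2.trans h4.symm⟩, h2⟩
    · intro x hx
      have := (Finset.mem_product.1 (Finset.mem_filter.1 hx).1).1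
      simpa using ⟨x.1, this, rfl⟩
  rw [h3]
  calc X.card ^ 2 = _ := by rw [h2]
    _ ≤ _ := sq_sum_le_card_mul_sum_sq

/-- The elements of `lipSphere p` give rise to many words of length `n`. -/
lemma exists_le_ncard_word {ε : ℝ} (hε : 0 < ε) : ∃ c : ℝ, 0 < c ∧ ∀ p n : ℕ, p.Prime → p ≠ 2 →
    p ≤ 5 ^ n → c * (p : ℝ) ^ (1 - ε) ≤ ((word n '' lipSphere p).ncard : ℝ) := by
  obtain ⟨C, hC, h⟩ := exists_ncard_dvd_gaussSnd_le hε
  set M : ℝ := ((lipSphere 1).ncard : ℝ) with hM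
  have hM0 : 0 < M := by
    rw [hM, Nat.cast_pos, Set.ncard_pos (finite_lipSphere 1)]
    exact ⟨1, by simp [lipSphere]⟩
  refine ⟨1 / (24 * M * (24 * C + 1)), by positivity, fun p n hp hp2 hpn => ?_⟩
  have : Fact p.Prime := ⟨hp⟩
  have h1 := sq_ncard_le (finite_lipSphere p) (word n)
  have h2 := ncard_pairs_le hp hp2 {r | (⟨2, 1⟩ : GaussianInt) ^ n ∣ gaussSnd r}
  have h3 := h p n hp.pos hpn
  have h4 := le_ncard_lipSphere p hp2
  have h5 : ((lipSphere p ×ˢ lipSphere p) ∩ {x | word n x.1 = word n x.2}).ncard ≤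
      ((lipSphere p ×ˢ lipSphere p) ∩ {x | star x.1 * x.2 ∈
        {r | (⟨2, 1⟩ : GaussianInt) ^ n ∣ gaussSnd r}}).ncard := by
    refine Set.ncard_le_ncard (fun x hx => ⟨hx.1, dvd_gaussSnd_of_word_eq hx.2⟩) ?_
    exact ((finite_lipSphere p).prod (finite_lipSphere p)).inter_of_left _
  have h6 : ((lipSphere p).ncard : ℝ) ^ 2 ≤ ((word n '' lipSphere p).ncard : ℝ) *
      (M * (C * (p : ℝ) ^ (1 + ε) + (lipSphere p).ncard)) := by
    calc _ ≤ ((word n '' lipSphere p).ncard : ℝ) * (M * (((lipSphere (p ^ 2) ∩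
          {r | (⟨2, 1⟩ : GaussianInt) ^ n ∣ gaussSnd r}).ncard : ℝ) + (lipSphere p).ncard)) := by
          rw [hM]; exact_mod_cast h1.trans (Nat.mul_le_mul_left _ (h5.trans h2))
      _ ≤ _ := by gcongr
  have hp3 : 3 ≤ p := by have := hp.two_le; omega
  have hA : (p : ℝ) ≤ 24 * ((lipSphere p).ncard : ℝ) := by
    have : p ≤ 24 * (lipSphere p).ncard := by omega
    exact_mod_cast this
  set A : ℝ := ((lipSphere p).ncard : ℝ)
  set W : ℝ := ((word n '' lipSphere p).ncard : ℝ)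
  have hp0 : (0 : ℝ) < p := by exact_mod_cast hp.pos
  have hA0 : 0 < A := by linarith
  have hpe : 1 ≤ (p : ℝ) ^ ε := Real.one_le_rpow (by exact_mod_cast hp.one_le) hε.le
  have hW : 0 ≤ W := Nat.cast_nonneg _
  have e1 : (p : ℝ) ^ (1 + ε) = p * (p : ℝ) ^ ε := by rw [Real.rpow_add hp0, Real.rpow_one]
  have e2 : (p : ℝ) ^ (1 - ε) = p / (p : ℝ) ^ ε := by rw [Real.rpow_sub hp0, Real.rpow_one]
  rw [e1] at h6
  rw [e2]
  set P : ℝ := (p : ℝ) ^ ε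
  have h7 : A ^ 2 ≤ W * (M * (24 * C + 1) * P * A) := by
    refine h6.trans (mul_le_mul_of_nonneg_left ?_ hW)
    have : C * (p * P) + A ≤ (24 * C + 1) * P * A := by
      have : C * (p * P) ≤ C * (24 * A * P) := by gcongr
      nlinarith
    calc _ ≤ M * ((24 * C + 1) * P * A) := by gcongr
      _ = _ := by ring
  have h8 : A ≤ W * (M * (24 * C + 1) * P) := by
    have : A * A ≤ (W * (M * (24 * C + 1) * P)) * A := by nlinarith
    exact le_of_mul_le_mul_right this hA0
  rw [div_mul_div_comm, one_mul, div_le_iff₀ (by positivity)]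
  nlinarith

/-- The unit sphere of imaginary quaternions. -/
def imSphere : Set ℍ := {x | x.re = 0 ∧ Quaternion.normSq x = 1}

lemma isCompact_imSphere : IsCompact imSphere := by
  refine (isCompact_closedBall (0 : ℍ) 1).of_isClosed_subset ?_ ?_
  · exact (isClosed_eq Quaternion.continuous_re continuous_const).inter
      (isClosed_eq Quaternion.continuous_normSq continuous_const)
  · rintro x ⟨-, hx⟩
    rw [Quaternion.normSq_eq_norm_mul_self] at hx
    rw [mem_closedBall_zero_iff]
    nlinarith [norm_nonneg x]

/-- The rotation attached to the inverse of a letter. -/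
noncomputable def rot (s : Fin 3 × Bool) (y : ℍ) : ℍ :=
  (5 : ℝ)⁻¹ • (star (lipCast (letter s)) * y * lipCast (letter s))

lemma normSq_lipCast_of_mem {n : ℕ} {q : ℍ[ℤ]} (hq : q ∈ lipSphere n) :
    Quaternion.normSq (lipCast q) = n := by
  rw [normSq_lipCast, show Quaternion.normSq q = n from hq]; norm_cast

lemma rot_eq (s : Fin 3 × Bool) (y : ℍ) :
    rot s y = (Quaternion.normSq (star (lipCast (letter s))))⁻¹ •
      (star (lipCast (letter s)) * y * star (star (lipCast (letter s)))) := by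
  rw [star_star, Quaternion.normSq_star, normSq_lipCast_of_mem (letter_mem s), rot]
  norm_num

lemma lipCast_ne_zero {n : ℕ} (hn : n ≠ 0) {q : ℍ[ℤ]} (hq : q ∈ lipSphere n) : lipCast q ≠ 0 := by
  rw [← Quaternion.normSq_ne_zero, normSq_lipCast_of_mem hq]; exact_mod_cast hn

lemma rot_mem (s : Fin 3 × Bool) {y : ℍ} (hy : y ∈ imSphere) : rot s y ∈ imSphere := by
  rw [rot_eq]
  refine ⟨?_, normSq_inv_smul_conj ?_ hy.2⟩
  · rw [Quaternion.re_smul, conj_re _ _ hy.1, smul_zero]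
  · exact star_ne_zero.2 (lipCast_ne_zero (by norm_num) (letter_mem s))

@[fun_prop]
lemma continuous_rot (s : Fin 3 × Bool) : Continuous (rot s) := by
  unfold rot; fun_prop

lemma norm_rot_sub_rot (s : Fin 3 × Bool) (x y : ℍ) : ‖rot s x - rot s y‖ = ‖x - y‖ := by
  have h : rot s x - rot s y = (5 : ℝ)⁻¹ • (star (lipCast (letter s)) * (x - y) *
      lipCast (letter s)) := by
    rw [rot, rot, ← smul_sub, mul_sub, sub_mul]
  have h5 : ‖lipCast (letter s)‖ * ‖lipCast (letter s)‖ = 5 := by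
    rw [← Quaternion.normSq_eq_norm_mul_self, normSq_lipCast_of_mem (letter_mem s)]; norm_num
  rw [h, norm_smul, norm_mul, norm_mul, norm_star]
  calc _ = ‖(5 : ℝ)⁻¹‖ * (‖lipCast (letter s)‖ * ‖lipCast (letter s)‖) * ‖x - y‖ := by ring
    _ = _ := by rw [h5]; norm_num

/-- The rotation of the quaternion `i` attached to `q`, of norm `p`. -/
noncomputable def orbitPt (p : ℕ) (q : ℍ[ℤ]) : ℍ :=
  (p : ℝ)⁻¹ • (lipCast q * quat 0 1 0 0 * star (lipCast q))

lemma orbitPt_mem {p : ℕ} (hp : p ≠ 0) {q : ℍ[ℤ]} (hq : q ∈ lipSphere p) :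
    orbitPt p q ∈ ratSphere p := by
  have h1 : (quat 0 1 0 0 : ℍ) ∈ ratSphere 1 := by
    refine ⟨rfl, by simp [Quaternion.normSq_def'], quat 0 1 0 0, ?_⟩
    ext <;> simp
  have := conj_mem_ratSphere hp hq h1
  rwa [normSq_lipCast_of_mem hq, one_mul] at this

lemma rot_orbitPt (p : ℕ) (q : ℍ[ℤ]) : rot (stepLetter q) (orbitPt p q) = orbitPt p (step q) := by
  set t := lipCast (letter (stepLetter q)) with ht
  have h1 : lipCast q * lipCast (letter (0, true)) = t * lipCast (step q) := by
    rw [ht, ← map_mul, ← map_mul, mul_letter_eq]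
  set π := lipCast (letter (0, true)) with hπ
  have h2 : star t * t = ((5 : ℝ) : ℍ) := by
    rw [Quaternion.star_mul_self, normSq_lipCast_of_mem (letter_mem _)]; norm_num
  have h3 : π * quat 0 1 0 0 * star π = (5 : ℝ) • quat 0 1 0 0 := by
    ext <;> simp [hπ, letter]; norm_num
  have h4 : (5 : ℝ) • lipCast (step q) = star t * lipCast q * π := by
    rw [mul_assoc, h1, ← mul_assoc, h2, Quaternion.coe_mul_eq_smul]
  have h5 : (25 : ℝ) • (lipCast (step q) * quat 0 1 0 0 * star (lipCast (step q))) =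
      (5 : ℝ) • (star t * (lipCast q * quat 0 1 0 0 * star (lipCast q)) * t) := by
    calc _ = ((5 : ℝ) • lipCast (step q)) * quat 0 1 0 0 * star ((5 : ℝ) • lipCast (step q)) := by
          rw [Quaternion.star_smul, smul_mul_assoc, smul_mul_assoc, mul_smul_comm, smul_smul]
          norm_num
      _ = star t * lipCast q * (π * quat 0 1 0 0 * star π) * star (lipCast q) * t := by
          rw [h4]; simp only [star_mul, star_star, mul_assoc]
      _ = _ := by
          rw [h3]; simp only [mul_assoc, mul_smul_comm, smul_mul_assoc]
  rw [rot, orbitPt, orbitPt, mul_smul_comm, smul_mul_assoc, smul_comm]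
  congr 1
  rw [inv_smul_eq_iff₀ (by norm_num)]
  have h6 := congrArg (fun z => (5 : ℝ)⁻¹ • z) h5
  simp only [smul_smul] at h6
  norm_num at h6
  rw [← h6]

/-- Reduced words, following the letter `s`, along which the point `y` stays away from `b`. -/
def AvoidWord (b : ℍ) (δ : ℝ) : ℍ → Fin 3 × Bool → List (Fin 3 × Bool) → Prop
  | _, _, [] => True
  | y, s, t :: l => t ≠ invLetter s ∧ δ ≤ ‖rot t y - b‖ ∧ AvoidWord b δ (rot t y) t l

open Classical in
/-- The number of avoiding words of given length. -/
noncomputable def avoidCount (b : ℍ) (δ : ℝ) : ℕ → ℍ → Fin 3 × Bool → ℕ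
  | 0, _, _ => 1
  | n + 1, y, s => ∑ t : Fin 3 × Bool, if t ≠ invLetter s ∧ δ ≤ ‖rot t y - b‖ then
      avoidCount b δ n (rot t y) t else 0

lemma ncard_avoidWord_le (b : ℍ) (δ : ℝ) (n : ℕ) (y : ℍ) (s : Fin 3 × Bool) :
    {l | l.length = n ∧ AvoidWord b δ y s l}.ncard ≤ avoidCount b δ n y s := by
  classical
  induction n generalizing y s with
  | zero =>
    calc _ ≤ ({[]} : Set (List (Fin 3 × Bool))).ncard :=
          Set.ncard_le_ncard fun l hl => List.length_eq_zero_iff.1 hl.1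
      _ = _ := by simp [avoidCount]
  | succ n ih =>
    have hfin : ∀ y s, {l | l.length = n ∧ AvoidWord b δ y s l}.Finite := fun y s =>
      (List.finite_length_eq _ n).subset fun l hl => hl.1
    let T : Fin 3 × Bool → Set (List (Fin 3 × Bool)) := fun t =>
      if t ≠ invLetter s ∧ δ ≤ ‖rot t y - b‖ then
        (List.cons t) '' {l | l.length = n ∧ AvoidWord b δ (rot t y) t l} else ∅
    have hT : ∀ t, (T t).Finite := fun t => by
      simp only [T]; split_ifs
      · exact (hfin _ _).image _
      · exact Set.finite_empty
    calc _ ≤ (⋃ t ∈ (Finset.univ : Finset (Fin 3 × Bool)), T t).ncard := by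
          refine Set.ncard_le_ncard ?_ (Set.Finite.biUnion (Finset.finite_toSet _) fun t _ => hT t)
          rintro (_ | ⟨t, l⟩) ⟨h1, h2⟩
          · simp at h1
          · simp only [Set.mem_iUnion]
            refine ⟨t, Finset.mem_univ _, ?_⟩
            simp only [T, if_pos (And.intro h2.1 h2.2.1)]
            exact ⟨l, ⟨by simpa using h1, h2.2.2⟩, rfl⟩
      _ ≤ ∑ t, (T t).ncard := Finset.set_ncard_biUnion_le _ _
      _ ≤ _ := by
        rw [avoidCount]
        refine Finset.sum_le_sum fun t _ => ?_
        simp only [T]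
        split_ifs
        · exact (Set.ncard_image_le (hfin _ _)).trans (ih _ _)
        · simp

lemma card_ne_invLetter (s : Fin 3 × Bool) :
    (Finset.univ.filter fun t => t ≠ invLetter s).card = 5 := by
  revert s; decide +kernel

lemma avoidCount_le (b : ℍ) (δ : ℝ) (n : ℕ) (y : ℍ) (s : Fin 3 × Bool) :
    avoidCount b δ n y s ≤ 5 ^ n := by
  classical
  induction n generalizing y s with
  | zero => simp [avoidCount]
  | succ n ih =>
    calc avoidCount b δ (n + 1) y s ≤ ∑ t, if t ≠ invLetter s then 5 ^ n else 0 := by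
          rw [avoidCount]
          refine Finset.sum_le_sum fun t _ => ?_
          split_ifs with h1 h2 h2
          · exact ih _ _
          · exact absurd h1.1 h2
          · exact Nat.zero_le _
          · exact le_rfl
      _ = 5 ^ (n + 1) := by
          rw [← Finset.sum_filter, Finset.sum_const, card_ne_invLetter, smul_eq_mul, pow_succ']

lemma avoidCount_add_le {b : ℍ} {δ : ℝ} {k B : ℕ}
    (hB : ∀ y ∈ imSphere, ∀ s, avoidCount b δ k y s ≤ B) (m : ℕ) {y : ℍ} (hy : y ∈ imSphere)
    (s : Fin 3 × Bool) : avoidCount b δ (k + m) y s ≤ B * avoidCount b δ m y s := by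
  classical
  induction m generalizing y s with
  | zero => simpa [avoidCount] using hB y hy s
  | succ m ih =>
    rw [← add_assoc, avoidCount, avoidCount, Finset.mul_sum]
    refine Finset.sum_le_sum fun t _ => ?_
    split_ifs
    · exact ih (rot_mem t hy) t
    · simp

lemma avoidCount_mul_le {b : ℍ} {δ : ℝ} {k B : ℕ}
    (hB : ∀ y ∈ imSphere, ∀ s, avoidCount b δ k y s ≤ B) (m : ℕ) {y : ℍ} (hy : y ∈ imSphere)
    (s : Fin 3 × Bool) : avoidCount b δ (k * m) y s ≤ B ^ m := by
  induction m generalizing y s with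
  | zero => simp [avoidCount]
  | succ m ih =>
    rw [mul_add, mul_one, add_comm, pow_succ']
    exact (avoidCount_add_le hB _ hy s).trans (Nat.mul_le_mul_left _ (ih hy s))

/-- The reduced word, following the letter `s`, brings the point `y` close to `b`. -/
def HitWord (b : ℍ) (δ : ℝ) : ℍ → Fin 3 × Bool → List (Fin 3 × Bool) → Prop
  | _, _, [] => False
  | y, s, t :: l => t ≠ invLetter s ∧ (‖rot t y - b‖ < δ ∨ HitWord b δ (rot t y) t l)

lemma avoidCount_lt {b : ℍ} {δ : ℝ} {k : ℕ} {y : ℍ} {s : Fin 3 × Bool}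
    {l : List (Fin 3 × Bool)} (hl : l.length ≤ k) (h : HitWord b δ y s l) :
    avoidCount b δ k y s < 5 ^ k := by
  classical
  induction l generalizing k y s with
  | nil => exact h.elim
  | cons t l ih =>
    obtain ⟨k, rfl⟩ : ∃ k', k = k' + 1 := ⟨k - 1, by rw [List.length_cons] at hl; omega⟩
    calc avoidCount b δ (k + 1) y s < ∑ t, if t ≠ invLetter s then 5 ^ k else 0 := by
          rw [avoidCount]
          refine Finset.sum_lt_sum (fun t _ => ?_) ⟨t, Finset.mem_univ _, ?_⟩
          · split_ifs with h1 h2 h2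
            · exact avoidCount_le _ _ _ _ _
            · exact absurd h1.1 h2
            · exact Nat.zero_le _
            · exact le_rfl
          · rw [if_pos h.1]
            split_ifs with h1
            · refine ih (by simpa using hl) (h.2.resolve_left (not_lt.2 h1.2))
            · positivity
      _ = 5 ^ (k + 1) := by
          rw [← Finset.sum_filter, Finset.sum_const, card_ne_invLetter, smul_eq_mul, pow_succ']

lemma isOpen_hitWord (b : ℍ) (δ : ℝ) (s : Fin 3 × Bool) (l : List (Fin 3 × Bool)) :
    IsOpen {y | HitWord b δ y s l} := by
  induction l generalizing s with
  | nil => exact isOpen_empty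
  | cons t l ih =>
    have h1 : IsOpen {y : ℍ | ‖rot t y - b‖ < δ} := isOpen_lt (by fun_prop) continuous_const
    have h2 : IsOpen (rot t ⁻¹' {y | HitWord b δ y t l}) := (ih t).preimage (continuous_rot t)
    by_cases h : t ≠ invLetter s
    · convert h1.union h2 using 1
      ext y; simp [HitWord, h]
    · convert isOpen_empty using 1
      ext y; simp [HitWord, h]

/-- The image of a point under a positive word. -/
noncomputable def posOrbit (y : ℍ) : List (Fin 3) → ℍ
  | [] => y
  | i :: l => rot (i, true) (posOrbit y l)

lemma posOrbit_append (y : ℍ) (l : List (Fin 3)) (i : Fin 3) :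
    posOrbit y (l ++ [i]) = posOrbit (rot (i, true) y) l := by
  induction l with
  | nil => rfl
  | cons j l ih => rw [List.cons_append, posOrbit, ih, posOrbit]

lemma posOrbit_mem {y : ℍ} (hy : y ∈ imSphere) (l : List (Fin 3)) : posOrbit y l ∈ imSphere := by
  induction l with
  | nil => exact hy
  | cons i l ih => exact rot_mem _ ih

lemma mem_closure_range_posOrbit {y b : ℍ} (hy : y ∈ imSphere) (hb : b ∈ imSphere) :
    b ∈ closure (Set.range (posOrbit y)) := by
  refine sphere_subset_of_conj_mem
    (Q := Set.range fun i : Fin 3 => star (lipCast (letter (i, true)))) isClosed_closure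
    ⟨y, subset_closure (Set.mem_range_self [])⟩ ?_ ?_ ?_ ?_ hb.1 hb.2
  · exact closure_minimal (Set.range_subset_iff.2 (posOrbit_mem hy)) isCompact_imSphere.isClosed
  · rintro _ ⟨i, rfl⟩ x hx
    simp only
    rw [← rot_eq]
    refine map_mem_closure (continuous_rot _) hx ?_
    rintro _ ⟨l, rfl⟩
    exact ⟨i :: l, rfl⟩
  · rintro _ ⟨i, rfl⟩
    refine ⟨fun h => ?_, 16 / 5, ?_, fun n hn => ?_⟩
    · have h1 := congrArg (·.imI) h
      have h2 := congrArg (·.imJ) h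
      have h3 := congrArg (·.imK) h
      fin_cases i <;> simp [letter] at h1 h2 h3
    · simp only
      rw [Quaternion.normSq_star, normSq_lipCast_of_mem (letter_mem _)]
      simp [letter]; norm_num
    · have h1 : (16 : ℝ) = 5 * n := by rw [← hn]; norm_num
      have h2 : (16 : ℤ) = 5 * n := by exact_mod_cast h1
      omega
  · intro w hw h
    have h0 := h _ (Set.mem_range_self 0)
    have h1 := h _ (Set.mem_range_self 1)
    have h2 := h _ (Set.mem_range_self 2)
    simp [letter] at h0 h1 h2
    ext <;> simp [hw, h0, h1, h2]

lemma exists_hitWord_of_posOrbit {b : ℍ} {δ : ℝ} (l : List (Fin 3)) {y : ℍ} (i : Fin 3)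
    (h : ‖posOrbit y l - b‖ < δ) : ‖y - b‖ < δ ∨ ∃ l', HitWord b δ y (i, true) l' := by
  induction l using List.reverseRecOn generalizing y i with
  | nil => exact Or.inl h
  | append_singleton l j ih =>
    right
    rw [posOrbit_append] at h
    have hne : ((j, true) : Fin 3 × Bool) ≠ invLetter (i, true) := by simp [invLetter]
    rcases ih j h with h | ⟨l', h⟩
    · exact ⟨[(j, true)], hne, Or.inl h⟩
    · exact ⟨(j, true) :: l', hne, Or.inr h⟩

lemma exists_hitWord {b : ℍ} (hb : b ∈ imSphere) {δ : ℝ} (hδ : 0 < δ) {y : ℍ} (hy : y ∈ imSphere)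
    (s : Fin 3 × Bool) : ∃ l, HitWord b δ y s l := by
  obtain ⟨i, hi⟩ : ∃ i : Fin 3, (i, true) ≠ invLetter s := by
    revert s; decide +kernel
  obtain ⟨_, ⟨l, rfl⟩, hl⟩ := Metric.mem_closure_iff.1
    (mem_closure_range_posOrbit (rot_mem (i, true) hy) hb) δ hδ
  rw [dist_comm, dist_eq_norm] at hl
  rcases exists_hitWord_of_posOrbit l i hl with h | ⟨l', h⟩
  · exact ⟨[(i, true)], hi, Or.inl h⟩
  · exact ⟨(i, true) :: l', hi, Or.inr h⟩

lemma exists_avoidCount_lt {b : ℍ} (hb : b ∈ imSphere) {δ : ℝ} (hδ : 0 < δ) :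
    ∃ k, ∀ y ∈ imSphere, ∀ s, avoidCount b δ k y s < 5 ^ k := by
  obtain ⟨k, hk⟩ : ∃ k, ∀ y ∈ imSphere, ∀ s, ∃ l, l.length ≤ k ∧ HitWord b δ y s l := by
    refine isCompact_imSphere.induction_on
      (p := fun A => ∃ k, ∀ y ∈ A, ∀ s, ∃ l, l.length ≤ k ∧ HitWord b δ y s l) ?_ ?_ ?_ ?_
    · exact ⟨0, by simp⟩
    · rintro A B hAB ⟨k, hk⟩
      exact ⟨k, fun y hy => hk y (hAB hy)⟩
    · rintro A B ⟨k, hk⟩ ⟨k', hk'⟩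
      refine ⟨max k k', fun y hy s => ?_⟩
      rcases hy with hy | hy
      · obtain ⟨l, h1, h2⟩ := hk y hy s
        exact ⟨l, h1.trans (le_max_left _ _), h2⟩
      · obtain ⟨l, h1, h2⟩ := hk' y hy s
        exact ⟨l, h1.trans (le_max_right _ _), h2⟩
    · intro y hy
      choose l hl using exists_hitWord hb hδ hy
      refine ⟨⋂ s, {z | HitWord b δ z s (l s)}, mem_nhdsWithin_of_mem_nhds ?_,
        Finset.univ.sup fun s => (l s).length, fun z hz s =>
          ⟨l s, Finset.le_sup (f := fun s => (l s).length) (Finset.mem_univ s),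
            Set.mem_iInter.1 hz s⟩⟩
      exact (isOpen_iInter_of_finite fun s => isOpen_hitWord b δ s (l s)).mem_nhds
        (Set.mem_iInter.2 hl)
  refine ⟨k, fun y hy s => ?_⟩
  obtain ⟨l, h1, h2⟩ := hk y hy s
  exact avoidCount_lt h1 h2

lemma avoidWord_word {p : ℕ} (hp : p ≠ 0) (hp5 : ¬ 5 ∣ p) {b : ℍ} {δ : ℝ}
    (h : ∀ x ∈ ratSphere p, 2 * δ ≤ ‖x - b‖) (n : ℕ) {q : ℍ[ℤ]} (hq : q ∈ lipSphere p) {y : ℍ}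
    (hy : ‖orbitPt p q - y‖ ≤ δ) {s : Fin 3 × Bool} (hs : stepLetter q ≠ invLetter s) :
    AvoidWord b δ y s (word n q) := by
  induction n generalizing q y s with
  | zero => trivial
  | succ n ih =>
    have h1 := norm_rot_sub_rot (stepLetter q) (orbitPt p q) y
    rw [rot_orbitPt] at h1
    refine ⟨hs, ?_, ih (step_mem hq) (h1.trans_le hy) (stepLetter_step_ne hp5 hq)⟩
    have h2 := h _ (orbitPt_mem hp (step_mem hq))
    have h3 := norm_sub_le_norm_sub_add_norm_sub (orbitPt p (step q))
      (rot (stepLetter q) y) b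
    linarith

lemma ratSphere_subset_imSphere (n : ℕ) : ratSphere n ⊆ imSphere := fun _ h => ⟨h.1, h.2.1⟩

lemma exists_ncard_word_le (b : ℍ) {δ : ℝ} (hδ : 0 < δ) : ∃ M : ℕ, ∀ p : ℕ, p ≠ 0 →
    ¬ 5 ∣ p → (∀ x ∈ ratSphere p, 2 * δ ≤ ‖x - b‖) → ∀ n N : ℕ,
    (∀ y ∈ imSphere, ∀ s, avoidCount b δ n y s ≤ N) → (word n '' lipSphere p).ncard ≤ M * N := by
  obtain ⟨Y, hYS, hYfin, hY⟩ := isCompact_imSphere.finite_cover_balls hδ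
  lift Y to Finset ℍ using hYfin
  refine ⟨Y.card * 6, fun p hp hp5 hfar n N hN => ?_⟩
  have hfin : ∀ y s, {l | l.length = n ∧ AvoidWord b δ y s l}.Finite := fun y s =>
    (List.finite_length_eq _ n).subset fun l hl => hl.1
  calc _ ≤ (⋃ x ∈ Y ×ˢ (Finset.univ : Finset (Fin 3 × Bool)),
        {l | l.length = n ∧ AvoidWord b δ x.1 x.2 l}).ncard := by
        refine Set.ncard_le_ncard ?_ (Set.Finite.biUnion (Finset.finite_toSet _)
          fun x _ => hfin _ _)
        rintro _ ⟨q, hq, rfl⟩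
        obtain ⟨y, hyY, hy⟩ := Set.mem_iUnion₂.1
          (hY (ratSphere_subset_imSphere p (orbitPt_mem hp hq)))
        simp only [Set.mem_iUnion]
        refine ⟨(y, stepLetter q), Finset.mem_product.2 ⟨hyY, Finset.mem_univ _⟩,
          length_word n q, avoidWord_word hp hp5 hfar n hq ?_ ?_⟩
        · rw [Metric.mem_ball, dist_eq_norm] at hy
          exact hy.le
        · intro h
          have := congrArg Prod.snd h
          simp [invLetter] at this
    _ ≤ ∑ x ∈ Y ×ˢ (Finset.univ : Finset (Fin 3 × Bool)),
        {l | l.length = n ∧ AvoidWord b δ x.1 x.2 l}.ncard := Finset.set_ncard_biUnion_le _ _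
    _ ≤ ∑ x ∈ Y ×ˢ (Finset.univ : Finset (Fin 3 × Bool)), N :=
        Finset.sum_le_sum fun x hx => (ncard_avoidWord_le b δ n x.1 x.2).trans
          (hN _ (hYS (Finset.mem_product.1 hx).1) _)
    _ = _ := by
      rw [Finset.sum_const, Finset.card_product, smul_eq_mul]
      simp

lemma exists_forall_prime_ratSphere {b : ℍ} (hb : b ∈ imSphere) {δ : ℝ} (hδ : 0 < δ) :
    ∃ P : ℕ, ∀ p : ℕ, p.Prime → P ≤ p → ∃ x ∈ ratSphere p, ‖x - b‖ < 2 * δ := by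
  obtain ⟨k, hk⟩ := exists_avoidCount_lt hb hδ
  obtain ⟨M, hM⟩ := exists_ncard_word_le b hδ
  have hk0 : k ≠ 0 := by
    rintro rfl
    have := hk b hb (0, true)
    simp [avoidCount] at this
  have h5 : 5 ≤ 5 ^ k := Nat.le_self_pow hk0 5
  set K : ℕ := 5 ^ k with hK
  set ρ : ℝ := Real.logb K (K - 1 : ℕ) with hρ
  have hK1 : (1 : ℝ) < K := by exact_mod_cast (by omega : 1 < K)
  have hKρ : (K : ℝ) ^ ρ = (K - 1 : ℕ) :=
    Real.rpow_logb (by linarith) hK1.ne' (by exact_mod_cast (by omega : 0 < K - 1))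
  have hρ1 : ρ < 1 := by
    rw [hρ, Real.logb_lt_iff_lt_rpow hK1 (by exact_mod_cast (by omega : 0 < K - 1)), Real.rpow_one]
    exact_mod_cast (by omega : K - 1 < K)
  have hρ0 : 0 ≤ ρ := Real.logb_nonneg hK1 (by exact_mod_cast (by omega : 1 ≤ K - 1))
  obtain ⟨c, hc, hW⟩ := exists_le_ncard_word (ε := (1 - ρ) / 2) (by linarith)
  have hlim : Filter.Tendsto (fun n : ℕ => (n : ℝ) ^ ((1 - ρ) / 2)) Filter.atTop Filter.atTop :=
    (tendsto_rpow_atTop (by linarith)).comp tendsto_natCast_atTop_atTop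
  obtain ⟨P, hP⟩ := Filter.eventually_atTop.1 (hlim.eventually_gt_atTop (M * K / c))
  refine ⟨max P 6, fun p hp hPp => ?_⟩
  by_contra! hfar
  have hp6 : 6 ≤ p := (le_max_right _ _).trans hPp
  have hp5 : ¬ 5 ∣ p := fun h => by
    have := (Nat.prime_dvd_prime_iff_eq Nat.prime_five hp).1 h
    omega
  set m := Nat.clog K p with hm
  have h1 : p ≤ K ^ m := Nat.le_pow_clog (by omega) p
  have h2 : K ^ m ≤ K * p := by
    have h3 := Nat.pow_pred_clog_lt_self (b := K) (by omega) (x := p) (by omega)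
    have h4 : 0 < m := Nat.clog_pos (by omega) (by omega)
    calc K ^ m = K * K ^ m.pred := by rw [← pow_succ', ← Nat.succ_eq_add_one, Nat.succ_pred h4.ne']
      _ ≤ K * p := Nat.mul_le_mul_left _ h3.le
  have h3 := hM p hp.ne_zero hp5 hfar (k * m) ((K - 1) ^ m) fun y hy s =>
    avoidCount_mul_le (fun y hy s => Nat.le_sub_one_of_lt (hk y hy s)) m hy s
  have h4 := hW p (k * m) hp (by omega) (by rw [pow_mul]; exact h1)
  have hp0 : (0 : ℝ) < p := by exact_mod_cast hp.pos
  have h6 : (((K - 1 : ℕ) : ℝ)) ^ m ≤ K * (p : ℝ) ^ ρ := by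
    calc (((K - 1 : ℕ) : ℝ)) ^ m = ((K : ℝ) ^ m) ^ ρ := by
          rw [← hKρ, ← Real.rpow_natCast, ← Real.rpow_natCast, ← Real.rpow_mul (by linarith),
            ← Real.rpow_mul (by linarith), mul_comm]
      _ ≤ ((K : ℝ) * p) ^ ρ := by
          refine Real.rpow_le_rpow (by positivity) ?_ hρ0
          exact_mod_cast h2
      _ = (K : ℝ) ^ ρ * (p : ℝ) ^ ρ := Real.mul_rpow (by linarith) hp0.le
      _ ≤ (K : ℝ) ^ (1 : ℝ) * (p : ℝ) ^ ρ := by gcongr; exact hK1.le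
      _ = _ := by rw [Real.rpow_one]
  have h7 : c * (p : ℝ) ^ (1 - (1 - ρ) / 2) ≤ M * (K * (p : ℝ) ^ ρ) := by
    refine h4.trans ?_
    calc _ ≤ ((M * (K - 1) ^ m : ℕ) : ℝ) := by exact_mod_cast h3
      _ = M * ((K - 1 : ℕ) : ℝ) ^ m := by push_cast; rfl
      _ ≤ _ := by gcongr
  have h8 : (p : ℝ) ^ (1 - (1 - ρ) / 2) = (p : ℝ) ^ ((1 - ρ) / 2) * (p : ℝ) ^ ρ := by
    rw [← Real.rpow_add hp0]; congr 1; ring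
  have h9 := hP p ((le_max_left _ _).trans hPp)
  rw [h8, ← mul_assoc, ← mul_assoc] at h7
  have h10 := le_of_mul_le_mul_right h7 (Real.rpow_pos_of_pos hp0 ρ)
  rw [div_lt_iff₀ hc] at h9
  linarith

/-- Rational points of large odd denominator accumulate everywhere on the sphere. -/
lemma exists_forall_odd_ratSphere {b : ℍ} (hb : b ∈ imSphere) {δ : ℝ} (hδ : 0 < δ) :
    ∃ N : ℕ, ∀ n : ℕ, Odd n → N ≤ n → ∃ x ∈ ratSphere n, ‖x - b‖ < δ := by
  obtain ⟨P, hP⟩ := exists_forall_prime_ratSphere hb (half_pos hδ)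
  have hpow : ∀ p : ℕ, ∃ k : ℕ, p.Prime → p ≠ 2 → ∃ x ∈ ratSphere (p ^ k), ‖x - b‖ < δ := by
    intro p
    by_cases hp : p.Prime ∧ p ≠ 2
    · obtain ⟨x, hx, hxb⟩ := Metric.mem_closure_iff.1
        (mem_closure_ratSphere_prime_pow hp.1 hp.2 hb.1 hb.2) δ hδ
      obtain ⟨k, hk⟩ := Set.mem_iUnion.1 hx
      exact ⟨k, fun _ _ => ⟨x, hk, by rwa [← dist_eq_norm, dist_comm]⟩⟩
    · exact ⟨0, fun h1 h2 => absurd ⟨h1, h2⟩ hp⟩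
  choose k hk using hpow
  set N : ℕ := ∏ p ∈ (Finset.range P).filter Nat.Prime, p ^ k p with hN
  have hN0 : N ≠ 0 := Finset.prod_ne_zero_iff.2 fun p hp =>
    pow_ne_zero _ (Finset.mem_filter.1 hp).2.ne_zero
  refine ⟨N + 1, fun n hn hNn => ?_⟩
  have hn0 : n ≠ 0 := by omega
  by_cases h : ∃ p, p.Prime ∧ P ≤ p ∧ p ∣ n
  · obtain ⟨p, hp, hPp, hpn⟩ := h
    obtain ⟨x, hx, hxb⟩ := hP p hp hPp
    exact ⟨x, ratSphere_mono hpn hx, by linarith⟩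
  · push Not at h
    obtain ⟨p, hp, hpn⟩ : ∃ p, p.Prime ∧ p ^ k p ∣ n ∧ p ∣ n := by
      by_contra! hcon
      have hdvd : n ∣ N := by
        rw [Nat.dvd_iff_prime_pow_dvd_dvd]
        intro p j hp hj
        rcases Nat.eq_zero_or_pos j with rfl | hj0
        · simp
        have hpn : p ∣ n := (dvd_pow_self p hj0.ne').trans hj
        have hjk : j ≤ k p := by
          by_contra! hlt
          exact hcon p hp ((pow_dvd_pow p hlt.le).trans hj) hpn
        refine (pow_dvd_pow p hjk).trans (Finset.dvd_prod_of_mem (fun p => p ^ k p) ?_)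
        rw [Finset.mem_filter, Finset.mem_range]
        exact ⟨not_le.1 fun hle => h p hp hle hpn, hp⟩
      have := Nat.le_of_dvd (Nat.pos_of_ne_zero hN0) hdvd
      omega
    have hp2 : p ≠ 2 := by
      rintro rfl
      rw [← Nat.not_even_iff_odd, even_iff_two_dvd] at hn
      exact hn hpn.2
    obtain ⟨x, hx, hxb⟩ := hk p hp hp2
    exact ⟨x, ratSphere_mono hpn.1 hx, hxb⟩

end

section

open scoped ContDiff Nat Quaternion

/-- The partial derivative in the `i`-th coordinate direction of a vector-valued function. -/
def pdv {G : Type*} [NormedAddCommGroup G] [NormedSpace ℝ G] (i : Fin 3) (f : E3 → G) : E3 → G :=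
  fun x => fderiv ℝ f x (EuclideanSpace.single i 1)

/-- Smooth solutions of the Helmholtz equation `Δ f = -λ² f` on `ℝ³`. -/
def IsHelmholtz {G : Type*} [NormedAddCommGroup G] [NormedSpace ℝ G] (lam : ℝ) (f : E3 → G) :
    Prop :=
  ContDiff ℝ ∞ f ∧ ∀ x, ∑ i, pdv i (pdv i f) x = -(lam ^ 2) • f x

section pdv

variable {G H : Type*} [NormedAddCommGroup G] [NormedSpace ℝ G]
  [NormedAddCommGroup H] [NormedSpace ℝ H] {f g : E3 → G} {lam : ℝ}

theorem contDiff_pdv (hf : ContDiff ℝ ∞ f) (i : Fin 3) : ContDiff ℝ ∞ (pdv i f) :=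
  (hf.fderiv_right (by simp)).clm_apply contDiff_const

theorem smooth_differentiable (hf : ContDiff ℝ ∞ f) : Differentiable ℝ f :=
  hf.differentiable (by simp)

theorem pdv_add (hf : ContDiff ℝ ∞ f) (hg : ContDiff ℝ ∞ g) (i : Fin 3) :
    pdv i (fun x => f x + g x) = fun x => pdv i f x + pdv i g x := by
  ext x
  simp only [pdv]
  rw [fderiv_fun_add (smooth_differentiable hf x) (smooth_differentiable hg x)]
  simp

theorem pdv_sub (hf : ContDiff ℝ ∞ f) (hg : ContDiff ℝ ∞ g) (i : Fin 3) :
    pdv i (fun x => f x - g x) = fun x => pdv i f x - pdv i g x := by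
  ext x
  simp only [pdv]
  rw [fderiv_fun_sub (smooth_differentiable hf x) (smooth_differentiable hg x)]
  simp

theorem pdv_clm (hf : ContDiff ℝ ∞ f) (L : G →L[ℝ] H) (i : Fin 3) :
    pdv i (fun x => L (f x)) = fun x => L (pdv i f x) := by
  ext x
  simp only [pdv]
  have h : HasFDerivAt (fun x => L (f x)) (L.comp (fderiv ℝ f x)) x :=
    L.hasFDerivAt.comp x (smooth_differentiable hf x).hasFDerivAt
  rw [h.fderiv]
  rfl

theorem pdv_const_smul (hf : ContDiff ℝ ∞ f) (c : ℝ) (i : Fin 3) :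
    pdv i (fun x => c • f x) = fun x => c • pdv i f x :=
  pdv_clm hf (c • ContinuousLinearMap.id ℝ G) i

theorem pdv_sum {ι : Type*} (s : Finset ι) {F : ι → E3 → G} (hF : ∀ j ∈ s, ContDiff ℝ ∞ (F j))
    (i : Fin 3) : pdv i (fun x => ∑ j ∈ s, F j x) = fun x => ∑ j ∈ s, pdv i (F j) x := by
  ext x
  simp only [pdv]
  rw [fderiv_fun_sum fun j hj => smooth_differentiable (hF j hj) x]
  simp

theorem pdv_comm (hf : ContDiff ℝ ∞ f) (i j : Fin 3) : pdv i (pdv j f) = pdv j (pdv i f) := by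
  ext x
  have key : ∀ a b : Fin 3, pdv a (pdv b f) x =
      fderiv ℝ (fderiv ℝ f) x (EuclideanSpace.single a 1) (EuclideanSpace.single b 1) := by
    intro a b
    have h := (hf.fderiv_right (m := ∞) (by simp)).differentiable (by simp) x
    have := (h.hasFDerivAt.clm_apply
      (hasFDerivAt_const (EuclideanSpace.single b (1 : ℝ) : E3) x)).fderiv
    change fderiv ℝ (fun y => fderiv ℝ f y (EuclideanSpace.single b 1)) x _ = _
    rw [this]
    simp
  rw [key, key]
  exact (hf.contDiffAt.isSymmSndFDerivAt (by
    simp only [minSmoothness_of_isRCLikeNormedField]; exact WithTop.coe_le_coe.2 (le_top : (2 : ℕ∞) ≤ ⊤))).eq _ _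

theorem hasDerivAt_line (hf : ContDiff ℝ ∞ f) (x : E3) (i : Fin 3) (t : ℝ) :
    HasDerivAt (fun s : ℝ => f (x + s • EuclideanSpace.single i (1 : ℝ)))
      (pdv i f (x + t • EuclideanSpace.single i (1 : ℝ))) t := by
  have h1 : HasDerivAt (fun s : ℝ => x + s • (EuclideanSpace.single i (1 : ℝ) : E3))
      (EuclideanSpace.single i (1 : ℝ)) t := by
    simpa using ((hasDerivAt_id t).smul_const (EuclideanSpace.single i (1 : ℝ) : E3)).const_add x
  exact (smooth_differentiable hf _).hasFDerivAt.comp_hasDerivAt t h1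

namespace IsHelmholtz

theorem pdv_mem (hf : IsHelmholtz lam f) (i : Fin 3) : IsHelmholtz lam (pdv i f) := by
  refine ⟨contDiff_pdv hf.1 i, fun x => ?_⟩
  have h : (fun x => ∑ j, pdv j (pdv j f) x) = fun x => (-(lam ^ 2)) • f x := funext hf.2
  have h2 := congrFun (congrArg (pdv i) h) x
  rw [pdv_const_smul hf.1,
    pdv_sum _ fun j _ => contDiff_pdv (contDiff_pdv hf.1 j) j] at h2
  simp only at h2
  rw [← h2]
  refine Finset.sum_congr rfl fun j _ => ?_
  rw [pdv_comm hf.1 j i, pdv_comm (contDiff_pdv hf.1 j) i j]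

theorem add (hf : IsHelmholtz lam f) (hg : IsHelmholtz lam g) :
    IsHelmholtz lam (fun x => f x + g x) := by
  refine ⟨hf.1.add hg.1, fun x => ?_⟩
  simp only [pdv_add hf.1 hg.1, pdv_add (contDiff_pdv hf.1 _) (contDiff_pdv hg.1 _),
    Finset.sum_add_distrib, hf.2, hg.2, smul_add]

theorem sub (hf : IsHelmholtz lam f) (hg : IsHelmholtz lam g) :
    IsHelmholtz lam (fun x => f x - g x) := by
  refine ⟨hf.1.sub hg.1, fun x => ?_⟩
  simp only [pdv_sub hf.1 hg.1, pdv_sub (contDiff_pdv hf.1 _) (contDiff_pdv hg.1 _),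
    Finset.sum_sub_distrib, hf.2, hg.2, smul_sub]

theorem clm (hf : IsHelmholtz lam f) (L : G →L[ℝ] H) : IsHelmholtz lam (fun x => L (f x)) := by
  refine ⟨L.contDiff.comp hf.1, fun x => ?_⟩
  simp only [pdv_clm hf.1, pdv_clm (contDiff_pdv hf.1 _)]
  rw [← map_sum, hf.2, map_smul]

end IsHelmholtz

end pdv

/-- Second derivative test: at a local maximum the second derivative is nonpositive. -/
theorem IsLocalMax.second_deriv_nonpos {χ χ' : ℝ → ℝ} {χ'' t : ℝ}
    (h1 : ∀ s, HasDerivAt χ (χ' s) s) (h2 : HasDerivAt χ' χ'' t) (hmax : IsLocalMax χ t) :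
    χ'' ≤ 0 := by
  by_contra hpos
  push Not at hpos
  have hd : deriv χ = χ' := funext fun s => (h1 s).deriv
  have h0 : deriv χ t = 0 := hmax.deriv_eq_zero
  have hmin : IsLocalMin χ t := by
    apply isLocalMin_of_deriv_deriv_pos _ h0 (h1 t).continuousAt
    rw [hd, h2.deriv]; exact hpos
  have hev : χ =ᶠ[nhds t] fun _ => χ t := by
    filter_upwards [hmax, hmin] with s h3 h4 using le_antisymm h3 h4
  have hev2 : χ' =ᶠ[nhds t] fun _ => 0 := by
    filter_upwards [hev.eventuallyEq_nhds] with s hs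
    rw [← hd, hs.deriv_eq]; simp
  have := h2.unique (hev2.hasDerivAt_iff.mpr (hasDerivAt_const t 0))
  linarith

/-- One-dimensional second derivative test for `ψ² ∑ Gⱼ² + α g²`. -/
theorem bernstein_line {α p q : ℝ} {g g' : ℝ → ℝ} {g'' : ℝ} {G G' : Fin 3 → ℝ → ℝ}
    {G'' : Fin 3 → ℝ} (hg : ∀ s, HasDerivAt g (g' s) s) (hg' : HasDerivAt g' g'' 0)
    (hG : ∀ j s, HasDerivAt (G j) (G' j s) s) (hG' : ∀ j, HasDerivAt (G' j) (G'' j) 0)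
    (hmax : IsLocalMax (fun s => (p - 2 * q * s - s ^ 2) ^ 2 * (∑ j, G j s ^ 2) + α * g s ^ 2) 0) :
    (8 * q ^ 2 - 4 * p) * (∑ j, G j 0 ^ 2) - 16 * p * q * (∑ j, G j 0 * G' j 0) +
      2 * p ^ 2 * (∑ j, G' j 0 ^ 2) + 2 * p ^ 2 * (∑ j, G j 0 * G'' j) +
      2 * α * g' 0 ^ 2 + 2 * α * (g 0 * g'') ≤ 0 := by
  have hψ : ∀ s : ℝ, HasDerivAt (fun s : ℝ => p - 2 * q * s - s ^ 2) (-2 * q - 2 * s) s := by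
    intro s
    refine ((((hasDerivAt_id' s).const_mul (2 * q)).const_sub p).fun_sub
      ((hasDerivAt_id' s).fun_pow 2)).congr_deriv ?_
    simp
  have hψ' : HasDerivAt (fun s : ℝ => -2 * q - 2 * s) (-2) 0 := by
    have := ((hasDerivAt_id (0 : ℝ)).const_mul 2).const_sub (-2 * q)
    simpa using this
  have hS : ∀ s, HasDerivAt (fun s => ∑ j, G j s ^ 2) (2 * ∑ j, G j s * G' j s) s := by
    intro s
    have := HasDerivAt.fun_sum (u := Finset.univ) fun j _ => (hG j s).fun_pow 2
    refine this.congr_deriv ?_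
    rw [Finset.mul_sum]
    exact Finset.sum_congr rfl fun j _ => by push_cast; ring
  have hS' : HasDerivAt (fun s => 2 * ∑ j, G j s * G' j s)
      (2 * ∑ j, (G' j 0 ^ 2 + G j 0 * G'' j)) 0 := by
    have := (HasDerivAt.fun_sum (u := Finset.univ) fun j _ => (hG j 0).fun_mul (hG' j)).const_mul 2
    refine this.congr_deriv ?_
    exact congrArg _ (Finset.sum_congr rfl fun j _ => by ring)
  have h1 : ∀ s, HasDerivAt
      (fun s => (p - 2 * q * s - s ^ 2) ^ 2 * (∑ j, G j s ^ 2) + α * g s ^ 2)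
      (2 * (p - 2 * q * s - s ^ 2) * (-2 * q - 2 * s) * (∑ j, G j s ^ 2) +
        (p - 2 * q * s - s ^ 2) ^ 2 * (2 * ∑ j, G j s * G' j s) + α * (2 * g s * g' s)) s := by
    intro s
    have := (((hψ s).fun_pow 2).fun_mul (hS s)).fun_add (((hg s).fun_pow 2).const_mul α)
    refine this.congr_deriv ?_
    push_cast
    ring
  have h2 := ((((hψ 0).const_mul 2).fun_mul hψ').fun_mul (hS 0)).fun_add
    (((hψ 0).fun_pow 2).fun_mul hS') |>.fun_add ((((hg 0).const_mul 2).fun_mul hg').const_mul α)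
  have := IsLocalMax.second_deriv_nonpos h1 h2 hmax
  simp only [Finset.sum_add_distrib] at this
  refine le_trans (le_of_eq ?_) this
  ring

theorem IsHelmholtz.grad_sq_le {lam : ℝ} {f : E3 → ℝ} (hf : IsHelmholtz lam f) {c : E3} {r S : ℝ}
    (hr : 0 < r) (hS : ∀ x ∈ Metric.closedBall c r, |f x| ≤ S) :
    r ^ 2 * ∑ j, pdv j f c ^ 2 ≤ (24 + 4 * lam ^ 2 * r ^ 2) * S ^ 2 := by
  set α : ℝ := 24 * r ^ 2 + 2 * lam ^ 2 * r ^ 4 with hα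
  have hαpos : 0 < α := by positivity
  set w : E3 → ℝ := fun x => (r ^ 2 - ‖x - c‖ ^ 2) ^ 2 * (∑ j, pdv j f x ^ 2) + α * f x ^ 2 with hw
  have hcont : Continuous w := by
    have := hf.1.continuous
    have h2 : ∀ j, Continuous (pdv j f) := fun j => (contDiff_pdv hf.1 j).continuous
    fun_prop
  obtain ⟨x₀, hx₀, hmax⟩ := (isCompact_closedBall c r).exists_isMaxOn
    ⟨c, Metric.mem_closedBall_self hr.le⟩ hcont.continuousOn
  have hsq : ∀ x ∈ Metric.closedBall c r, f x ^ 2 ≤ S ^ 2 := fun x hx =>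
    sq_le_sq' (abs_le.1 (hS x hx)).1 (abs_le.1 (hS x hx)).2
  have hcw : w c ≤ w x₀ := hmax (Metric.mem_closedBall_self hr.le)
  have hwc : r ^ 4 * ∑ j, pdv j f c ^ 2 ≤ w c := by
    have : 0 ≤ α * f c ^ 2 := by positivity
    simp only [hw, sub_self, norm_zero]
    nlinarith
  suffices h : w x₀ ≤ (24 * r ^ 2 + 4 * lam ^ 2 * r ^ 4) * S ^ 2 by
    have h3 : r ^ 2 * (r ^ 2 * ∑ j, pdv j f c ^ 2) ≤
        r ^ 2 * ((24 + 4 * lam ^ 2 * r ^ 2) * S ^ 2) := by linarith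
    exact le_of_mul_le_mul_left h3 (by positivity)
  have hle : ‖x₀ - c‖ ≤ r := by simpa [dist_eq_norm] using hx₀
  rcases hle.eq_or_lt with heq | hlt
  · have : 0 ≤ 2 * lam ^ 2 * r ^ 4 * S ^ 2 := by positivity
    have := hsq x₀ hx₀
    simp only [hw, heq, sub_self]
    nlinarith
  · set y : E3 := x₀ - c with hy
    set p : ℝ := r ^ 2 - ‖y‖ ^ 2 with hp
    have hy2 : ‖y‖ ^ 2 = ∑ i, y i ^ 2 := by
      rw [EuclideanSpace.norm_sq_eq]; simp
    have hp0 : 0 ≤ p := by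
      have := norm_nonneg y; nlinarith
    have hpr : p ≤ r ^ 2 := by have := sq_nonneg ‖y‖; linarith
    have hnhds : Metric.closedBall c r ∈ nhds x₀ :=
      Metric.closedBall_mem_nhds_of_mem (by simpa [dist_eq_norm] using hlt)
    have hloc : IsLocalMax w x₀ := hmax.isLocalMax hnhds
    have hline : ∀ i : Fin 3,
        (8 * y i ^ 2 - 4 * p) * (∑ j, pdv j f x₀ ^ 2) -
          16 * p * y i * (∑ j, pdv j f x₀ * pdv i (pdv j f) x₀) +
          2 * p ^ 2 * (∑ j, pdv i (pdv j f) x₀ ^ 2) +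
          2 * p ^ 2 * (∑ j, pdv j f x₀ * pdv i (pdv i (pdv j f)) x₀) +
          2 * α * pdv i f x₀ ^ 2 + 2 * α * (f x₀ * pdv i (pdv i f) x₀) ≤ 0 := by
      intro i
      set L : ℝ → E3 := fun t => x₀ + t • EuclideanSpace.single i (1 : ℝ) with hL
      have hL0 : L 0 = x₀ := by simp [hL]
      have hLc : Continuous L := by fun_prop
      have hmaxL : IsLocalMax (fun t => w (L t)) 0 := by
        have : IsLocalMax w (L 0) := by rw [hL0]; exact hloc
        exact this.comp_continuous hLc.continuousAt
      have hps : ∀ t : ℝ, r ^ 2 - ‖L t - c‖ ^ 2 = p - 2 * y i * t - t ^ 2 := by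
        intro t
        have : L t - c = y + t • EuclideanSpace.single i (1 : ℝ) := by simp only [hL, hy]; abel
        rw [this, norm_add_sq_real, inner_smul_right, norm_smul]
        simp [EuclideanSpace.inner_single_right]
        ring
      have h := bernstein_line (α := α) (p := p) (q := y i) (g := fun t => f (L t))
        (g' := fun t => pdv i f (L t)) (g'' := pdv i (pdv i f) (L 0))
        (G := fun j t => pdv j f (L t)) (G' := fun j t => pdv i (pdv j f) (L t))
        (G'' := fun j => pdv i (pdv i (pdv j f)) (L 0))
        (fun s => hasDerivAt_line hf.1 x₀ i s) (hasDerivAt_line (contDiff_pdv hf.1 i) x₀ i 0)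
        (fun j s => hasDerivAt_line (contDiff_pdv hf.1 j) x₀ i s)
        (fun j => hasDerivAt_line (contDiff_pdv (contDiff_pdv hf.1 j) i) x₀ i 0)
        (by simpa only [hw, hps] using hmaxL)
      simpa only [hL0] using h
    have hH := hf.2 x₀
    have hHj : ∀ j, ∑ i, pdv i (pdv i (pdv j f)) x₀ = -lam ^ 2 * pdv j f x₀ := fun j => by
      simpa using (hf.pdv_mem j).2 x₀
    have hsum := Finset.sum_nonpos fun i (_ : i ∈ Finset.univ) => hline i
    have hsq2 : ∀ i j, 0 ≤ 2 * (p * pdv i (pdv j f) x₀ - 4 * y i * pdv j f x₀) ^ 2 := by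
      intro i j; positivity
    have hsq3 := Finset.sum_nonneg fun i (_ : i ∈ Finset.univ) =>
      Finset.sum_nonneg fun j (_ : j ∈ Finset.univ) => hsq2 i j
    have h0 := hHj 0
    have h1 := hHj 1
    have h2 := hHj 2
    have hgrad : ∑ j, pdv j f x₀ ^ 2 ≤ 2 * lam ^ 2 * f x₀ ^ 2 := by
      have hT : 0 ≤ ∑ j, pdv j f x₀ ^ 2 := Finset.sum_nonneg fun _ _ => sq_nonneg _
      have hcoef : α ≤ 2 * α - 24 * ‖y‖ ^ 2 - 12 * p - 2 * lam ^ 2 * p ^ 2 := by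
        have : lam ^ 2 * p ^ 2 ≤ lam ^ 2 * (r ^ 2) ^ 2 := by gcongr
        nlinarith
      have hmain : (2 * α - 24 * ‖y‖ ^ 2 - 12 * p - 2 * lam ^ 2 * p ^ 2) *
          (∑ j, pdv j f x₀ ^ 2) ≤ 2 * α * lam ^ 2 * f x₀ ^ 2 := by
        rw [hy2]
        simp only [Fin.sum_univ_three, smul_eq_mul] at *
        generalize pdv 0 (pdv 0 (pdv 0 f)) x₀ = a000 at *
        generalize pdv 1 (pdv 1 (pdv 0 f)) x₀ = a110 at *
        generalize pdv 2 (pdv 2 (pdv 0 f)) x₀ = a220 at *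
        generalize pdv 0 (pdv 0 (pdv 1 f)) x₀ = a001 at *
        generalize pdv 1 (pdv 1 (pdv 1 f)) x₀ = a111 at *
        generalize pdv 2 (pdv 2 (pdv 1 f)) x₀ = a221 at *
        generalize pdv 0 (pdv 0 (pdv 2 f)) x₀ = a002 at *
        generalize pdv 1 (pdv 1 (pdv 2 f)) x₀ = a112 at *
        generalize pdv 2 (pdv 2 (pdv 2 f)) x₀ = a222 at *
        have e0 : a220 = -lam ^ 2 * pdv 0 f x₀ - a000 - a110 := by linarith
        have e1 : a221 = -lam ^ 2 * pdv 1 f x₀ - a001 - a111 := by linarith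
        have e2 : a222 = -lam ^ 2 * pdv 2 f x₀ - a002 - a112 := by linarith
        have e3 : pdv 2 (pdv 2 f) x₀ =
          -lam ^ 2 * f x₀ - pdv 0 (pdv 0 f) x₀ - pdv 1 (pdv 1 f) x₀ := by linarith
        subst e0 e1 e2
        rw [← sub_nonneg] at hsum ⊢
        have e4 := e3
        refine le_trans (add_nonneg hsum hsq3) (le_of_eq ?_)
        linear_combination (-2 * α * f x₀) * e3
      have h5 : α * (∑ j, pdv j f x₀ ^ 2) ≤ α * (2 * lam ^ 2 * f x₀ ^ 2) := by nlinarith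
      exact le_of_mul_le_mul_left h5 hαpos
    have h6 := hsq x₀ hx₀
    have hp4 : p ^ 2 ≤ r ^ 4 := by nlinarith
    calc w x₀ = p ^ 2 * (∑ j, pdv j f x₀ ^ 2) + α * f x₀ ^ 2 := rfl
      _ ≤ r ^ 4 * (2 * lam ^ 2 * f x₀ ^ 2) + α * f x₀ ^ 2 := by
        gcongr
      _ = (24 * r ^ 2 + 4 * lam ^ 2 * r ^ 4) * f x₀ ^ 2 := by rw [hα]; ring
      _ ≤ _ := by gcongr

theorem IsHelmholtz.abs_pdv_le {lam : ℝ} {f : E3 → ℝ} (hf : IsHelmholtz lam f) {c : E3} {r S : ℝ}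
    (hr : 0 < r) (hS : ∀ x ∈ Metric.closedBall c r, |f x| ≤ S) (i : Fin 3) :
    |pdv i f c| ≤ (5 / r + 2 * |lam|) * S := by
  have hS0 : 0 ≤ S := (abs_nonneg _).trans (hS c (Metric.mem_closedBall_self hr.le))
  have h := hf.grad_sq_le hr hS
  have h1 : pdv i f c ^ 2 ≤ ∑ j, pdv j f c ^ 2 :=
    Finset.single_le_sum (f := fun j => pdv j f c ^ 2) (fun _ _ => sq_nonneg _) (Finset.mem_univ i)
  have h2 : (r * |pdv i f c|) ^ 2 ≤ ((5 + 2 * |lam| * r) * S) ^ 2 := by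
    rw [mul_pow, mul_pow, sq_abs]
    have h3 : r ^ 2 * pdv i f c ^ 2 ≤ r ^ 2 * ∑ j, pdv j f c ^ 2 := by gcongr
    have h4 : 24 + 4 * lam ^ 2 * r ^ 2 ≤ (5 + 2 * |lam| * r) ^ 2 := by
      rw [← sq_abs lam]
      have : 0 ≤ |lam| * r := by positivity
      nlinarith
    exact (h3.trans h).trans (by gcongr)
  have h5 := abs_le_of_sq_le_sq' h2 (by positivity)
  have h6 : (5 / r + 2 * |lam|) * S = ((5 + 2 * |lam| * r) * S) / r := by field_simp
  rw [h6, le_div_iff₀ hr]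
  linarith [h5.2]

theorem IsHelmholtz.norm_pdv_le {lam : ℝ} {f : E3 → ℂ} (hf : IsHelmholtz lam f) {c : E3} {r S : ℝ}
    (hr : 0 < r) (hS : ∀ x ∈ Metric.closedBall c r, ‖f x‖ ≤ S) (i : Fin 3) :
    ‖pdv i f c‖ ≤ (5 / r + 2 * |lam|) * S := by
  rcases eq_or_ne (pdv i f c) 0 with h0 | h0
  · have hS0 : 0 ≤ S := (norm_nonneg _).trans (hS c (Metric.mem_closedBall_self hr.le))
    rw [h0, norm_zero]; positivity
  set θ : ℂ := (starRingEnd ℂ) (pdv i f c) / ‖pdv i f c‖ with hθ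
  have hn : (‖pdv i f c‖ : ℂ) ≠ 0 := by simpa using h0
  have hθ1 : ‖θ‖ = 1 := by
    rw [hθ, norm_div]; simp [h0]
  let L : ℂ →L[ℝ] ℝ := Complex.reCLM.comp ((ContinuousLinearMap.mul ℝ ℂ) θ)
  have hL : ∀ z, L z = (θ * z).re := fun z => rfl
  have key := (hf.clm L).abs_pdv_le (c := c) hr (S := S) (fun x hx => by
    rw [hL]
    refine (Complex.abs_re_le_norm _).trans ?_
    rw [norm_mul, hθ1, one_mul]
    exact hS x hx) i
  rw [pdv_clm hf.1] at key
  have h1 : L (pdv i f c) = ‖pdv i f c‖ := by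
    rw [hL, hθ, div_mul_eq_mul_div, mul_comm, Complex.mul_conj, Complex.normSq_eq_norm_sq]
    have : ((‖pdv i f c‖ ^ 2 : ℝ) : ℂ) / ‖pdv i f c‖ = (‖pdv i f c‖ : ℝ) := by
      push_cast; field_simp
    rw [this, Complex.ofReal_re]
  simp only [h1, abs_of_nonneg (norm_nonneg _)] at key
  exact key

/-- Iterated partial derivatives along a list of coordinate directions. -/
def pdl {G : Type*} [NormedAddCommGroup G] [NormedSpace ℝ G] : List (Fin 3) → (E3 → G) → (E3 → G)
  | [], f => f
  | i :: l, f => pdv i (pdl l f)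

/-- The derivative along the constant vector `x`. -/
def dirD {G : Type*} [NormedAddCommGroup G] [NormedSpace ℝ G] (x : E3) (f : E3 → G) : E3 → G :=
  fun y => fderiv ℝ f y x

section pdl

variable {G : Type*} [NormedAddCommGroup G] [NormedSpace ℝ G] {f g : E3 → G} {lam : ℝ}

theorem contDiff_pdl (hf : ContDiff ℝ ∞ f) (l : List (Fin 3)) : ContDiff ℝ ∞ (pdl l f) := by
  induction l with
  | nil => exact hf
  | cons i l ih => exact contDiff_pdv ih i

theorem IsHelmholtz.pdl_mem (hf : IsHelmholtz lam f) (l : List (Fin 3)) :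
    IsHelmholtz lam (pdl l f) := by
  induction l with
  | nil => exact hf
  | cons i l ih => exact ih.pdv_mem i

theorem pdl_append (l l' : List (Fin 3)) (f : E3 → G) : pdl (l ++ l') f = pdl l (pdl l' f) := by
  induction l with
  | nil => rfl
  | cons i l ih => simp only [List.cons_append, pdl, ih]

theorem pdl_perm (hf : ContDiff ℝ ∞ f) {l l' : List (Fin 3)} (h : l.Perm l') :
    pdl l f = pdl l' f := by
  induction h with
  | nil => rfl
  | cons i _ ih => simp only [pdl, ih]
  | swap i j l => exact pdv_comm (contDiff_pdl hf l) j i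
  | trans _ _ ih1 ih2 => exact ih1.trans ih2

theorem pdl_sub (hf : ContDiff ℝ ∞ f) (hg : ContDiff ℝ ∞ g) (l : List (Fin 3)) :
    pdl l (fun x => f x - g x) = fun x => pdl l f x - pdl l g x := by
  induction l with
  | nil => rfl
  | cons i l ih => simp only [pdl, ih, pdv_sub (contDiff_pdl hf l) (contDiff_pdl hg l)]

theorem pdl_const_smul (hf : ContDiff ℝ ∞ f) (c : ℝ) (l : List (Fin 3)) :
    pdl l (fun x => c • f x) = fun x => c • pdl l f x := by
  induction l with
  | nil => rfl
  | cons i l ih => simp only [pdl, ih, pdv_const_smul (contDiff_pdl hf l)]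

theorem pdl_sum {ι : Type*} (s : Finset ι) {F : ι → E3 → G} (hF : ∀ j ∈ s, ContDiff ℝ ∞ (F j))
    (l : List (Fin 3)) : pdl l (fun x => ∑ j ∈ s, F j x) = fun x => ∑ j ∈ s, pdl l (F j) x := by
  induction l with
  | nil => rfl
  | cons i l ih => simp only [pdl, ih, pdv_sum s fun j hj => contDiff_pdl (hF j hj) l]

theorem contDiff_dirD (hf : ContDiff ℝ ∞ f) (x : E3) : ContDiff ℝ ∞ (dirD x f) :=
  (hf.fderiv_right (by simp)).clm_apply contDiff_const

theorem contDiff_dirD_iterate (hf : ContDiff ℝ ∞ f) (x : E3) (k : ℕ) :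
    ContDiff ℝ ∞ ((dirD x)^[k] f) := by
  induction k with
  | zero => exact hf
  | succ k ih => rw [Function.iterate_succ_apply']; exact contDiff_dirD ih x

theorem dirD_eq_sum (x : E3) (f : E3 → G) : dirD x f = fun y => ∑ i, x i • pdv i f y := by
  ext y
  have hx : x = ∑ i, x i • EuclideanSpace.single i (1 : ℝ) := by
    ext j
    fin_cases j <;> simp [Fin.sum_univ_three]
  conv_lhs => rw [dirD, hx, map_sum]
  simp only [map_smul, pdv]

theorem norm_dirD_iterate_le (hf : ContDiff ℝ ∞ f) {x y : E3} {r M : ℝ} (hx : ‖x‖ ≤ r) {k : ℕ}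
    (l : List (Fin 3)) (hM : ∀ l' : List (Fin 3), l'.length = k + l.length → ‖pdl l' f y‖ ≤ M) :
    ‖pdl l ((dirD x)^[k] f) y‖ ≤ (3 * r) ^ k * M := by
  induction k generalizing f M with
  | zero => simpa using hM l (by simp)
  | succ k ih =>
    rw [Function.iterate_succ_apply]
    refine (ih (M := 3 * r * M) (contDiff_dirD hf x) fun l' hl' => ?_).trans_eq (by ring)
    have h1 : pdl l' (dirD x f) = fun y => ∑ i, x i • pdl (l' ++ [i]) f y := by
      rw [dirD_eq_sum, pdl_sum (F := fun i y => x i • pdv i f y) _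
        fun i _ => contDiff_const.smul (contDiff_pdv hf i)]
      simp only [pdl_const_smul (contDiff_pdv hf _), pdl_append]
      rfl
    rw [h1]
    refine (norm_sum_le _ _).trans ((Finset.sum_le_card_nsmul _ _ (r * M) fun i _ => ?_).trans_eq
      (by simp; ring))
    rw [norm_smul]
    refine mul_le_mul ((PiLp.norm_apply_le x i).trans hx) (hM _ ?_) (norm_nonneg _)
      ((norm_nonneg x).trans hx)
    simp [hl']; omega

theorem norm_pdl_le_of_count {f : E3 → G} (hf : IsHelmholtz lam f) {M : ℝ} {y : E3} {k : ℕ}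
    (hM : ∀ l : List (Fin 3), l.length ≤ k → l.count 2 ≤ 1 → ‖pdl l f y‖ ≤ M)
    {l : List (Fin 3)} (hl : l.length ≤ k) : ‖pdl l f y‖ ≤ (2 + lam ^ 2) ^ k * M := by
  have hM0 : 0 ≤ M := (norm_nonneg _).trans (hM [] (by simp) (by simp))
  have hB : 1 ≤ 2 + lam ^ 2 := by nlinarith [sq_nonneg lam]
  suffices h : ∀ c, ∀ l : List (Fin 3), l.count 2 = c → l.length ≤ k →
      ‖pdl l f y‖ ≤ (2 + lam ^ 2) ^ c * M by
    refine (h _ l rfl hl).trans ?_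
    gcongr
    exact (List.count_le_length).trans hl
  intro c
  induction c using Nat.strong_induction_on with
  | _ c ih =>
  intro l hc hl
  rcases Nat.lt_or_ge c 2 with h2 | h2
  · refine (hM l hl (by omega)).trans ?_
    exact le_mul_of_one_le_left hM0 (one_le_pow₀ hB)
  · obtain ⟨l', hl'⟩ : ∃ l', l.Perm (2 :: 2 :: l') := by
      have h3 : (2 : Fin 3) ∈ l := List.count_pos_iff.1 (by omega)
      have h4 := List.perm_cons_erase h3
      have h5 : (2 : Fin 3) ∈ l.erase 2 :=
        List.count_pos_iff.1 (by rw [List.count_erase_self]; omega)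
      exact ⟨_, h4.trans ((List.perm_cons_erase h5).cons 2)⟩
    have hlen := hl'.length_eq
    have hcnt := hl'.count_eq 2
    simp only [List.length_cons, List.count_cons_self] at hlen hcnt
    have hH := (hf.pdl_mem l').2 y
    rw [Fin.sum_univ_three] at hH
    have e : pdl l f y = -(lam ^ 2) • pdl l' f y - pdl (0 :: 0 :: l') f y
        - pdl (1 :: 1 :: l') f y := by
      rw [pdl_perm hf.1 hl', ← hH]
      simp only [pdl]
      abel
    have b0 := ih (c - 2) (by omega) l' (by omega) (by omega)
    have b1 := ih (c - 2) (by omega) (0 :: 0 :: l')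
      (by rw [List.count_cons_of_ne (by decide), List.count_cons_of_ne (by decide)]; omega)
      (by simp; omega)
    have b2 := ih (c - 2) (by omega) (1 :: 1 :: l')
      (by rw [List.count_cons_of_ne (by decide), List.count_cons_of_ne (by decide)]; omega)
      (by simp; omega)
    obtain ⟨d, rfl⟩ : ∃ d, c = d + 2 := ⟨c - 2, by omega⟩
    simp only [Nat.add_sub_cancel] at b0 b1 b2
    rw [e]
    refine (norm_sub_le _ _).trans ((add_le_add_left (norm_sub_le _ _) _).trans ?_)
    rw [norm_smul, norm_neg, Real.norm_of_nonneg (sq_nonneg lam)]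
    have hX : 0 ≤ (2 + lam ^ 2) ^ d * M := by positivity
    have h6 := mul_le_mul_of_nonneg_left b0 (sq_nonneg lam)
    calc _ ≤ (2 + lam ^ 2) * ((2 + lam ^ 2) ^ d * M) := by linarith
      _ ≤ (2 + lam ^ 2) * ((2 + lam ^ 2) * ((2 + lam ^ 2) ^ d * M)) := by
        exact mul_le_mul_of_nonneg_left (le_mul_of_one_le_left hX hB) (by positivity)
      _ = _ := by ring

end pdl

theorem IsHelmholtz.norm_pdl_le_step {lam : ℝ} {f : E3 → ℂ} (hf : IsHelmholtz lam f) {r S : ℝ}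
    (hr : 0 < r) (l : List (Fin 3)) {c : E3}
    (hS : ∀ x ∈ Metric.closedBall c (l.length * r), ‖f x‖ ≤ S) :
    ‖pdl l f c‖ ≤ (5 / r + 2 * |lam|) ^ l.length * S := by
  induction l generalizing c with
  | nil => simpa [pdl] using hS c (by simp)
  | cons i l ih =>
    have := (hf.pdl_mem l).norm_pdv_le (c := c) hr (fun x hx => ih (c := x) fun z hz => hS z ?_) i
    · refine this.trans_eq ?_
      rw [List.length_cons]; ring
    · rw [Metric.mem_closedBall] at *
      rw [List.length_cons]; push_cast
      linarith [dist_triangle z x c]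

theorem IsHelmholtz.norm_pdl_le {lam : ℝ} {f : E3 → ℂ} (hf : IsHelmholtz lam f) {r S : ℝ}
    (hr : 0 < r) (l : List (Fin 3)) {c : E3}
    (hS : ∀ x ∈ Metric.closedBall c r, ‖f x‖ ≤ S) :
    ‖pdl l f c‖ ≤ (5 * l.length / r + 2 * |lam|) ^ l.length * S := by
  rcases Nat.eq_zero_or_pos l.length with h0 | h0
  · rw [List.length_eq_zero_iff.1 h0]
    simpa [pdl] using hS c (by simp [hr.le])
  · have hl : (0 : ℝ) < l.length := by exact_mod_cast h0
    have := hf.norm_pdl_le_step (r := r / l.length) (by positivity) l (c := c) (S := S)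
      (by rw [mul_div_cancel₀ _ hl.ne']; exact hS)
    rwa [div_div_eq_mul_div] at this

theorem exists_pow_le_factorial (K A : ℝ) (hK : 0 < K) (hA : 0 ≤ A) : ∃ ρ : ℝ, 0 < ρ ∧ ∃ N : ℕ,
    ∀ n : ℕ, N ≤ n → (5 * n / ρ + A) ^ n ≤ (1 / 2) ^ n * (n ! / K ^ n) := by
  refine ⟨60 * K, by positivity, ⌈12 * K * A⌉₊, fun n hn => ?_⟩
  have h1 : 12 * K * A ≤ n := (Nat.le_ceil _).trans (by exact_mod_cast hn)
  have h2 : 6 * K * (5 * n / (60 * K) + A) ≤ n := by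
    have : 6 * K * (5 * n / (60 * K) + A) = n / 2 + 6 * K * A := by field_simp; ring
    linarith
  have h3 : (n : ℝ) ^ n ≤ 3 ^ n * n ! := by
    have h4 := Real.pow_div_factorial_le_exp (n : ℝ) (by positivity) n
    rw [div_le_iff₀ (by positivity)] at h4
    refine h4.trans ?_
    gcongr
    rw [← Real.exp_one_pow]
    gcongr
    exact Real.exp_one_lt_three.le
  have h5 : (6 * K * (5 * n / (60 * K) + A)) ^ n ≤ 3 ^ n * n ! :=
    (pow_le_pow_left₀ (by positivity) h2 n).trans h3
  have h6 : (6 * K * (5 * n / (60 * K) + A)) ^ n = 3 ^ n * (2 ^ n * K ^ n *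
    (5 * n / (60 * K) + A) ^ n) := by
    rw [mul_pow, mul_pow, show (6 : ℝ) = 3 * 2 by norm_num, mul_pow]; ring
  rw [h6] at h5
  have h7 := le_of_mul_le_mul_left h5 (by positivity)
  rw [one_div, inv_pow, ← mul_div_assoc, le_div_iff₀ (by positivity), ← div_eq_inv_mul,
    le_div_iff₀ (by positivity)]
  linarith

theorem IsHelmholtz.exists_norm_pdl_tail_le {lam : ℝ} {f : E3 → ℂ} (hf : IsHelmholtz lam f)
    {K δ : ℝ} (hK : 0 < K) (hδ : 0 < δ) : ∃ N : ℕ, ∀ l : List (Fin 3), N ≤ l.length →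
      ‖pdl l f 0‖ ≤ δ * (l.length ! / K ^ l.length) := by
  obtain ⟨ρ, hρ, N, hN⟩ := exists_pow_le_factorial K (2 * |lam|) hK (by positivity)
  obtain ⟨S, hS⟩ := (isCompact_closedBall (0 : E3) ρ).exists_bound_of_continuousOn
    hf.1.continuous.continuousOn
  have hS0 : 0 ≤ S := (norm_nonneg _).trans (hS 0 (by simp [hρ.le]))
  obtain ⟨N', hN'⟩ := ((tendsto_pow_atTop_nhds_zero_of_lt_one (r := (1 / 2 : ℝ)) (by norm_num)
    (by norm_num)).mul_const S).eventually_le_const (u := δ) (by simpa using hδ) |>.exists_forall_of_atTop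
  refine ⟨max N N', fun l hl => ?_⟩
  refine (hf.norm_pdl_le hρ l hS).trans ?_
  calc _ ≤ ((1 / 2) ^ l.length * (l.length ! / K ^ l.length)) * S := by
        gcongr; exact hN _ ((le_max_left _ _).trans hl)
    _ = ((1 / 2) ^ l.length * S) * (l.length ! / K ^ l.length) := by ring
    _ ≤ _ := by gcongr; exact hN' _ ((le_max_right _ _).trans hl)

theorem factorial_div_pow_le {K : ℝ} (hK : 0 < K) {n k : ℕ} (hnk : n ≤ k) :
    (n ! : ℝ) / K ^ n ≤ 1 + k ! / K ^ k := by
  induction k, hnk using Nat.le_induction with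
  | base => linarith
  | succ k hnk ih =>
    rcases le_total (k + 1 : ℝ) K with h | h
    · have h1 : (n ! : ℝ) ≤ K ^ n := by
        have h2 : (n ! : ℝ) ≤ (n : ℝ) ^ n := by exact_mod_cast Nat.factorial_le_pow n
        refine h2.trans (pow_le_pow_left₀ (by positivity) ?_ n)
        have : (n : ℝ) ≤ k := by exact_mod_cast hnk
        linarith
      have h3 : (n ! : ℝ) / K ^ n ≤ 1 := div_le_one_of_le₀ h1 (by positivity)
      have : 0 ≤ ((k + 1) ! : ℝ) / K ^ (k + 1) := by positivity
      linarith
    · refine ih.trans (add_le_add_right ?_ 1)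
      rw [Nat.factorial_succ, pow_succ, div_le_div_iff₀ (by positivity) (by positivity)]
      push_cast
      have : (0 : ℝ) < k ! * K ^ k := by positivity
      nlinarith

theorem iteratedDerivWithin_ray {G : Type*} [NormedAddCommGroup G] [NormedSpace ℝ G] {f : E3 → G}
    (hf : ContDiff ℝ ∞ f) (x : E3) (k : ℕ) : ∀ t ∈ Set.Icc (0 : ℝ) 1,
    iteratedDerivWithin k (fun t : ℝ => f (t • x)) (Set.Icc 0 1) t = (dirD x)^[k] f (t • x) := by
  induction k with
  | zero => intro t _; simp
  | succ k ih =>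
    intro t ht
    rw [iteratedDerivWithin_succ, derivWithin_congr ih (ih t ht), Function.iterate_succ_apply']
    have h1 : HasDerivAt (fun t : ℝ => t • x) x t := by
      simpa using (hasDerivAt_id t).smul_const x
    have h2 : HasDerivAt (fun t : ℝ => (dirD x)^[k] f (t • x)) _ t :=
      (smooth_differentiable (contDiff_dirD_iterate hf x k) _).hasFDerivAt.comp_hasDerivAt t h1
    exact h2.hasDerivWithinAt.derivWithin (uniqueDiffOn_Icc one_pos t ht)

theorem taylor_ray {G : Type*} [NormedAddCommGroup G] [NormedSpace ℝ G] {f : E3 → G}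
    (hf : ContDiff ℝ ∞ f) (x : E3) (n : ℕ) {C : ℝ}
    (hC : ∀ t ∈ Set.Icc (0 : ℝ) 1, ‖(dirD x)^[n + 1] f (t • x)‖ ≤ C) :
    ‖f x‖ ≤ ∑ k ∈ Finset.range (n + 1), ‖(dirD x)^[k] f 0‖ / k ! + C / n ! := by
  have hg : ContDiff ℝ ∞ (fun t : ℝ => f (t • x)) := hf.comp (contDiff_id.smul contDiff_const)
  have h := taylor_mean_remainder_bound (f := fun t : ℝ => f (t • x)) (n := n) (C := C) (x := 1)
    zero_le_one (hg.of_le (by exact_mod_cast le_top)).contDiffOn (Set.right_mem_Icc.2 zero_le_one)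
    (fun t ht => by rw [iteratedDerivWithin_ray hf x _ t ht]; exact hC t ht)
  rw [taylor_within_apply] at h
  simp only [one_smul, sub_zero, one_pow, mul_one] at h
  have h2 : ‖∑ k ∈ Finset.range (n + 1), ((k ! : ℝ)⁻¹) •
      iteratedDerivWithin k (fun t : ℝ => f (t • x)) (Set.Icc 0 1) 0‖ ≤
      ∑ k ∈ Finset.range (n + 1), ‖(dirD x)^[k] f 0‖ / k ! := by
    refine (norm_sum_le _ _).trans (Finset.sum_le_sum fun k _ => ?_)
    rw [iteratedDerivWithin_ray hf x k 0 (Set.left_mem_Icc.2 zero_le_one), norm_smul, zero_smul,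
      norm_inv, Real.norm_natCast, div_eq_inv_mul]
  have h3 := norm_sub_norm_le (f x) (∑ k ∈ Finset.range (n + 1), ((k ! : ℝ)⁻¹) •
      iteratedDerivWithin k (fun t : ℝ => f (t • x)) (Set.Icc 0 1) 0)
  linarith

theorem IsHelmholtz.exists_norm_dirD_le {lam : ℝ} {f : E3 → ℂ} (hf : IsHelmholtz lam f)
    {R η : ℝ} (hR : 0 < R) (hη : 0 < η) : ∃ n : ℕ, ∀ x : E3, ‖x‖ ≤ R → ∀ y : E3, ‖y‖ ≤ R →
      ‖(dirD x)^[n + 1] f y‖ / n ! ≤ η := by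
  obtain ⟨ρ, hρ, N, hN⟩ := exists_pow_le_factorial (3 * (3 * R)) (2 * |lam|) (by positivity)
    (by positivity)
  obtain ⟨S, hS⟩ := (isCompact_closedBall (0 : E3) (R + ρ)).exists_bound_of_continuousOn
    hf.1.continuous.continuousOn
  have hS0 : 0 ≤ S := (norm_nonneg _).trans (hS 0 (by
    rw [Metric.mem_closedBall, dist_self]; positivity))
  have hlim : Filter.Tendsto (fun n : ℕ => (n + 1 : ℕ) * (1 / 2 : ℝ) ^ (n + 1) * S)
      Filter.atTop (nhds 0) := by
    have := (tendsto_self_mul_const_pow_of_lt_one (r := (1 / 2 : ℝ)) (by norm_num)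
      (by norm_num)).comp (Filter.tendsto_add_atTop_nat 1)
    simpa [Function.comp_def] using this.mul_const S
  obtain ⟨n, hn, hnN⟩ := ((hlim.eventually_le_const hη).and
    (Filter.eventually_ge_atTop N)).exists
  refine ⟨n, fun x hx y hy => ?_⟩
  have hb : ∀ l' : List (Fin 3), l'.length = n + 1 + ([] : List (Fin 3)).length →
      ‖pdl l' f y‖ ≤ (1 / 2) ^ (n + 1) * ((n + 1) ! / (3 * (3 * R)) ^ (n + 1)) * S := by
    intro l' hl'
    simp only [List.length_nil, add_zero] at hl'
    refine (hf.norm_pdl_le hρ l' fun z hz => hS z ?_).trans ?_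
    · rw [Metric.mem_closedBall, dist_eq_norm] at *
      have : ‖z‖ ≤ ‖z - y‖ + ‖y‖ := by simpa using norm_add_le (z - y) y
      rw [sub_zero]; linarith
    · rw [hl']
      gcongr
      exact hN _ (by omega)
  have h := norm_dirD_iterate_le hf.1 hx [] hb
  rw [div_le_iff₀ (by positivity)]
  refine h.trans ?_
  have e : (3 * R) ^ (n + 1) * ((1 / 2) ^ (n + 1) * ((n + 1) ! / (3 * (3 * R)) ^ (n + 1)) * S) =
      (((n + 1 : ℕ) * (1 / 2 : ℝ) ^ (n + 1) * S) * n !) / 3 ^ (n + 1) := by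
    rw [Nat.factorial_succ, mul_pow 3 (3 * R)]
    push_cast
    field_simp
  rw [e]
  refine (div_le_self (by positivity) (one_le_pow₀ (by norm_num))).trans ?_
  gcongr

theorem IsHelmholtz.norm_le_of_data {lam : ℝ} {f : E3 → ℂ} (hf : IsHelmholtz lam f) {R δ : ℝ}
    (hR : 0 < R) (hδ : 0 ≤ δ) (h : ∀ l : List (Fin 3), l.count 2 ≤ 1 →
      ‖pdl l f 0‖ ≤ δ * (l.length ! / (2 * (3 * R * (2 + lam ^ 2))) ^ l.length))
    {x : E3} (hx : ‖x‖ ≤ R) : ‖f x‖ ≤ δ * (Real.exp (3 * R * (2 + lam ^ 2)) + 2) := by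
  refine le_of_forall_pos_le_add fun η hη => ?_
  obtain ⟨n, hn⟩ := hf.exists_norm_dirD_le hR hη
  set A : ℝ := 3 * R * (2 + lam ^ 2) with hA
  have hApos : 0 < A := by positivity
  have hC := taylor_ray hf.1 x n (C := η * n !) fun t ht => by
    have := hn x hx (t • x) (by
      rw [norm_smul, Real.norm_of_nonneg ht.1]
      exact (mul_le_of_le_one_left (norm_nonneg x) ht.2).trans hx)
    rwa [div_le_iff₀ (by positivity)] at this
  rw [mul_div_cancel_right₀ _ (by positivity)] at hC
  refine hC.trans (add_le_add_left ?_ η)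
  have hterm : ∀ k ∈ Finset.range (n + 1), ‖(dirD x)^[k] f 0‖ / k ! ≤
      δ * (A ^ k / k ! + (1 / 2) ^ k) := by
    intro k _
    have h1 : ∀ l : List (Fin 3), l.length ≤ k → l.count 2 ≤ 1 →
        ‖pdl l f 0‖ ≤ δ * (1 + k ! / (2 * A) ^ k) := fun l hl hc =>
      (h l hc).trans (by gcongr; exact factorial_div_pow_le (by positivity) hl)
    have h2 := norm_dirD_iterate_le hf.1 hx [] (k := k) (y := 0) fun l' hl' =>
      norm_pdl_le_of_count hf h1 (l := l') (by simpa using hl'.le)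
    rw [div_le_iff₀ (by positivity)]
    refine (h2.trans_eq ?_ : ‖(dirD x)^[k] f 0‖ ≤ _)
    rw [← mul_assoc, ← mul_pow, ← hA, mul_pow 2 A, one_div, inv_pow]
    field_simp
  refine (Finset.sum_le_sum hterm).trans ?_
  rw [← Finset.mul_sum, Finset.sum_add_distrib]
  gcongr
  · exact Real.sum_le_exp_of_nonneg hApos.le _
  · have := geom_sum_eq (x := (1 / 2 : ℝ)) (by norm_num) (n + 1)
    rw [this]
    have : (0 : ℝ) < (1 / 2) ^ (n + 1) := by positivity
    rw [div_le_iff_of_neg (by norm_num)]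
    linarith

/-- The plane wave `x ↦ exp (i ξ · x)`. -/
def planeWave (ξ : E3) (x : E3) : ℂ := Complex.exp (Complex.I * (inner ℝ ξ x : ℝ))

/-- Finite linear combinations of plane waves with wave vectors in `S`. -/
def waveSpan (S : Set E3) : Submodule ℂ (E3 → ℂ) := Submodule.span ℂ (planeWave '' S)

theorem contDiff_planeWave (ξ : E3) : ContDiff ℝ ∞ (planeWave ξ) := by
  have h : ContDiff ℝ ∞ fun x : E3 => ((inner ℝ ξ x : ℝ) : ℂ) :=
    Complex.ofRealCLM.contDiff.comp (innerSL ℝ ξ).contDiff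
  exact (contDiff_const.mul h).cexp

theorem pdv_const_mul {f : E3 → ℂ} (hf : ContDiff ℝ ∞ f) (c : ℂ) (i : Fin 3) :
    pdv i (fun x => c * f x) = fun x => c * pdv i f x :=
  pdv_clm hf (ContinuousLinearMap.mul ℝ ℂ c) i

theorem pdl_const_mul {f : E3 → ℂ} (hf : ContDiff ℝ ∞ f) (c : ℂ) (l : List (Fin 3)) :
    pdl l (fun x => c * f x) = fun x => c * pdl l f x := by
  induction l with
  | nil => rfl
  | cons i l ih => simp only [pdl, ih, pdv_const_mul (contDiff_pdl hf l)]

theorem IsHelmholtz.const_mul {lam : ℝ} {f : E3 → ℂ} (hf : IsHelmholtz lam f) (c : ℂ) :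
    IsHelmholtz lam (fun x => c * f x) :=
  hf.clm (ContinuousLinearMap.mul ℝ ℂ c)

theorem pdv_planeWave (ξ : E3) (i : Fin 3) :
    pdv i (planeWave ξ) = fun x => (Complex.I * ξ i) * planeWave ξ x := by
  ext x
  have h := hasDerivAt_line (contDiff_planeWave ξ) x i 0
  have h1 : HasDerivAt (fun t : ℝ => planeWave ξ (x + t • EuclideanSpace.single i (1 : ℝ)))
      ((Complex.I * ξ i) * planeWave ξ x) 0 := by
    have e : (fun t : ℝ => planeWave ξ (x + t • EuclideanSpace.single i (1 : ℝ))) = fun t : ℝ =>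
        Complex.exp (Complex.I * ((inner ℝ ξ x : ℝ) + t * ξ i)) := by
      ext t
      simp only [planeWave, inner_add_right, inner_smul_right]
      simp [EuclideanSpace.inner_single_right]
    rw [e]
    have h2 : HasDerivAt (fun t : ℝ => (t : ℂ)) 1 0 := Complex.ofRealCLM.hasDerivAt
    have h3 := (((h2.mul_const (ξ i : ℂ)).const_add ((inner ℝ ξ x : ℝ) : ℂ)).const_mul
      Complex.I).cexp
    refine h3.congr_deriv ?_
    simp [planeWave]; ring
  have := h.unique h1
  simpa using this

theorem pdl_planeWave (ξ : E3) (l : List (Fin 3)) :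
    pdl l (planeWave ξ) = fun x => (l.map fun i => Complex.I * ξ i).prod * planeWave ξ x := by
  induction l with
  | nil => simp [pdl]
  | cons i l ih =>
    simp only [pdl, ih, pdv_const_mul (contDiff_planeWave ξ), pdv_planeWave]
    ext x
    rw [List.map_cons, List.prod_cons]; ring

theorem List.prod_map_fin_three (l : List (Fin 3)) (z : Fin 3 → ℂ) :
    (l.map z).prod = z 0 ^ l.count 0 * z 1 ^ l.count 1 * z 2 ^ l.count 2 := by
  induction l with
  | nil => simp
  | cons i l ih =>
    rw [List.map_cons, List.prod_cons, ih]
    fin_cases i <;> simp <;> ring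

theorem pdl_planeWave_zero (ξ : E3) (l : List (Fin 3)) : pdl l (planeWave ξ) 0 =
    (Complex.I * ξ 0) ^ l.count 0 * (Complex.I * ξ 1) ^ l.count 1 *
      (Complex.I * ξ 2) ^ l.count 2 := by
  rw [pdl_planeWave, List.prod_map_fin_three]
  simp [planeWave]

theorem isHelmholtz_planeWave {lam : ℝ} {ξ : E3} (hξ : ‖ξ‖ = |lam|) :
    IsHelmholtz lam (planeWave ξ) := by
  refine ⟨contDiff_planeWave ξ, fun x => ?_⟩
  have h2 : ξ 0 ^ 2 + ξ 1 ^ 2 + ξ 2 ^ 2 = lam ^ 2 := by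
    rw [← sq_abs lam, ← hξ, EuclideanSpace.norm_sq_eq, Fin.sum_univ_three]; simp
  have h3 : (ξ 0 : ℂ) ^ 2 + (ξ 1 : ℂ) ^ 2 + (ξ 2 : ℂ) ^ 2 = (lam : ℂ) ^ 2 := by exact_mod_cast h2
  simp only [pdv_planeWave, pdv_const_mul (contDiff_planeWave ξ), Fin.sum_univ_three,
    Complex.real_smul]
  push_cast
  linear_combination (-planeWave ξ x) * h3 + (planeWave ξ x) * (ξ 0 ^ 2 + ξ 1 ^ 2 + ξ 2 ^ 2) *
    Complex.I_sq

theorem isHelmholtz_zero {G : Type*} [NormedAddCommGroup G] [NormedSpace ℝ G] (lam : ℝ) :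
    IsHelmholtz lam (fun _ : E3 => (0 : G)) := by
  have h : ∀ i, pdv i (fun _ : E3 => (0 : G)) = fun _ => 0 := fun i => by ext x; simp [pdv]
  exact ⟨contDiff_const, fun x => by simp [h]⟩

theorem isHelmholtz_of_mem_waveSpan {lam : ℝ} {S : Set E3} (hS : ∀ ξ ∈ S, ‖ξ‖ = |lam|)
    {F : E3 → ℂ} (hF : F ∈ waveSpan S) : IsHelmholtz lam F := by
  induction hF using Submodule.span_induction with
  | mem F h =>
    obtain ⟨ξ, hξ, rfl⟩ := h
    exact isHelmholtz_planeWave (hS ξ hξ)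
  | zero => exact isHelmholtz_zero lam
  | add F G _ _ h1 h2 => exact h1.add h2
  | smul c F _ h => exact h.const_mul c

/-- Coefficients extracting the `a₀`-th Taylor coefficient from values at `0, …, N`. -/
theorem exists_vandermonde_coeff (N a₀ : ℕ) : ∃ c : ℕ → ℝ, ∀ a ≤ N,
    ∑ j ∈ Finset.range (N + 1), c j * (j : ℝ) ^ a = if a = a₀ then 1 else 0 := by
  refine ⟨fun j => (Lagrange.basis (Finset.range (N + 1)) (fun j : ℕ => (j : ℝ)) j).coeff a₀,
    fun a ha => ?_⟩
  have h := Lagrange.eq_interpolate (s := Finset.range (N + 1)) (v := fun j : ℕ => (j : ℝ))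
    (f := (Polynomial.X : Polynomial ℝ) ^ a) (Nat.cast_injective.injOn) (by
      rw [Polynomial.degree_X_pow, Finset.card_range]; exact_mod_cast Nat.lt_succ_of_le ha)
  have h2 := congrArg (fun p : Polynomial ℝ => p.coeff a₀) h
  simp only [Lagrange.interpolate_apply, Polynomial.finsetSum_coeff, Polynomial.coeff_C_mul,
    Polynomial.coeff_X_pow, Polynomial.eval_pow, Polynomial.eval_X] at h2
  simp only [eq_comm (a := a), h2]
  exact Finset.sum_congr rfl fun j _ => mul_comm _ _

theorem exists_moment_coeff (N a₀ : ℕ) (ha₀ : a₀ ≤ N) {lam : ℝ} (hlam : lam ≠ 0) :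
    ∃ C M : ℝ, 1 ≤ C ∧ 1 ≤ M ∧ ∀ h : ℝ, 0 < h → h ≤ 1 → ∃ c : ℕ → ℂ, ∀ a : ℕ,
      ‖∑ j ∈ Finset.range (N + 1), c j * (Complex.I * (lam * (h * j) : ℝ)) ^ a -
        (if a = a₀ then 1 else 0)‖ ≤ h * (C * M ^ a) := by
  obtain ⟨c, hc⟩ := exists_vandermonde_coeff N a₀
  refine ⟨1 + ∑ j ∈ Finset.range (N + 1), |c j|, (1 + |lam|) * (N + 1),
    by linarith [Finset.sum_nonneg fun j (_ : j ∈ Finset.range (N + 1)) => abs_nonneg (c j)],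
    ?_, fun h h0 h1 => ⟨fun j => c j * ((Complex.I * (lam * h : ℝ)) ^ a₀)⁻¹, fun a => ?_⟩⟩
  · have := abs_nonneg lam
    have : (0 : ℝ) ≤ N := by positivity
    nlinarith
  set w : ℂ := Complex.I * (lam * h : ℝ) with hw
  have hw0 : w ≠ 0 := by
    rw [hw]; simp [hlam, h0.ne']
  have hwn : ‖w‖ = |lam| * h := by
    rw [hw, norm_mul, Complex.norm_I, one_mul, Complex.norm_real, Real.norm_eq_abs, abs_mul,
      abs_of_pos h0]
  have e : ∑ j ∈ Finset.range (N + 1), c j * (w ^ a₀)⁻¹ * (Complex.I * (lam * (h * j) : ℝ)) ^ a =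
      w ^ a * (w ^ a₀)⁻¹ * ((∑ j ∈ Finset.range (N + 1), c j * (j : ℝ) ^ a : ℝ) : ℂ) := by
    push_cast
    rw [Finset.mul_sum]
    refine Finset.sum_congr rfl fun j _ => ?_
    have : (Complex.I * (lam * (h * j)) : ℂ) = w * j := by rw [hw]; push_cast; ring
    rw [this, mul_pow]; ring
  rw [e]
  rcases le_or_gt a N with ha | ha
  · rw [hc a ha]
    split_ifs with haa
    · subst haa
      rw [mul_inv_cancel₀ (pow_ne_zero _ hw0)]
      simp only [Complex.ofReal_one, mul_one, sub_self, norm_zero]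
      positivity
    · simp only [Complex.ofReal_zero, mul_zero, sub_self, norm_zero]
      positivity
  · rw [if_neg (by omega), sub_zero, ← pow_sub₀ w hw0 (by omega), norm_mul, norm_pow, hwn,
      Complex.norm_real, mul_pow]
    have h2 : h ^ (a - a₀) ≤ h := by
      simpa using pow_le_pow_of_le_one h0.le h1 (show 1 ≤ a - a₀ by omega)
    have h3 : |lam| ^ (a - a₀) ≤ (1 + |lam|) ^ a :=
      (pow_le_pow_left₀ (abs_nonneg _) (by linarith) _).trans
        (pow_le_pow_right₀ (by linarith [abs_nonneg lam]) (by omega))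
    have h4 : ‖∑ j ∈ Finset.range (N + 1), c j * (j : ℝ) ^ a‖ ≤
        (1 + ∑ j ∈ Finset.range (N + 1), |c j|) * (N + 1) ^ a := by
      refine (norm_sum_le _ _).trans ?_
      have : ∀ j ∈ Finset.range (N + 1), ‖c j * (j : ℝ) ^ a‖ ≤ |c j| * (N + 1) ^ a := by
        intro j hj
        rw [norm_mul, norm_pow, Real.norm_natCast, Real.norm_eq_abs]
        have : (j : ℝ) ≤ N + 1 := by exact_mod_cast (Finset.mem_range.1 hj).le
        gcongr
      refine (Finset.sum_le_sum this).trans ?_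
      rw [← Finset.sum_mul]
      gcongr
      linarith
    calc _ ≤ (1 + |lam|) ^ a * h * ((1 + ∑ j ∈ Finset.range (N + 1), |c j|) * (N + 1) ^ a) := by
          gcongr
      _ = _ := by rw [mul_pow]; ring

theorem pdl_add {G : Type*} [NormedAddCommGroup G] [NormedSpace ℝ G] {f g : E3 → G}
    (hf : ContDiff ℝ ∞ f) (hg : ContDiff ℝ ∞ g) (l : List (Fin 3)) :
    pdl l (fun x => f x + g x) = fun x => pdl l f x + pdl l g x := by
  induction l with
  | nil => rfl
  | cons i l ih => simp only [pdl, ih, pdv_add (contDiff_pdl hf l) (contDiff_pdl hg l)]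

theorem exists_parity_coeff {z : ℂ} (hz : z ≠ 0) {γ₀ : ℕ} (hγ₀ : γ₀ ≤ 1) : ∃ A B : ℂ,
    ∀ γ ≤ 1, A * z ^ γ + B * (-z) ^ γ = if γ = γ₀ then 1 else 0 := by
  interval_cases γ₀
  · refine ⟨1 / 2, 1 / 2, fun γ hγ => ?_⟩
    interval_cases γ <;> norm_num
  · refine ⟨1 / (2 * z), -(1 / (2 * z)), fun γ hγ => ?_⟩
    interval_cases γ
    · norm_num
    · simp only [pow_one, if_true]
      field_simp
      norm_num

theorem norm_mul_sub_ite_le {p q : Prop} [Decidable p] [Decidable q] {P Q : ℂ} {h X Y : ℝ}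
    (h0 : 0 ≤ h) (h1 : h ≤ 1) (hX : 1 ≤ X) (hY : 1 ≤ Y)
    (hP : ‖P - if p then 1 else 0‖ ≤ h * X) (hQ : ‖Q - if q then 1 else 0‖ ≤ h * Y) :
    ‖P * Q - (if p then 1 else 0) * (if q then 1 else 0)‖ ≤ 3 * h * (X * Y) := by
  set d : ℂ := if p then 1 else 0 with hd
  set e : ℂ := if q then 1 else 0 with he
  have hd1 : ‖d‖ ≤ 1 := by rw [hd]; split_ifs <;> simp
  have he1 : ‖e‖ ≤ 1 := by rw [he]; split_ifs <;> simp
  have e1 : P * Q - d * e = (P - d) * (Q - e) + d * (Q - e) + (P - d) * e := by ring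
  rw [e1]
  have hXh : 0 ≤ h * X := by positivity
  have hYh : 0 ≤ h * Y := by positivity
  have n1 : ‖(P - d) * (Q - e)‖ ≤ h * X * (h * Y) := by rw [norm_mul]; gcongr
  have n2 : ‖d * (Q - e)‖ ≤ 1 * (h * Y) := by rw [norm_mul]; gcongr
  have n3 : ‖(P - d) * e‖ ≤ h * X * 1 := by rw [norm_mul]; gcongr
  have n4 : h * X * (h * Y) ≤ h * (X * Y) := by
    have : h * (h * (X * Y)) ≤ 1 * (h * (X * Y)) := by gcongr
    linarith
  have n5 : h * Y ≤ h * (X * Y) := by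
    gcongr; exact le_mul_of_one_le_left (by linarith) hX
  have n6 : h * X ≤ h * (X * Y) := by
    gcongr; exact le_mul_of_one_le_right (by linarith) hY
  linarith [norm_add_le ((P - d) * (Q - e) + d * (Q - e)) ((P - d) * e),
    norm_add_le ((P - d) * (Q - e)) (d * (Q - e))]

theorem count_add_count_add_count (l : List (Fin 3)) :
    l.count 0 + l.count 1 + l.count 2 = l.length := by
  induction l with
  | nil => rfl
  | cons i l ih => fin_cases i <;> simp <;> omega

/-- Plane waves realise a prescribed Cauchy datum at the origin up to a small weighted error. -/
theorem exists_wave_unit_data {lam : ℝ} (hlam : lam ≠ 0) {N a₀ b₀ γ₀ : ℕ} (ha₀ : a₀ ≤ N)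
    (hb₀ : b₀ ≤ N) (hγ₀ : γ₀ ≤ 1) {K ε : ℝ} (hK : 0 < K) (hε : 0 < ε) :
    ∃ F ∈ waveSpan {ξ | ‖ξ‖ = |lam|}, ∀ l : List (Fin 3), l.count 2 ≤ 1 →
      ‖pdl l F 0 - (if l.count 0 = a₀ then 1 else 0) * (if l.count 1 = b₀ then 1 else 0) *
        (if l.count 2 = γ₀ then 1 else 0)‖ ≤ ε * (l.length ! / K ^ l.length) := by
  obtain ⟨C₁, M₁, hC₁, hM₁, H₁⟩ := exists_moment_coeff N a₀ ha₀ hlam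
  obtain ⟨C₂, M₂, hC₂, hM₂, H₂⟩ := exists_moment_coeff N b₀ hb₀ hlam
  set E : ℝ := 3 * (C₁ * C₂ * Real.exp (M₁ * M₂ * K)) with hE
  have hEpos : 0 < E := by positivity
  set h : ℝ := min (1 / (2 * (N + 1))) (ε / E) with hh
  have hh0 : 0 < h := by positivity
  have hhN : h * (N + 1) ≤ 1 / 2 := by
    have : h ≤ 1 / (2 * (N + 1)) := min_le_left _ _
    calc h * (N + 1) ≤ 1 / (2 * (N + 1)) * (N + 1) := by gcongr
      _ = 1 / 2 := by field_simp
  have hN0 : (0 : ℝ) ≤ N := by positivity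
  have hh1 : h ≤ 1 := by nlinarith
  have hhE : h * E ≤ ε := by
    have : h ≤ ε / E := min_le_right _ _
    rwa [le_div_iff₀ hEpos] at this
  obtain ⟨c, hc⟩ := H₁ h hh0 hh1
  obtain ⟨c', hc'⟩ := H₂ h hh0 hh1
  have hκ : ∀ j ∈ Finset.range (N + 1), ∀ j' ∈ Finset.range (N + 1),
      (1 / 2 : ℝ) ≤ 1 - (h * j) ^ 2 - (h * j') ^ 2 := by
    have hs : ∀ j ∈ Finset.range (N + 1), (h * j) ^ 2 ≤ 1 / 4 := by
      intro j hj
      have : (j : ℝ) ≤ N + 1 := by exact_mod_cast (Finset.mem_range.1 hj).le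
      have h5 : h * j ≤ 1 / 2 := le_trans (by gcongr) hhN
      have : 0 ≤ h * j := by positivity
      nlinarith
    intro j hj j' hj'
    linarith [hs j hj, hs j' hj']
  set κ : ℕ → ℕ → ℝ := fun j j' => Real.sqrt (1 - (h * j) ^ 2 - (h * j') ^ 2) with hκdef
  have hAB : ∀ j j' : ℕ, ∃ AB : ℂ × ℂ, j ∈ Finset.range (N + 1) → j' ∈ Finset.range (N + 1) →
      ∀ γ ≤ 1, AB.1 * (Complex.I * (lam * κ j j' : ℝ)) ^ γ +
        AB.2 * (-(Complex.I * (lam * κ j j' : ℝ))) ^ γ = if γ = γ₀ then 1 else 0 := by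
    intro j j'
    by_cases hj : j ∈ Finset.range (N + 1) ∧ j' ∈ Finset.range (N + 1)
    · have hz : Complex.I * (lam * κ j j' : ℝ) ≠ 0 := by
        have : 0 < κ j j' := Real.sqrt_pos.2 (by linarith [hκ j hj.1 j' hj.2])
        refine mul_ne_zero Complex.I_ne_zero ?_
        exact_mod_cast mul_ne_zero hlam this.ne'
      obtain ⟨A, B, h⟩ := exists_parity_coeff hz hγ₀
      exact ⟨(A, B), fun _ _ => h⟩
    · exact ⟨(0, 0), fun h1 h2 => absurd ⟨h1, h2⟩ hj⟩
  choose AB hAB using hAB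
  let ξ : ℝ → ℕ → ℕ → E3 := fun σ j j' => !₂[lam * (h * j), lam * (h * j'), lam * (σ * κ j j')]
  have hξ : ∀ σ : ℝ, σ ^ 2 = 1 → ∀ j ∈ Finset.range (N + 1), ∀ j' ∈ Finset.range (N + 1),
      planeWave (ξ σ j j') ∈ waveSpan {ξ | ‖ξ‖ = |lam|} := by
    intro σ hσ j hj j' hj'
    refine Submodule.subset_span ⟨_, ?_, rfl⟩
    change ‖ξ σ j j'‖ = |lam|
    rw [← abs_of_nonneg (norm_nonneg (ξ σ j j')), ← sq_eq_sq_iff_abs_eq_abs,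
      EuclideanSpace.norm_sq_eq, Fin.sum_univ_three]
    simp only [ξ, Real.norm_eq_abs, sq_abs]
    have h6 : κ j j' ^ 2 = 1 - (h * j) ^ 2 - (h * j') ^ 2 :=
      Real.sq_sqrt (by linarith [hκ j hj j' hj'])
    simp
    rw [mul_pow, mul_pow lam, mul_pow lam, mul_pow σ, hσ, h6]
    ring
  let F : E3 → ℂ := fun x => ∑ j ∈ Finset.range (N + 1), ∑ j' ∈ Finset.range (N + 1),
    (c j * c' j') * ((AB j j').1 * planeWave (ξ 1 j j') x +
      (AB j j').2 * planeWave (ξ (-1) j j') x)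
  have hFmem : F ∈ waveSpan {ξ | ‖ξ‖ = |lam|} := by
    have : F = ∑ j ∈ Finset.range (N + 1), ∑ j' ∈ Finset.range (N + 1),
        (c j * c' j') • ((AB j j').1 • planeWave (ξ 1 j j') +
          (AB j j').2 • planeWave (ξ (-1) j j')) := by
      ext x; simp [F, mul_add]
    rw [this]
    exact Submodule.sum_mem _ fun j hj => Submodule.sum_mem _ fun j' hj' =>
      Submodule.smul_mem _ _ (Submodule.add_mem _
        (Submodule.smul_mem _ _ (hξ 1 (by norm_num) j hj j' hj'))
        (Submodule.smul_mem _ _ (hξ (-1) (by norm_num) j hj j' hj')))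
  refine ⟨F, hFmem, fun l hl => ?_⟩
  have cd : ∀ (σ : ℝ) (j j' : ℕ) (z : ℂ), ContDiff ℝ ∞ fun x => z * planeWave (ξ σ j j') x :=
    fun σ j j' z => contDiff_const.mul (contDiff_planeWave _)
  have cd2 : ∀ j j' : ℕ, ContDiff ℝ ∞ fun x => (AB j j').1 * planeWave (ξ 1 j j') x +
      (AB j j').2 * planeWave (ξ (-1) j j') x := fun j j' => (cd _ _ _ _).add (cd _ _ _ _)
  have cd3 : ∀ j j' : ℕ, ContDiff ℝ ∞ fun x => (c j * c' j') * ((AB j j').1 *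
      planeWave (ξ 1 j j') x + (AB j j').2 * planeWave (ξ (-1) j j') x) :=
    fun j j' => contDiff_const.mul (cd2 j j')
  set P := ∑ j ∈ Finset.range (N + 1), c j * (Complex.I * (lam * (h * j) : ℝ)) ^ l.count 0
    with hP
  set Q := ∑ j ∈ Finset.range (N + 1), c' j * (Complex.I * (lam * (h * j) : ℝ)) ^ l.count 1
    with hQ
  have hdata : pdl l F 0 = P * Q * (if l.count 2 = γ₀ then 1 else 0) := by
    have e1 : pdl l F = fun x => ∑ j ∈ Finset.range (N + 1), ∑ j' ∈ Finset.range (N + 1),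
        (c j * c' j') * ((AB j j').1 * pdl l (planeWave (ξ 1 j j')) x +
          (AB j j').2 * pdl l (planeWave (ξ (-1) j j')) x) := by
      rw [pdl_sum _ fun j _ => ContDiff.sum fun j' _ => cd3 j j']
      simp only [pdl_sum _ fun j' _ => cd3 _ j', pdl_const_mul (cd2 _ _),
        pdl_add (cd _ _ _ _) (cd _ _ _ _), pdl_const_mul (contDiff_planeWave _)]
    rw [e1, hP, hQ, Finset.sum_mul_sum, Finset.sum_mul]
    refine Finset.sum_congr rfl fun j hj => ?_
    rw [Finset.sum_mul]
    refine Finset.sum_congr rfl fun j' hj' => ?_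
    rw [← hAB j j' hj hj' _ hl, pdl_planeWave_zero, pdl_planeWave_zero]
    simp [ξ]
    ring
  rw [hdata, ← sub_mul, norm_mul]
  have hPQ := norm_mul_sub_ite_le hh0.le hh1
    (one_le_mul_of_one_le_of_one_le hC₁ (one_le_pow₀ hM₁ (n := l.count 0)))
    (one_le_mul_of_one_le_of_one_le hC₂ (one_le_pow₀ hM₂ (n := l.count 1)))
    (hc (l.count 0)) (hc' (l.count 1))
  have hone : ‖(if l.count 2 = γ₀ then 1 else 0 : ℂ)‖ ≤ 1 := by split_ifs <;> simp
  refine (mul_le_of_le_one_right (norm_nonneg _) hone).trans (hPQ.trans ?_)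
  have hlen := count_add_count_add_count l
  have g1 : M₁ ^ l.count 0 ≤ M₁ ^ l.length := pow_le_pow_right₀ hM₁ (by omega)
  have g2 : M₂ ^ l.count 1 ≤ M₂ ^ l.length := pow_le_pow_right₀ hM₂ (by omega)
  have g3 : M₁ ^ l.length * M₂ ^ l.length ≤
      Real.exp (M₁ * M₂ * K) * (l.length ! / K ^ l.length) := by
    have := Real.pow_div_factorial_le_exp (M₁ * M₂ * K) (by positivity) l.length
    rw [div_le_iff₀ (by positivity), mul_pow, mul_pow] at this
    rw [← mul_div_assoc, le_div_iff₀ (by positivity)]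
    exact this
  calc 3 * h * (C₁ * M₁ ^ l.count 0 * (C₂ * M₂ ^ l.count 1))
      ≤ 3 * h * (C₁ * M₁ ^ l.length * (C₂ * M₂ ^ l.length)) := by gcongr
    _ = 3 * h * (C₁ * C₂) * (M₁ ^ l.length * M₂ ^ l.length) := by ring
    _ ≤ 3 * h * (C₁ * C₂) * (Real.exp (M₁ * M₂ * K) * (l.length ! / K ^ l.length)) := by gcongr
    _ = h * E * (l.length ! / K ^ l.length) := by rw [hE]; ring
    _ ≤ _ := by gcongr

theorem perm_replicate_append (l : List (Fin 3)) :
    l.Perm (List.replicate (l.count 0) 0 ++ (List.replicate (l.count 1) 1 ++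
      List.replicate (l.count 2) 2)) := by
  rw [List.perm_iff_count]
  intro i
  fin_cases i <;> simp [List.count_replicate]

/-- Solutions of the Helmholtz equation are locally uniform limits of sums of plane waves. -/
theorem IsHelmholtz.exists_waveSpan_approx {lam : ℝ} (hlam : lam ≠ 0) {u : E3 → ℂ}
    (hu : IsHelmholtz lam u) {R ε : ℝ} (hR : 0 < R) (hε : 0 < ε) :
    ∃ F ∈ waveSpan {ξ | ‖ξ‖ = |lam|}, ∀ x : E3, ‖x‖ ≤ R → ‖u x - F x‖ ≤ ε := by
  set C : ℝ := Real.exp (3 * R * (2 + lam ^ 2)) + 2 with hC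
  have hCpos : 0 < C := by positivity
  set K : ℝ := 2 * (3 * R * (2 + lam ^ 2)) with hK
  have hKpos : 0 < K := by positivity
  obtain ⟨N, hN⟩ := hu.exists_norm_pdl_tail_le hKpos (show 0 < ε / C / 2 by positivity)
  let d : ℕ × ℕ × ℕ → ℂ := fun q => pdl (List.replicate q.1 0 ++ (List.replicate q.2.1 1 ++
      List.replicate q.2.2 2)) u 0
  let T : Finset (ℕ × ℕ × ℕ) := Finset.range (N + 1) ×ˢ (Finset.range (N + 1) ×ˢ Finset.range 2)
  let D : ℝ := ∑ q ∈ T, ‖d q‖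
  have hD : 0 ≤ D := Finset.sum_nonneg fun _ _ => norm_nonneg _
  have hex : ∀ q : ℕ × ℕ × ℕ, ∃ F ∈ waveSpan {ξ | ‖ξ‖ = |lam|}, q ∈ T → ∀ l : List (Fin 3),
      l.count 2 ≤ 1 → ‖pdl l F 0 - (if l.count 0 = q.1 then 1 else 0) *
        (if l.count 1 = q.2.1 then 1 else 0) * (if l.count 2 = q.2.2 then 1 else 0)‖ ≤
        ε / C / (2 * (D + 1)) * (l.length ! / K ^ l.length) := by
    intro q
    by_cases hq : q ∈ T
    · have hq' := hq
      simp only [T, Finset.mem_product, Finset.mem_range] at hq'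
      obtain ⟨F, hF, h⟩ := exists_wave_unit_data hlam (N := N) (a₀ := q.1) (b₀ := q.2.1)
        (γ₀ := q.2.2) (by omega) (by omega) (by omega) hKpos
        (show 0 < ε / C / (2 * (D + 1)) by positivity)
      exact ⟨F, hF, fun _ => h⟩
    · exact ⟨0, Submodule.zero_mem _, fun h => absurd h hq⟩
  choose G hG hGd using hex
  have hGH : ∀ q, IsHelmholtz lam (G q) := fun q =>
    isHelmholtz_of_mem_waveSpan (fun ξ hξ => hξ) (hG q)
  let F : E3 → ℂ := fun x => ∑ q ∈ T, d q * G q x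
  have hFmem : F ∈ waveSpan {ξ | ‖ξ‖ = |lam|} := by
    have : F = ∑ q ∈ T, d q • G q := by ext x; simp [F]
    rw [this]
    exact Submodule.sum_mem _ fun q _ => Submodule.smul_mem _ _ (hG q)
  have hFH : IsHelmholtz lam F := isHelmholtz_of_mem_waveSpan (fun ξ hξ => hξ) hFmem
  refine ⟨F, hFmem, fun x hx => ?_⟩
  have key := (hu.sub hFH).norm_le_of_data hR (δ := ε / C) (by positivity) (fun l hl => ?_) hx
  · rwa [div_mul_cancel₀ _ hCpos.ne'] at key
  · rw [← hK, pdl_sub hu.1 hFH.1]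
    set w : ℝ := l.length ! / K ^ l.length with hw
    have hw0 : 0 ≤ w := by positivity
    have e1 : pdl l F 0 = ∑ q ∈ T, d q * pdl l (G q) 0 := by
      simp only [F]
      rw [pdl_sum _ fun q _ => contDiff_const.mul (hGH q).1]
      simp only [pdl_const_mul (hGH _).1]
    let e : ℕ × ℕ × ℕ → ℂ := fun q => (if l.count 0 = q.1 then 1 else 0) *
        (if l.count 1 = q.2.1 then 1 else 0) * (if l.count 2 = q.2.2 then 1 else 0)
    have he : ∀ q, e q = if (l.count 0, l.count 1, l.count 2) = q then 1 else 0 := by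
      rintro ⟨a, b, c⟩
      simp only [e, Prod.mk.injEq]
      by_cases h0 : l.count 0 = a <;> by_cases h1 : l.count 1 = b <;>
        by_cases h2 : l.count 2 = c <;> simp only [h0, h1, h2, if_true, if_false, mul_one, mul_zero,
          and_self, and_true, and_false]
    have e2 : ∑ q ∈ T, d q * e q =
        if (l.count 0, l.count 1, l.count 2) ∈ T then pdl l u 0 else 0 := by
      simp only [he, mul_ite, mul_one, mul_zero, Finset.sum_ite_eq]
      rw [pdl_perm hu.1 (perm_replicate_append l)]
    have h1 : ‖pdl l u 0 - ∑ q ∈ T, d q * e q‖ ≤ ε / C / 2 * w := by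
      rw [e2]
      split_ifs with hT
      · rw [sub_self, norm_zero]; positivity
      · rw [sub_zero]
        refine hN l ?_
        simp only [T, Finset.mem_product, Finset.mem_range] at hT
        have := count_add_count_add_count l
        omega
    have h2 : ‖∑ q ∈ T, d q * e q - pdl l F 0‖ ≤ ε / C / 2 * w := by
      rw [e1, ← Finset.sum_sub_distrib]
      refine (norm_sum_le _ _).trans ?_
      have h3 : ∀ q ∈ T, ‖d q * e q - d q * pdl l (G q) 0‖ ≤
          ‖d q‖ * (ε / C / (2 * (D + 1)) * w) := by
        intro q hq
        rw [← mul_sub, norm_mul, norm_sub_rev]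
        exact mul_le_mul_of_nonneg_left (hGd q hq l hl) (norm_nonneg _)
      refine (Finset.sum_le_sum h3).trans ?_
      rw [← Finset.sum_mul]
      change D * _ ≤ _
      have : D * (ε / C / (2 * (D + 1)) * w) = (ε / C / 2 * w) * (D / (D + 1)) := by field_simp
      rw [this]
      exact mul_le_of_le_one_right (by positivity) (div_le_one_of_le₀ (by linarith) (by linarith))
    calc ‖pdl l u 0 - pdl l F 0‖ ≤ _ := norm_sub_le_norm_sub_add_norm_sub _ _ _
      _ ≤ _ := add_le_add h1 h2
      _ = _ := by ring

/-- Wave vectors of length `|λ|` whose direction is an integer vector divided by `n`. -/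
def ratFreq (lam : ℝ) (n : ℕ) : Set E3 :=
  {ξ | ∃ k : Fin 3 → ℤ, ∑ i, k i ^ 2 = (n : ℤ) ^ 2 ∧ ξ = toE3 fun i => lam / n * k i}

theorem norm_of_mem_ratFreq {lam : ℝ} {n : ℕ} (hn : 0 < n) {ξ : E3} (hξ : ξ ∈ ratFreq lam n) :
    ‖ξ‖ = |lam| := by
  obtain ⟨k, hk, rfl⟩ := hξ
  have hn' : (n : ℝ) ≠ 0 := by exact_mod_cast hn.ne'
  have hk' : ∑ i, (k i : ℝ) ^ 2 = (n : ℝ) ^ 2 := by exact_mod_cast hk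
  rw [← abs_of_nonneg (norm_nonneg (toE3 _)), ← sq_eq_sq_iff_abs_eq_abs,
    EuclideanSpace.norm_sq_eq]
  have : ∀ i, ‖(toE3 fun i => lam / n * k i) i‖ ^ 2 = (lam / n) ^ 2 * (k i : ℝ) ^ 2 := by
    intro i
    rw [Real.norm_eq_abs, sq_abs, ← mul_pow]
    rfl
  simp only [this]
  rw [← Finset.mul_sum, hk', div_pow, div_mul_cancel₀ _ (pow_ne_zero 2 hn')]

theorem exists_forall_odd_int_near {η : E3} (hη : ‖η‖ = 1) {δ : ℝ} (hδ : 0 < δ) :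
    ∃ N : ℕ, ∀ n : ℕ, Odd n → N ≤ n → ∃ k : Fin 3 → ℤ, ∑ i, k i ^ 2 = (n : ℤ) ^ 2 ∧
      ‖(toE3 fun i => (k i : ℝ) / n) - η‖ < δ := by
  have hη2 : η 0 ^ 2 + η 1 ^ 2 + η 2 ^ 2 = 1 := by
    have := EuclideanSpace.norm_sq_eq η
    rw [hη, Fin.sum_univ_three] at this
    simpa using this.symm
  have hb : quat 0 (η 0) (η 1) (η 2) ∈ imSphere :=
    ⟨rfl, by rw [Quaternion.normSq_def']; simpa using hη2⟩
  obtain ⟨N, hN⟩ := exists_forall_odd_ratSphere hb hδ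
  refine ⟨N, fun n hn hNn => ?_⟩
  obtain ⟨x, ⟨hx0, hx1, ξ, hξ⟩, hxδ⟩ := hN n hn hNn
  have hn0 : (n : ℝ) ≠ 0 := by exact_mod_cast hn.pos.ne'
  have c1 := congrArg QuaternionAlgebra.imI hξ
  have c2 := congrArg QuaternionAlgebra.imJ hξ
  have c3 := congrArg QuaternionAlgebra.imK hξ
  simp only [Quaternion.imI_smul, Quaternion.imJ_smul, Quaternion.imK_smul, smul_eq_mul,
    lipCast_imI, lipCast_imJ, lipCast_imK] at c1 c2 c3
  rw [Quaternion.normSq_def', hx0] at hx1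
  refine ⟨![ξ.imI, ξ.imJ, ξ.imK], ?_, ?_⟩
  · have : (ξ.imI : ℝ) ^ 2 + (ξ.imJ : ℝ) ^ 2 + (ξ.imK : ℝ) ^ 2 = (n : ℝ) ^ 2 := by
      rw [← c1, ← c2, ← c3]
      linear_combination (n : ℝ) ^ 2 * hx1
    rw [Fin.sum_univ_three]
    simp only [Matrix.cons_val]
    exact_mod_cast this
  · rw [← sq_lt_sq₀ (norm_nonneg _) hδ.le] at hxδ ⊢
    refine lt_of_eq_of_lt ?_ hxδ
    rw [EuclideanSpace.norm_sq_eq, Fin.sum_univ_three, sq ‖x - quat 0 (η 0) (η 1) (η 2)‖,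
      ← Quaternion.normSq_eq_norm_mul_self, Quaternion.normSq_def']
    simp only [toE3, Real.norm_eq_abs, sq_abs]
    simp [← c1, ← c2, ← c3, hx0, hn0]

theorem norm_planeWave_sub_le (ξ ξ' x : E3) :
    ‖planeWave ξ x - planeWave ξ' x‖ ≤ ‖ξ - ξ'‖ * ‖x‖ := by
  have e : planeWave ξ x - planeWave ξ' x =
      planeWave ξ' x * (Complex.exp (Complex.I * (inner ℝ (ξ - ξ') x : ℝ)) - 1) := by
    rw [mul_sub, mul_one, planeWave, planeWave, ← Complex.exp_add, inner_sub_left]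
    push_cast
    ring_nf
  have h1 : ‖planeWave ξ' x‖ = 1 := by
    rw [planeWave, mul_comm, Complex.norm_exp_ofReal_mul_I]
  rw [e, norm_mul, h1, one_mul]
  refine (Real.norm_exp_I_mul_ofReal_sub_one_le).trans ?_
  exact norm_inner_le_norm _ _

theorem exists_ratFreq_approx {lam : ℝ} (hlam : lam ≠ 0) {F : E3 → ℂ}
    (hF : F ∈ waveSpan {ξ | ‖ξ‖ = |lam|}) {R : ℝ} (hR : 0 < R) : ∀ {ε : ℝ}, 0 < ε → ∃ N : ℕ,
    ∀ n : ℕ, Odd n → N ≤ n → ∃ F' ∈ waveSpan (ratFreq lam n),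
      ∀ x : E3, ‖x‖ ≤ R → ‖F x - F' x‖ ≤ ε := by
  induction hF using Submodule.span_induction with
  | mem F h =>
    intro ε hε
    obtain ⟨ξ, hξ, rfl⟩ := h
    have hl : 0 < |lam| := abs_pos.2 hlam
    have hη : ‖lam⁻¹ • ξ‖ = 1 := by
      rw [norm_smul, norm_inv, Real.norm_eq_abs, show ‖ξ‖ = |lam| from hξ, inv_mul_cancel₀ hl.ne']
    obtain ⟨N, hN⟩ := exists_forall_odd_int_near hη (δ := ε / (|lam| * R)) (by positivity)
    refine ⟨N, fun n hn hNn => ?_⟩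
    obtain ⟨k, hk, hkn⟩ := hN n hn hNn
    refine ⟨_, Submodule.subset_span ⟨_, ⟨k, hk, rfl⟩, rfl⟩, fun x hx => ?_⟩
    refine (norm_planeWave_sub_le _ _ _).trans ?_
    have e : ξ - (toE3 fun i => lam / n * k i) =
        (-lam) • ((toE3 fun i => (k i : ℝ) / n) - lam⁻¹ • ξ) := by
      rw [smul_sub, smul_smul, neg_mul, mul_inv_cancel₀ hlam]
      ext i
      simp [toE3]
      ring
    rw [e, norm_smul, norm_neg, Real.norm_eq_abs]
    calc _ ≤ |lam| * (ε / (|lam| * R)) * R := by gcongr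
      _ = ε := by field_simp
  | zero => exact fun hε => ⟨0, fun n _ _ => ⟨0, Submodule.zero_mem _, fun x _ => by simp [hε.le]⟩⟩
  | add F G _ _ h1 h2 =>
    intro ε hε
    obtain ⟨N₁, hN₁⟩ := h1 (half_pos hε)
    obtain ⟨N₂, hN₂⟩ := h2 (half_pos hε)
    refine ⟨max N₁ N₂, fun n hn hNn => ?_⟩
    obtain ⟨F', hF', hF'x⟩ := hN₁ n hn ((le_max_left _ _).trans hNn)
    obtain ⟨G', hG', hG'x⟩ := hN₂ n hn ((le_max_right _ _).trans hNn)
    refine ⟨F' + G', Submodule.add_mem _ hF' hG', fun x hx => ?_⟩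
    rw [Pi.add_apply, Pi.add_apply, add_sub_add_comm]
    exact (norm_add_le _ _).trans (by linarith [hF'x x hx, hG'x x hx])
  | smul c F _ h =>
    intro ε hε
    obtain ⟨N, hN⟩ := h (ε := ε / (‖c‖ + 1)) (by positivity)
    refine ⟨N, fun n hn hNn => ?_⟩
    obtain ⟨F', hF', hF'x⟩ := hN n hn hNn
    refine ⟨c • F', Submodule.smul_mem _ _ hF', fun x hx => ?_⟩
    rw [Pi.smul_apply, Pi.smul_apply, ← smul_sub, norm_smul]
    calc _ ≤ ‖c‖ * (ε / (‖c‖ + 1)) := by gcongr; exact hF'x x hx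
      _ = ε * (‖c‖ / (‖c‖ + 1)) := by ring
      _ ≤ ε := mul_le_of_le_one_right hε.le (div_le_one_of_le₀ (by linarith) (by positivity))

/-- The curl of a vector field given by its components. -/
def curlC (w : Fin 3 → E3 → ℝ) : Fin 3 → E3 → ℝ :=
  ![fun x => pdv 1 (w 2) x - pdv 2 (w 1) x, fun x => pdv 2 (w 0) x - pdv 0 (w 2) x,
    fun x => pdv 0 (w 1) x - pdv 1 (w 0) x]

/-- The projection onto `λ`-Beltrami fields of a field with Helmholtz components. -/
def beltramiProj (lam : ℝ) (w : Fin 3 → E3 → ℝ) (i : Fin 3) : E3 → ℝ :=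
  fun x => (2 * lam ^ 2)⁻¹ • (curlC (curlC w) i x + lam • curlC w i x)

section curlC

variable {w z : Fin 3 → E3 → ℝ} {lam : ℝ}

theorem curl3_toE3 (w : Fin 3 → E3 → ℝ) (x : E3) :
    curl3 (fun y => toE3 fun i => w i y) x = toE3 fun i => curlC w i x := by
  unfold curl3
  congr 1
  ext i
  fin_cases i <;> rfl

theorem contDiff_curlC (hw : ∀ i, ContDiff ℝ ∞ (w i)) (i : Fin 3) : ContDiff ℝ ∞ (curlC w i) := by
  fin_cases i <;> exact (contDiff_pdv (hw _) _).sub (contDiff_pdv (hw _) _)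

theorem IsHelmholtz.curlC_mem (hw : ∀ i, IsHelmholtz lam (w i)) (i : Fin 3) :
    IsHelmholtz lam (curlC w i) := by
  fin_cases i <;> exact ((hw _).pdv_mem _).sub ((hw _).pdv_mem _)

theorem curlC_add (hw : ∀ i, ContDiff ℝ ∞ (w i)) (hz : ∀ i, ContDiff ℝ ∞ (z i)) (i : Fin 3) :
    curlC (fun j x => w j x + z j x) i = fun x => curlC w i x + curlC z i x := by
  fin_cases i <;> ext x <;> simp only [curlC, pdv_add (hw _) (hz _), Fin.zero_eta, Fin.mk_one,
    Fin.reduceFinMk, Matrix.cons_val] <;> ring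

theorem curlC_const_smul (hw : ∀ i, ContDiff ℝ ∞ (w i)) (c : ℝ) (i : Fin 3) :
    curlC (fun j x => c • w j x) i = fun x => c • curlC w i x := by
  fin_cases i <;> ext x <;> simp only [curlC, pdv_const_smul (hw _), Fin.zero_eta, Fin.mk_one,
    Fin.reduceFinMk, Matrix.cons_val, smul_sub]

theorem curlC_sub (hw : ∀ i, ContDiff ℝ ∞ (w i)) (hz : ∀ i, ContDiff ℝ ∞ (z i)) (i : Fin 3) :
    curlC (fun j x => w j x - z j x) i = fun x => curlC w i x - curlC z i x := by
  fin_cases i <;> ext x <;> simp only [curlC, pdv_sub (hw _) (hz _), Fin.zero_eta, Fin.mk_one,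
    Fin.reduceFinMk, Matrix.cons_val] <;> ring

theorem sum_pdv_curlC (hw : ∀ i, ContDiff ℝ ∞ (w i)) (x : E3) : ∑ i, pdv i (curlC w i) x = 0 := by
  rw [Fin.sum_univ_three]
  simp only [curlC, Matrix.cons_val, pdv_sub (contDiff_pdv (hw _) _) (contDiff_pdv (hw _) _)]
  rw [pdv_comm (hw 2) 0 1, pdv_comm (hw 1) 0 2, pdv_comm (hw 0) 1 2]
  ring

theorem curlC_curlC (hw : ∀ i, ContDiff ℝ ∞ (w i)) (i : Fin 3) (x : E3) :
    curlC (curlC w) i x = pdv i (fun y => ∑ j, pdv j (w j) y) x - ∑ j, pdv j (pdv j (w i)) x := by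
  rw [pdv_sum _ fun j _ => contDiff_pdv (hw j) j]
  have h2 := fun i j k => congrFun (pdv_comm (hw i) j k) x
  have e0 := h2 1 1 0
  have e1 := h2 2 2 0
  have e2 := h2 0 1 0
  have e3 := h2 2 2 1
  have e4 := h2 0 2 0
  have e5 := h2 1 2 1
  simp only [Fin.sum_univ_three]
  fin_cases i <;> simp only [curlC, Fin.zero_eta, Fin.mk_one, Fin.reduceFinMk, Matrix.cons_val,
    pdv_sub (contDiff_pdv (hw _) _) (contDiff_pdv (hw _) _)] <;> linarith

theorem curlC_curlC_of_div_eq_zero (hw : ∀ i, IsHelmholtz lam (w i))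
    (hdiv : ∀ x, ∑ i, pdv i (w i) x = 0) (i : Fin 3) :
    curlC (curlC w) i = fun x => lam ^ 2 • w i x := by
  ext x
  rw [curlC_curlC (fun i => (hw i).1), (hw i).2, funext hdiv]
  simp [pdv]

theorem isHelmholtz_of_curlC_eq (hlam : lam ≠ 0) (hw : ∀ i, ContDiff ℝ ∞ (w i))
    (hc : ∀ i, curlC w i = fun x => lam • w i x) (i : Fin 3) : IsHelmholtz lam (w i) := by
  have hdiv : ∀ x, ∑ i, pdv i (w i) x = 0 := by
    intro x
    have h := sum_pdv_curlC hw x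
    simp only [hc, pdv_const_smul (hw _), ← Finset.smul_sum] at h
    exact (smul_eq_zero.1 h).resolve_left hlam
  refine ⟨hw i, fun x => ?_⟩
  have h := curlC_curlC hw i x
  rw [funext hdiv, funext hc, curlC_const_smul hw, hc] at h
  simp only [pdv, fderiv_fun_const, smul_eq_mul] at h ⊢
  simp only [Pi.zero_apply, zero_apply] at h
  linarith

theorem IsHelmholtz.beltramiProj_mem (hw : ∀ i, IsHelmholtz lam (w i)) (i : Fin 3) :
    IsHelmholtz lam (beltramiProj lam w i) :=
  ((curlC_mem (curlC_mem hw) i).add ((curlC_mem hw i).clm (lam • .id ℝ ℝ))).clm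
    ((2 * lam ^ 2)⁻¹ • .id ℝ ℝ)

theorem curlC_beltramiProj (hw : ∀ i, IsHelmholtz lam (w i)) (i : Fin 3) :
    curlC (beltramiProj lam w) i = fun x => lam • beltramiProj lam w i x := by
  have h1 := fun i => (IsHelmholtz.curlC_mem hw i).1
  have h2 := contDiff_curlC h1
  have h3 : ∀ i, ContDiff ℝ ∞ fun x => lam • curlC w i x := fun i => (h1 i).const_smul lam
  have h4 := fun i => curlC_curlC_of_div_eq_zero (IsHelmholtz.curlC_mem hw)
    (sum_pdv_curlC fun i => (hw i).1) i
  unfold beltramiProj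
  rw [curlC_const_smul (fun i => (h2 i).add (h3 i)), curlC_add h2 h3, curlC_const_smul h1, h4]
  ext x
  simp only [smul_eq_mul]
  ring

theorem beltramiProj_eq_self (hlam : lam ≠ 0) (hw : ∀ i, ContDiff ℝ ∞ (w i))
    (hc : ∀ i, curlC w i = fun x => lam • w i x) (i : Fin 3) : beltramiProj lam w i = w i := by
  ext x
  rw [beltramiProj, funext hc, curlC_const_smul hw, hc]
  simp only [smul_eq_mul]
  field_simp
  ring

theorem beltramiProj_sub (hw : ∀ i, ContDiff ℝ ∞ (w i)) (hz : ∀ i, ContDiff ℝ ∞ (z i))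
    (i : Fin 3) : beltramiProj lam (fun j x => w j x - z j x) i =
      fun x => beltramiProj lam w i x - beltramiProj lam z i x := by
  ext x
  rw [beltramiProj, beltramiProj, beltramiProj, funext (curlC_sub hw hz),
    curlC_sub (contDiff_curlC hw) (contDiff_curlC hz)]
  simp only [smul_eq_mul]
  ring

theorem abs_curlC_le (hw : ∀ i, IsHelmholtz lam (w i)) {R S : ℝ}
    (hS : ∀ i x, ‖x‖ ≤ R + 1 → |w i x| ≤ S) (i : Fin 3) {x : E3} (hx : ‖x‖ ≤ R) :
    |curlC w i x| ≤ 2 * (5 + 2 * |lam|) * S := by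
  have h : ∀ i j, |pdv i (w j) x| ≤ (5 + 2 * |lam|) * S := by
    intro i j
    have := (hw j).abs_pdv_le (c := x) one_pos (S := S) (fun y hy => hS j y ?_) i
    · simpa using this
    · rw [mem_closedBall_iff_norm] at hy
      linarith [norm_le_norm_add_norm_sub' y x]
  have h2 : ∀ i j k l, |pdv i (w j) x - pdv k (w l) x| ≤ 2 * (5 + 2 * |lam|) * S := by
    intro i j k l
    refine (abs_sub _ _).trans ?_
    linarith [h i j, h k l]
  fin_cases i <;> exact h2 _ _ _ _

theorem abs_beltramiProj_le (hw : ∀ i, IsHelmholtz lam (w i)) {R S : ℝ}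
    (hS : ∀ i x, ‖x‖ ≤ R + 2 → |w i x| ≤ S) (i : Fin 3) {x : E3} (hx : ‖x‖ ≤ R) :
    |beltramiProj lam w i x| ≤ (2 * lam ^ 2)⁻¹ * ((2 * (5 + 2 * |lam|)) ^ 2 +
      |lam| * (2 * (5 + 2 * |lam|))) * S := by
  have h1 : ∀ i x, ‖x‖ ≤ R + 1 → |curlC w i x| ≤ 2 * (5 + 2 * |lam|) * S :=
    fun i x hx => abs_curlC_le hw (R := R + 1) (fun i x hx => hS i x (by linarith)) i hx
  have h2 := abs_curlC_le (IsHelmholtz.curlC_mem hw) h1 i hx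
  have h3 := h1 i x (by linarith)
  rw [beltramiProj, smul_eq_mul, smul_eq_mul, abs_mul, abs_of_nonneg (by positivity), mul_assoc]
  refine mul_le_mul_of_nonneg_left ?_ (by positivity)
  refine (abs_add_le _ _).trans ?_
  rw [abs_mul]
  nlinarith [mul_le_mul_of_nonneg_left h3 (abs_nonneg lam)]

end curlC

section pdl

variable {G H : Type*} [NormedAddCommGroup G] [NormedSpace ℝ G]
  [NormedAddCommGroup H] [NormedSpace ℝ H] {f : E3 → G}

theorem pdl_clm (hf : ContDiff ℝ ∞ f) (L : G →L[ℝ] H) (l : List (Fin 3)) :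
    pdl l (fun x => L (f x)) = fun x => L (pdl l f x) := by
  induction l with
  | nil => rfl
  | cons i l ih => simp only [pdl, ih, pdv_clm (contDiff_pdl hf l)]

theorem fderiv_eq_sum_pdv (f : E3 → G) : fderiv ℝ f = fun x => ∑ i,
    ContinuousLinearMap.smulRightL ℝ E3 G (EuclideanSpace.proj i) (pdv i f x) := by
  ext x y
  have h := congrFun (dirD_eq_sum y f) x
  rw [dirD] at h
  rw [h, sum_apply]
  rfl

theorem norm_iteratedFDeriv_le_of_pdl (hf : ContDiff ℝ ∞ f) {n : ℕ} {x : E3} {M : ℝ}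
    (hM : ∀ l : List (Fin 3), l.length = n → ‖pdl l f x‖ ≤ M) :
    ‖iteratedFDeriv ℝ n f x‖ ≤ 3 ^ n * M := by
  induction n generalizing f with
  | zero => simpa [pdl] using hM [] rfl
  | succ n ih =>
    have hL : ∀ i : Fin 3, ContDiff ℝ n (fun x =>
        ContinuousLinearMap.smulRightL ℝ E3 G (EuclideanSpace.proj i) (pdv i f x)) := fun i =>
      (ContinuousLinearMap.contDiff _).comp ((contDiff_pdv hf i).of_le (by exact_mod_cast le_top))
    rw [← norm_iteratedFDeriv_fderiv, fderiv_eq_sum_pdv,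
      iteratedFDeriv_fun_sum_apply fun i _ => (hL i).contDiffAt]
    refine (norm_sum_le _ _).trans ((Finset.sum_le_card_nsmul _ _ (3 ^ n * M) fun i _ => ?_).trans_eq
      (by simp; ring))
    have h1 := ContinuousLinearMap.norm_iteratedFDeriv_comp_left
      (ContinuousLinearMap.smulRightL ℝ E3 G (EuclideanSpace.proj i)) (x := x)
      (contDiff_pdv hf i).contDiffAt (n := n) (N := ∞) (by exact_mod_cast le_top)
    refine h1.trans ((mul_le_of_le_one_left (norm_nonneg _) ?_).trans (ih (contDiff_pdv hf i) ?_))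
    · refine ContinuousLinearMap.opNorm_le_bound _ zero_le_one fun g => ?_
      rw [ContinuousLinearMap.smulRightL_apply_apply, ContinuousLinearMap.norm_smulRight_apply]
      refine mul_le_mul_of_nonneg_right ?_ (norm_nonneg _)
      exact ContinuousLinearMap.opNorm_le_bound _ zero_le_one fun y => by
        simpa using PiLp.norm_apply_le y i
    · intro l hl
      have := hM (l ++ [i]) (by simp [hl])
      rwa [pdl_append] at this

theorem pdv_comp_add_right (f : E3 → G) (i : Fin 3) (a : E3) :
    pdv i (fun x => f (x + a)) = fun x => pdv i f (x + a) := by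
  ext x
  simp only [pdv, fderiv_comp_add_right]

theorem pdv_comp_smul (f : E3 → G) (i : Fin 3) (c : ℝ) :
    pdv i (fun x => f (c • x)) = fun x => c • pdv i f (c • x) := by
  ext x
  simp only [pdv, fderiv_comp_smul]
  rfl

end pdl

theorem toE3_apply (v : Fin 3 → ℝ) (i : Fin 3) : toE3 v i = v i := rfl

theorem contDiff_toE3 {w : Fin 3 → E3 → ℝ} (hw : ∀ i, ContDiff ℝ ∞ (w i)) :
    ContDiff ℝ ∞ fun x => toE3 fun i => w i x :=
  contDiff_euclidean.2 hw

theorem norm_toE3_le {v : Fin 3 → ℝ} {S : ℝ} (hv : ∀ i, |v i| ≤ S) : ‖toE3 v‖ ≤ 3 * S := by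
  have hS : 0 ≤ S := (abs_nonneg _).trans (hv 0)
  rw [← sq_le_sq₀ (norm_nonneg _) (by positivity), EuclideanSpace.norm_sq_eq, Fin.sum_univ_three]
  have h : ∀ i, ‖toE3 v i‖ ^ 2 ≤ S ^ 2 := fun i => by
    rw [toE3_apply, Real.norm_eq_abs]; gcongr; exact hv i
  nlinarith [h 0, h 1, h 2]

theorem pdl_toE3 {w : Fin 3 → E3 → ℝ} (hw : ∀ i, ContDiff ℝ ∞ (w i)) (l : List (Fin 3)) (x : E3) :
    pdl l (fun x => toE3 fun i => w i x) x = toE3 fun i => pdl l (w i) x := by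
  ext i
  exact (congrFun (pdl_clm (contDiff_toE3 hw) (EuclideanSpace.proj (𝕜 := ℝ) i) l) x).symm

theorem curlC_comp_smul (w : Fin 3 → E3 → ℝ) (c : ℝ) (i : Fin 3) (x : E3) :
    curlC (fun j y => w j (c • y)) i x = c * curlC w i (c • x) := by
  fin_cases i <;> simp only [curlC, pdv_comp_smul, Fin.zero_eta, Fin.mk_one, Fin.reduceFinMk,
    Matrix.cons_val, smul_eq_mul] <;> ring

theorem curlC_add_right {w : Fin 3 → E3 → ℝ} {a : E3} (hw : ∀ i x, w i (x + a) = w i x)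
    (i : Fin 3) (x : E3) : curlC w i (x + a) = curlC w i x := by
  have h : ∀ j k, pdv k (w j) (x + a) = pdv k (w j) x := fun j k => by
    rw [← congrFun (pdv_comp_add_right (w j) k a) x, funext (hw j)]
  fin_cases i <;> simp only [curlC, h, Fin.zero_eta, Fin.mk_one, Fin.reduceFinMk, Matrix.cons_val]

theorem beltramiProj_add_right {lam : ℝ} {w : Fin 3 → E3 → ℝ} {a : E3}
    (hw : ∀ i x, w i (x + a) = w i x) (i : Fin 3) (x : E3) :
    beltramiProj lam w i (x + a) = beltramiProj lam w i x := by
  rw [beltramiProj, beltramiProj, curlC_add_right hw, curlC_add_right (curlC_add_right hw)]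

theorem IsHelmholtz.abs_pdl_le {lam : ℝ} {f : E3 → ℝ} (hf : IsHelmholtz lam f) {R S : ℝ}
    (hS : ∀ x, ‖x‖ ≤ R + 1 → |f x| ≤ S) (l : List (Fin 3)) {x : E3} (hx : ‖x‖ ≤ R) :
    |pdl l f x| ≤ (5 * l.length + 2 * |lam|) ^ l.length * S := by
  have h := (hf.clm Complex.ofRealCLM).norm_pdl_le one_pos l (c := x) (S := S) fun y hy => ?_
  · rw [pdl_clm hf.1] at h
    simpa using h
  · rw [mem_closedBall_iff_norm] at hy
    simpa using hS y (by linarith [norm_le_norm_add_norm_sub' y x])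

theorem waveSpan_ratFreq_add_right {lam : ℝ} (hlam : lam ≠ 0) {n : ℕ} (hn : 0 < n) {F : E3 → ℂ}
    (hF : F ∈ waveSpan (ratFreq lam n)) (k : Fin 3 → ℤ) (x : E3) :
    F (x + (n / lam) • toE3 fun i => 2 * Real.pi * k i) = F x := by
  induction hF using Submodule.span_induction with
  | mem F h =>
    obtain ⟨_, ⟨q, _, rfl⟩, rfl⟩ := h
    have hn' : (n : ℝ) ≠ 0 := by exact_mod_cast hn.ne'
    have e : inner ℝ (toE3 fun i => lam / n * q i)
        (((n : ℝ) / lam) • toE3 fun i => 2 * Real.pi * k i) =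
          ((∑ i, q i * k i : ℤ) : ℝ) * (2 * Real.pi) := by
      rw [inner_smul_right, PiLp.inner_apply]
      push_cast
      rw [Finset.mul_sum, Finset.sum_mul]
      refine Finset.sum_congr rfl fun i _ => ?_
      rw [toE3_apply, toE3_apply, RCLike.inner_apply, conj_trivial]
      field_simp
    rw [planeWave, planeWave, inner_add_right, e, Complex.exp_eq_exp_iff_exists_int]
    exact ⟨∑ i, q i * k i, by push_cast; ring⟩
  | zero => rfl
  | add F G _ _ h1 h2 => rw [Pi.add_apply, Pi.add_apply, h1, h2]
  | smul c F _ h => rw [Pi.smul_apply, Pi.smul_apply, h]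

/-- Fields with Helmholtz components are approximated, componentwise and uniformly on balls, by
real parts of combinations of plane waves with wave vectors in `ratFreq lam n`. -/
theorem IsHelmholtz.exists_ratFreq_approx {lam : ℝ} (hlam : lam ≠ 0) {w : Fin 3 → E3 → ℝ}
    (hw : ∀ i, IsHelmholtz lam (w i)) {R S : ℝ} (hR : 0 < R) (hS : 0 < S) : ∃ N : ℕ, ∀ n : ℕ,
    Odd n → N ≤ n → ∃ v : Fin 3 → E3 → ℝ, (∀ i, IsHelmholtz lam (v i)) ∧
      (∀ i (k : Fin 3 → ℤ) x,
        v i (x + ((n : ℝ) / lam) • toE3 fun i => 2 * Real.pi * k i) = v i x) ∧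
      ∀ i x, ‖x‖ ≤ R → |v i x - w i x| ≤ S := by
  have h1 : ∀ i, ∃ N : ℕ, ∀ n : ℕ, Odd n → N ≤ n → ∃ F ∈ waveSpan (ratFreq lam n),
      ∀ x : E3, ‖x‖ ≤ R → ‖(w i x : ℂ) - F x‖ ≤ S := by
    intro i
    obtain ⟨F, hF, hFx⟩ := ((hw i).clm Complex.ofRealCLM).exists_waveSpan_approx hlam hR
      (half_pos hS)
    obtain ⟨N, hN⟩ := _root_.exists_ratFreq_approx hlam hF hR (half_pos hS)
    refine ⟨N, fun n hn hNn => ?_⟩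
    obtain ⟨F', hF', hF'x⟩ := hN n hn hNn
    refine ⟨F', hF', fun x hx => ?_⟩
    have h2 := norm_sub_le_norm_sub_add_norm_sub (w i x : ℂ) (F x) (F' x)
    have h3 := hFx x hx
    rw [Complex.ofRealCLM_apply] at h3
    linarith [hF'x x hx]
  choose N hN using h1
  refine ⟨∑ i, N i, fun n hn hNn => ?_⟩
  have h2 := fun i => hN i n hn
    ((Finset.single_le_sum (fun j _ => Nat.zero_le (N j)) (Finset.mem_univ i)).trans hNn)
  choose F hF hFx using h2
  refine ⟨fun i x => Complex.reCLM (F i x), fun i => ?_, fun i k x => ?_, fun i x hx => ?_⟩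
  · exact (isHelmholtz_of_mem_waveSpan (fun ξ hξ => norm_of_mem_ratFreq hn.pos hξ) (hF i)).clm _
  · simp only [waveSpan_ratFreq_add_right hlam hn.pos (hF i)]
  · rw [abs_sub_comm]
    refine le_trans ?_ (hFx i x hx)
    simpa using Complex.abs_re_le_norm ((w i x : ℂ) - F i x)

theorem toE3_eta (f : E3 → E3) : (fun x => toE3 fun i => f x i) = f := rfl

theorem curlC_eq_of_curl3_eq {lam : ℝ} {u : E3 → E3} (h : ∀ x, curl3 u x = lam • u x)
    (i : Fin 3) : curlC (fun i x => u x i) i = fun x => lam • u x i := by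
  ext x
  have h1 := h x
  rw [← toE3_eta u, curl3_toE3] at h1
  exact congrArg (fun y : E3 => y i) h1

theorem IsHelmholtz.norm_iteratedFDeriv_toE3_le {lam : ℝ} {w : Fin 3 → E3 → ℝ}
    (hw : ∀ i, IsHelmholtz lam (w i)) {R S : ℝ} (hS : ∀ i x, ‖x‖ ≤ R + 1 → |w i x| ≤ S)
    (n : ℕ) {x : E3} (hx : ‖x‖ ≤ R) :
    ‖iteratedFDeriv ℝ n (fun x => toE3 fun i => w i x) x‖ ≤
      3 ^ n * (3 * ((5 * n + 2 * |lam|) ^ n * S)) := by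
  refine norm_iteratedFDeriv_le_of_pdl (contDiff_toE3 fun i => (hw i).1) fun l hl => ?_
  rw [pdl_toE3 fun i => (hw i).1]
  refine norm_toE3_le fun i => ?_
  have := (hw i).abs_pdl_le (hS i) l hx
  rwa [hl] at this

end

/-- Inverse localization: Beltrami fields on `ℝ³` are approximated by rescaled
high-frequency Beltrami fields on the torus. -/
theorem stmt11
    (lam : ℝ) (hlam : lam ≠ 0)
    (u : E3 → E3) (hu : ContDiff ℝ (⊤ : ℕ∞) u)
    (hbeltrami : ∀ x, curl3 u x = lam • u x)
    (ε' : ℝ) (hε' : 0 < ε') (m : ℕ) (R : ℝ) (hR : 0 < R) :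
    ∃ J₀ : ℤ, ∀ J : ℤ, Odd J → J₀ ≤ J →
      ∃ U : E3 → E3, ContDiff ℝ (⊤ : ℕ∞) U ∧
        (∀ (x : E3) (k : Fin 3 → ℤ), U (x + toE3 (fun i => 2 * Real.pi * (k i))) = U x) ∧
        (∀ x, curl3 U x = (J : ℝ) • U x) ∧
        (∀ x : E3, ‖x‖ ≤ R → ∀ j ≤ m,
          ‖iteratedFDeriv ℝ j (fun y => U ((lam / (J : ℝ)) • y) - u y) x‖ ≤ ε') := by
  have huc : ∀ i, ContDiff ℝ (⊤ : ℕ∞) fun x => u x i := contDiff_euclidean.1 hu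
  have hcu := curlC_eq_of_curl3_eq hbeltrami
  have hw := isHelmholtz_of_curlC_eq hlam huc hcu
  set C : ℝ := (2 * lam ^ 2)⁻¹ * ((2 * (5 + 2 * |lam|)) ^ 2 + |lam| * (2 * (5 + 2 * |lam|)))
  have hC : 0 ≤ C := by positivity
  set B : ℝ := ∑ j ∈ Finset.range (m + 1), (3 : ℝ) ^ j * (3 * (5 * j + 2 * |lam|) ^ j)
  have hB : 0 ≤ B := by positivity
  obtain ⟨N, hN⟩ := IsHelmholtz.exists_ratFreq_approx hlam hw (R := R + 3)
    (S := ε' / (B * C + 1)) (by positivity) (by positivity)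
  refine ⟨max N 1, fun J hJ hNJ => ?_⟩
  obtain ⟨n, rfl⟩ := Int.eq_ofNat_of_zero_le (by omega : 0 ≤ J)
  have hn : 0 < n := by omega
  have hn' : (n : ℝ) ≠ 0 := by exact_mod_cast hn.ne'
  obtain ⟨v, hv, hvper, hvu⟩ := hN n (by exact_mod_cast hJ) (by omega)
  rw [Int.cast_natCast]
  have hP := IsHelmholtz.beltramiProj_mem hv
  refine ⟨fun x => toE3 fun i => beltramiProj lam v i (((n : ℝ) / lam) • x), ?_, ?_, ?_, ?_⟩
  · exact (contDiff_toE3 fun i => (hP i).1).comp (contDiff_id.const_smul _)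
  · intro x k
    simp only [smul_add, beltramiProj_add_right fun i => hvper i k]
  · intro x
    rw [curl3_toE3 (fun i y => beltramiProj lam v i (((n : ℝ) / lam) • y))]
    ext i
    rw [toE3_apply, curlC_comp_smul, curlC_beltramiProj hv, PiLp.smul_apply, toE3_apply]
    simp only [smul_eq_mul]
    rw [← mul_assoc, div_mul_cancel₀ _ hlam]
  · intro x hx j hj
    have hd : ∀ i, IsHelmholtz lam fun x => v i x - u x i := fun i => (hv i).sub (hw i)
    have e : (fun y => (toE3 fun i => beltramiProj lam v i (((n : ℝ) / lam) • (lam / n) • y)) - u y)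
        = fun y => toE3 fun i => beltramiProj lam (fun i x => v i x - u x i) i y := by
      ext y i
      rw [toE3_apply, beltramiProj_sub (fun i => (hv i).1) huc,
        beltramiProj_eq_self hlam huc hcu, smul_smul, div_mul_div_cancel₀ hlam, div_self hn',
        one_smul]
      rfl
    rw [e]
    refine (IsHelmholtz.norm_iteratedFDeriv_toE3_le (IsHelmholtz.beltramiProj_mem hd)
      (fun i y hy => abs_beltramiProj_le hd (R := R + 1)
        (fun i z hz => hvu i z (by linarith)) i hy) j hx).trans ?_
    calc _ = (3 : ℝ) ^ j * (3 * (5 * j + 2 * |lam|) ^ j) * (C * (ε' / (B * C + 1))) := by ring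
      _ ≤ B * (C * (ε' / (B * C + 1))) := by
        gcongr
        exact Finset.single_le_sum
          (f := fun j : ℕ => (3 : ℝ) ^ j * (3 * (5 * j + 2 * |lam|) ^ j))
          (fun _ _ => by positivity) (Finset.mem_range.2 (by omega))
      _ = ε' * (B * C / (B * C + 1)) := by ring
      _ ≤ ε' := mul_le_of_le_one_right hε'.le
        (div_le_one_of_le₀ (by linarith) (by positivity))
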